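/- For every even integer n ≥ 342 there exists a cyclically 6-connected strictly critical snark of order n, i.e., a connected cubic simple graph G with n vertices that is not 3-edge-colourable, is cyclically 6-connected, and is critical but not bicritical. -/

import Mathlib

/-- The colour set `K = (ℤ₂ × ℤ₂) ∖ {(0,0)}`. -/
abbrev Kol : Type := {x : ZMod 2 × ZMod 2 // x ≠ 0}

/-- A proper edge colouring: distinct edges sharing a vertex get distinct colours. -/
def IsProperEdgeColoring {V C : Type*} (G : SimpleGraph V) (f : Sym2 V → C) : Prop :=
  ∀ e₁ ∈ G.edgeSet, ∀ e₂ ∈ G.edgeSet, e₁ ≠ e₂ → (∃ v : V, v ∈ e₁ ∧ v ∈ e₂) → f e₁ ≠ f e₂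

/-- A graph is 3-edge-colourable if it has a proper edge colouring with three colours. -/
def ThreeEdgeColorable {V : Type*} (G : SimpleGraph V) : Prop :=
  ∃ f : Sym2 V → Kol, IsProperEdgeColoring G f

/-- A graph is cubic if every vertex has degree 3. -/
def IsCubic {V : Type*} (G : SimpleGraph V) : Prop :=
  ∀ v : V, (G.neighborSet v).ncard = 3

/-- A snark: a connected cubic simple graph which is not 3-edge-colourable. -/
def IsSnark {V : Type*} (G : SimpleGraph V) : Prop :=
  G.Connected ∧ IsCubic G ∧ ¬ ThreeEdgeColorable G

/-- A snark is critical if removing any two distinct adjacent vertices yields a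
3-edge-colourable graph. -/
def Critical {V : Type*} (G : SimpleGraph V) : Prop :=
  ∀ u v : V, G.Adj u v → ThreeEdgeColorable (G.induce ({u, v}ᶜ : Set V))

/-- A snark is bicritical if removing any two distinct vertices yields a
3-edge-colourable graph. -/
def Bicritical {V : Type*} (G : SimpleGraph V) : Prop :=
  ∀ u v : V, u ≠ v → ThreeEdgeColorable (G.induce ({u, v}ᶜ : Set V))

/-- Strictly critical: critical but not bicritical. -/
def StrictlyCritical {V : Type*} (G : SimpleGraph V) : Prop :=
  Critical G ∧ ¬ Bicritical G

/-- A cubic graph is cyclically `k`-connected if no set of fewer than `k` edges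
separates two cycles, i.e. there is no set `F` of fewer than `k` edges whose deletion
leaves a graph in which two connected components contain a cycle. -/
def CyclicallyConnected {V : Type*} (G : SimpleGraph V) (k : ℕ) : Prop :=
  ¬ ∃ F : Set (Sym2 V), F ⊆ G.edgeSet ∧ F.ncard < k ∧
    ∃ a b : V, (∃ w : (G.deleteEdges F).Walk a a, w.IsCycle) ∧
               (∃ w : (G.deleteEdges F).Walk b b, w.IsCycle) ∧
               ¬ (G.deleteEdges F).Reachable a b

/-- The cyclic connectivity of a cubic graph: the largest `k` (at most the number of
edges) such that the graph is cyclically `k`-connected. -/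
noncomputable def cyclicConnectivity {V : Type*} (G : SimpleGraph V) : ℕ :=
  sSup {k | k ≤ G.edgeSet.ncard ∧ CyclicallyConnected G k}

open Function

/-- A cubic simple graph presented by its darts: the dart `(v, i)` leaves the vertex `v`
through its `i`-th port, and `flip` reverses darts. -/
structure DartGraph (V : Type) where
  flip : V × Fin 3 → V × Fin 3
  flip_flip : ∀ d, flip (flip d) = d
  port_eq : ∀ v i j, (flip (v, i)).1 = (flip (v, j)).1 → i = j
  loopless : ∀ d, (flip d).1 ≠ d.1

namespace DartGraph

variable {V : Type} (G : DartGraph V)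

/-- The underlying simple graph. -/
def toGraph : SimpleGraph V where
  Adj u v := ∃ i, (G.flip (u, i)).1 = v
  symm := ⟨by
    rintro u v ⟨i, rfl⟩
    exact ⟨(G.flip (u, i)).2, by simp [G.flip_flip]⟩⟩
  loopless := ⟨by
    rintro u ⟨i, hi⟩
    exact G.loopless _ hi⟩

theorem toGraph_adj {u v : V} : G.toGraph.Adj u v ↔ ∃ i, (G.flip (u, i)).1 = v := Iff.rfl

theorem isCubic : IsCubic G.toGraph := by
  intro v
  have : G.toGraph.neighborSet v = Set.range fun i => (G.flip (v, i)).1 := by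
    ext u; simp [toGraph_adj]
  rw [this, ← Set.image_univ, Set.ncard_image_of_injective _ fun i j h => G.port_eq v i j h]
  simp

/-- A proper 3-edge-colouring of the darts of `G` off the vertex set `X`. -/
structure IsCol (X : Set V) (h : V × Fin 3 → Fin 3) : Prop where
  inj : ∀ v ∉ X, Injective fun i => h (v, i)
  flip : ∀ d, d.1 ∉ X → (G.flip d).1 ∉ X → h (G.flip d) = h d

theorem dart_unique {d d' : V × Fin 3} (h : s(d.1, (G.flip d).1) = s(d'.1, (G.flip d').1)) :
    d' = d ∨ d' = G.flip d := by
  obtain ⟨v, i⟩ := d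
  obtain ⟨w, j⟩ := d'
  rcases Sym2.eq_iff.1 h with ⟨h1, h2⟩ | ⟨h1, h2⟩
  · simp only at h1; subst h1
    left; rw [G.port_eq _ _ _ h2]
  · right
    rw [← G.flip_flip (w, j)]
    congr 1
    have e : (G.flip (w, j)) = (v, (G.flip (w, j)).2) := Prod.ext h1.symm rfl
    rw [e]
    congr 1
    apply G.port_eq v
    rw [← e, G.flip_flip, h2]

end DartGraph

theorem exists_injective_extension (p : Fin 3 → Option (Fin 3))
    (hp : ∀ i j, i ≠ j → p i = p j → p i = none) :
    ∃ q : Fin 3 → Fin 3, Injective q ∧ ∀ i c, p i = some c → q i = c := by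
  revert p; decide +kernel

/-- The three colours, numbered. -/
noncomputable def kolEquiv : Kol ≃ Fin 3 := Fintype.equivFinOfCardEq (by decide)

namespace DartGraph

variable {V : Type} (G : DartGraph V)

theorem threeEdgeColorable_induce_compl {X : Set V} :
    ThreeEdgeColorable (G.toGraph.induce Xᶜ) ↔ ∃ h, G.IsCol X h := by
  classical
  constructor
  · rintro ⟨f, hf⟩
    have key : ∀ v : V, ∃ q : Fin 3 → Fin 3, v ∉ X → Injective q ∧
        ∀ i, ∀ (hv : v ∈ Xᶜ) (hw : (G.flip (v, i)).1 ∈ Xᶜ),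
          q i = kolEquiv (f s(⟨v, hv⟩, ⟨_, hw⟩)) := by
      intro v
      by_cases hv : v ∈ X
      · exact ⟨id, fun h => absurd hv h⟩
      obtain ⟨q, hq, hq'⟩ := exists_injective_extension
        (fun i => if hw : (G.flip (v, i)).1 ∈ Xᶜ then
          some (kolEquiv (f s(⟨v, hv⟩, ⟨_, hw⟩))) else none) (by
            intro i j hij
            by_cases hi : (G.flip (v, i)).1 ∈ Xᶜ
            swap
            · exact fun _ => dif_neg hi
            by_cases hj : (G.flip (v, j)).1 ∈ Xᶜ
            swap
            · rw [dif_pos hi, dif_neg hj]; simp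
            simp only [hi, hj, dif_pos, reduceCtorEq, Option.some.injEq,
              EmbeddingLike.apply_eq_iff_eq, imp_false]
            refine hf _ ?_ _ ?_ ?_ ⟨⟨v, hv⟩, by simp, by simp⟩
            · exact ⟨i, rfl⟩
            · exact ⟨j, rfl⟩
            · intro h
              rw [Sym2.congr_right, Subtype.mk.injEq] at h
              exact hij (G.port_eq _ _ _ h))
      refine ⟨q, fun _ => ⟨hq, fun i hv hw => hq' i _ ?_⟩⟩
      simp only [hw, dif_pos]
    choose q hq using key
    refine ⟨fun d => q d.1 d.2, fun v hv => (hq v hv).1, fun d h1 h2 => ?_⟩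
    obtain ⟨v, i⟩ := d
    have a := (hq v h1).2 i h1 h2
    have b := (hq _ h2).2 (G.flip (v, i)).2 h2 (by simpa [G.flip_flip] using h1)
    simp only [a, b, Prod.mk.eta, G.flip_flip]
    rw [Sym2.eq_swap]
  · rintro ⟨h, hh⟩
    let ed : (d : V × Fin 3) → d.1 ∈ Xᶜ → (G.flip d).1 ∈ Xᶜ → Sym2 (Xᶜ : Set V) :=
      fun d h1 h2 => s(⟨d.1, h1⟩, ⟨(G.flip d).1, h2⟩)
    have key : ∀ e : Sym2 (Xᶜ : Set V), ∃ c : Kol, ∀ d h1 h2, ed d h1 h2 = e →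
        kolEquiv c = h d := by
      intro e
      by_cases he : ∃ d h1 h2, ed d h1 h2 = e
      · obtain ⟨d, h1, h2, rfl⟩ := he
        refine ⟨kolEquiv.symm (h d), fun d' h1' h2' h' => ?_⟩
        have h'' := congrArg (Sym2.map Subtype.val) h'
        simp only [ed, Sym2.map_mk] at h''
        rcases G.dart_unique h''.symm with rfl | rfl
        · simp
        · simp [hh.flip d h1 h2]
      · exact ⟨kolEquiv.symm 0, fun d h1 h2 h' => absurd ⟨d, h1, h2, h'⟩ he⟩
    choose f hf using key
    refine ⟨f, ?_⟩
    have hd : ∀ e ∈ (G.toGraph.induce Xᶜ).edgeSet, ∀ v ∈ e, ∃ i, ∃ h2 : (G.flip (v.1, i)).1 ∈ Xᶜ,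
        ed (v.1, i) v.2 h2 = e := by
      intro e he v hv
      obtain ⟨w, rfl⟩ := hv
      obtain ⟨i, hi⟩ : G.toGraph.Adj v.1 w.1 := he
      refine ⟨i, by rw [hi]; exact w.2, ?_⟩
      simp only [ed]
      congr 2
    intro e₁ h₁ e₂ h₂ hne ⟨v, hv₁, hv₂⟩ heq
    obtain ⟨i, hi, hi'⟩ := hd e₁ h₁ v hv₁
    obtain ⟨j, hj, hj'⟩ := hd e₂ h₂ v hv₂
    have := hf _ _ _ _ hi'
    rw [heq, hf _ _ _ _ hj'] at this
    have hij := hh.inj v.1 v.2 this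
    subst hij
    exact hne (hi'.symm.trans hj')

end DartGraph

namespace DartGraph

variable {V : Type} (G : DartGraph V) [Fintype V] [DecidableEq V]

/-- The number of darts from `A` to `B`. -/
def cut (A B : Finset V) : ℕ :=
  (Finset.univ.filter fun d : V × Fin 3 => d.1 ∈ A ∧ (G.flip d).1 ∈ B).card

theorem cut_comm (A B : Finset V) : G.cut A B = G.cut B A := by
  refine Finset.card_nbij' G.flip G.flip ?_ ?_ ?_ ?_ <;> intro d <;>
    simp +contextual [G.flip_flip]

theorem cut_union_left {A A' : Finset V} (h : Disjoint A A') (B : Finset V) :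
    G.cut (A ∪ A') B = G.cut A B + G.cut A' B := by
  unfold cut
  rw [← Finset.card_union_of_disjoint]
  · congr 1; ext d; simp; tauto
  · rw [Finset.disjoint_filter]
    rintro d - ⟨h1, -⟩ ⟨h2, -⟩
    exact Finset.disjoint_left.1 h h1 h2

theorem cut_union_right (A : Finset V) {B B' : Finset V} (h : Disjoint B B') :
    G.cut A (B ∪ B') = G.cut A B + G.cut A B' := by
  rw [cut_comm, cut_union_left _ h, cut_comm, G.cut_comm B']

theorem cut_univ (A : Finset V) : G.cut A Finset.univ = 3 * A.card := by
  have : (Finset.univ.filter fun d : V × Fin 3 => d.1 ∈ A ∧ (G.flip d).1 ∈ Finset.univ)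
      = A ×ˢ Finset.univ := by ext d; simp
  rw [cut, this, Finset.card_product]; simp [mul_comm]

theorem cut_add_cut_compl (A : Finset V) : G.cut A A + G.cut A Aᶜ = 3 * A.card := by
  rw [← cut_univ, ← Finset.union_compl A, ← cut_union_right _ _ disjoint_compl_right]

theorem even_cut_self (A : Finset V) : Even (G.cut A A) := by
  rw [← ZMod.natCast_eq_zero_iff_even, cut, Finset.card_eq_sum_ones, Nat.cast_sum]
  refine Finset.sum_involution (fun d _ => G.flip d) (fun _ _ => by decide)
    (fun d _ _ h => G.loopless d (by rw [h])) (fun d hd => ?_) (fun d _ => G.flip_flip d)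
  simpa [G.flip_flip, and_comm] using hd

/-- The number of edges leaving `A`. -/
abbrev bdry (A : Finset V) : ℕ := G.cut A Aᶜ

theorem bdry_compl (A : Finset V) : G.bdry Aᶜ = G.bdry A := by
  rw [bdry, compl_compl, cut_comm]

theorem bdry_add_card_even (A : Finset V) : Even (G.bdry A + A.card) := by
  have h1 := G.cut_add_cut_compl A
  obtain ⟨k, hk⟩ := G.even_cut_self A
  exact ⟨2 * A.card - k, by unfold bdry; omega⟩

theorem cut_singleton (v : V) (B : Finset V) :
    G.cut {v} B = (Finset.univ.filter fun i => (G.flip (v, i)).1 ∈ B).card := by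
  symm
  refine Finset.card_nbij (fun i => (v, i)) ?_ ?_ ?_
  · intro i; simp
  · intro i _ j _ h; simpa using h
  · rintro ⟨w, i⟩ h
    simp only [Finset.coe_filter, Finset.mem_univ, Finset.mem_singleton, true_and,
      Set.mem_ofPred_eq, Set.mem_image] at h ⊢
    obtain ⟨rfl, h⟩ := h
    exact ⟨i, h, rfl⟩

theorem cut_eq_sum (A B : Finset V) : G.cut A B = ∑ v ∈ A, G.cut {v} B := by
  induction A using Finset.induction_on with
  | empty => simp [cut]
  | insert v A hv ih =>
    rw [Finset.sum_insert hv, Finset.insert_eq, cut_union_left _ (by simpa using hv), ih]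

theorem cut_singleton_self (v : V) : G.cut {v} {v} = 0 := by
  rw [cut_singleton, Finset.card_eq_zero, Finset.filter_eq_empty_iff]
  intro i _ h
  exact G.loopless (v, i) (by simpa using h)

theorem exists_bdry_lt_of_card_lt {S : Finset V} (h : S.card < G.bdry S) :
    ∃ v ∈ S, 2 ≤ G.cut {v} Sᶜ ∧ G.bdry (S \ {v}) < G.bdry S := by
  obtain ⟨v, hv, h2⟩ : ∃ v ∈ S, 2 ≤ G.cut {v} Sᶜ := by
    by_contra! hc
    rw [bdry, cut_eq_sum] at h
    have : ∑ v ∈ S, G.cut {v} Sᶜ ≤ ∑ v ∈ S, 1 :=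
      Finset.sum_le_sum fun v hv => by have := hc v hv; omega
    simp at this
    omega
  refine ⟨v, hv, h2, ?_⟩
  have hS : S = (S \ {v}) ∪ {v} := by
    rw [Finset.sdiff_union_of_subset]; simpa using hv
  have hd : Disjoint (S \ {v}) {v} := Finset.sdiff_disjoint
  have hc : (S \ {v})ᶜ = Sᶜ ∪ {v} := by
    ext x; by_cases hx : x = v <;> simp [hx]
  have hd' : Disjoint Sᶜ {v} := by simpa using hv
  have e1 : G.bdry S = G.cut (S \ {v}) Sᶜ + G.cut {v} Sᶜ := by
    rw [bdry]; nth_rewrite 1 [hS]; exact G.cut_union_left hd _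
  have e2 : G.bdry (S \ {v}) = G.cut (S \ {v}) Sᶜ + G.cut {v} (S \ {v}) := by
    rw [bdry, hc, G.cut_union_right _ hd', G.cut_comm _ {v}]
  have e3 := G.cut_add_cut_compl {v}
  have hc' : ({v} : Finset V)ᶜ = Sᶜ ∪ (S \ {v}) := by
    ext x; by_cases hx : x = v <;> simp [hx, hv, em']
  rw [cut_singleton_self, hc', G.cut_union_right] at e3
  · simp at e3; omega
  · rw [Finset.disjoint_left]; intro x; simp +contextual

/-- A vertex set that would, up to trees, witness a small cycle-separating edge cut. -/
structure IsBad (S : Finset V) : Prop where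
  bdry_lt : G.bdry S < 6
  le_card : G.bdry S ≤ S.card
  le_card_compl : G.bdry S ≤ Sᶜ.card
  nonempty : S.Nonempty
  nonempty_compl : Sᶜ.Nonempty

theorem IsBad.compl {S : Finset V} (h : G.IsBad S) : G.IsBad Sᶜ :=
  ⟨by rw [bdry_compl]; exact h.1, by rw [bdry_compl]; exact h.3,
    by rw [bdry_compl, compl_compl]; exact h.2, h.5, by rw [compl_compl]; exact h.4⟩

/-- A set in which every vertex has two neighbours. -/
def Cyclic (C : Finset V) : Prop := C.Nonempty ∧ ∀ v ∈ C, 2 ≤ G.cut {v} C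

theorem cut_mono_right (A : Finset V) {B B' : Finset V} (h : B ⊆ B') :
    G.cut A B ≤ G.cut A B' := by
  rw [← Finset.union_sdiff_of_subset h, cut_union_right _ _ Finset.disjoint_sdiff]
  omega

theorem Cyclic.card_le_of_forall {C S : Finset V} (hC : G.Cyclic C) (hCS : C ⊆ S)
    (hmin : ∀ S', C ⊆ S' → S' ⊆ S → G.bdry S ≤ G.bdry S') : G.bdry S ≤ S.card := by
  by_contra! h
  obtain ⟨v, hv, h2, hlt⟩ := G.exists_bdry_lt_of_card_lt h
  refine (hmin (S \ {v}) (fun x hx => ?_) Finset.sdiff_subset).not_gt hlt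
  rw [Finset.mem_sdiff, Finset.mem_singleton]
  refine ⟨hCS hx, ?_⟩
  rintro rfl
  have h1 := (hC.2 x hx).trans (G.cut_mono_right {x} hCS)
  have h3 : G.cut {x} S + G.cut {x} Sᶜ = 3 := by
    rw [← cut_union_right _ _ disjoint_compl_right, Finset.union_compl, cut_univ]; simp
  omega

theorem exists_isBad {C C' S : Finset V} (hC : G.Cyclic C) (hC' : G.Cyclic C')
    (hS : C ⊆ S) (hS' : C' ⊆ Sᶜ) (hlt : G.bdry S < 6) : ∃ S, G.IsBad S := by
  obtain ⟨T, hT, hmin⟩ := Finset.exists_min_image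
    (Finset.univ.filter fun T : Finset V => C ⊆ T ∧ C' ⊆ Tᶜ) G.bdry ⟨S, by simp [hS, hS']⟩
  simp only [Finset.mem_filter, Finset.mem_univ, true_and] at hT hmin
  refine ⟨T, (hmin S ⟨hS, hS'⟩).trans_lt hlt, ?_, ?_, hC.1.mono hT.1, hC'.1.mono hT.2⟩
  · exact hC.card_le_of_forall G hT.1 fun S' h h' =>
      hmin S' ⟨h, hT.2.trans (Finset.compl_subset_compl.2 h')⟩
  · rw [← bdry_compl]
    refine hC'.card_le_of_forall G hT.2 fun S' h h' => ?_
    rw [bdry_compl, ← G.bdry_compl S']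
    exact hmin _ ⟨hT.1.trans (Finset.subset_compl_comm.1 h'), by rwa [compl_compl]⟩

theorem cyclic_of_isCycle {H : SimpleGraph V} (hH : H ≤ G.toGraph) {a : V} {w : H.Walk a a}
    (hw : w.IsCycle) : G.Cyclic w.support.toFinset := by
  refine ⟨⟨a, by simp⟩, fun v hv => ?_⟩
  rw [List.mem_toFinset] at hv
  have h := hw.ncard_neighborSet_toSubgraph_eq_two hv
  rw [cut_singleton, ← h, ← Set.ncard_coe_finset]
  refine (Set.ncard_le_ncard ?_ (Set.toFinite _)).trans
    (Set.ncard_image_le (f := fun i => (G.flip (v, i)).1) (Set.toFinite _))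
  intro u hu
  obtain ⟨i, hi⟩ := hH (w.toSubgraph.adj_sub hu)
  refine ⟨i, ?_, hi⟩
  simp only [Finset.coe_filter, Finset.mem_univ, List.mem_toFinset, true_and, Set.mem_ofPred_eq]
  rw [hi]
  exact w.mem_verts_toSubgraph.1 (w.toSubgraph.edge_vert hu.symm)

theorem cyclicallyConnected_six (h : ∀ S, ¬ G.IsBad S) : CyclicallyConnected G.toGraph 6 := by
  classical
  rintro ⟨F, -, hF, a, b, ⟨w, hw⟩, ⟨w', hw'⟩, hab⟩
  have hle : G.toGraph.deleteEdges F ≤ G.toGraph := SimpleGraph.deleteEdges_le F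
  let S : Finset V := Finset.univ.filter fun v => (G.toGraph.deleteEdges F).Reachable a v
  refine not_exists.2 h (G.exists_isBad (S := S) (G.cyclic_of_isCycle hle hw)
    (G.cyclic_of_isCycle hle hw') ?_ ?_ ?_)
  · intro v hv
    rw [List.mem_toFinset] at hv
    simpa [S] using ⟨w.takeUntil v hv⟩
  · intro v hv
    rw [List.mem_toFinset] at hv
    simp only [S, Finset.mem_compl, Finset.mem_filter, Finset.mem_univ, true_and]
    exact fun hav => hab (hav.trans ⟨(w'.takeUntil v hv).reverse⟩)
  · refine lt_of_le_of_lt ?_ hF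
    rw [bdry, cut, ← Set.ncard_coe_finset]
    refine Set.ncard_le_ncard_of_injOn (fun d => s(d.1, (G.flip d).1)) ?_ ?_ F.toFinite
    · intro d hd
      simp only [Finset.coe_filter, Finset.mem_univ, true_and, Finset.mem_compl,
        Set.mem_ofPred_eq, S, Finset.mem_filter] at hd
      by_contra hdF
      refine hd.2 (hd.1.trans (SimpleGraph.Adj.reachable ?_))
      rw [SimpleGraph.deleteEdges_adj]
      exact ⟨⟨d.2, rfl⟩, hdF⟩
    · intro d hd d' hd' hdd
      simp only [Finset.coe_filter, Finset.mem_univ, true_and, Finset.mem_compl,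
        Set.mem_ofPred_eq] at hd hd'
      rcases G.dart_unique hdd with rfl | rfl
      · rfl
      · exact absurd hd'.1 hd.2

theorem connected [Nonempty V] (h : ∀ S, ¬ G.IsBad S) : G.toGraph.Connected := by
  classical
  rw [SimpleGraph.connected_iff]
  refine ⟨fun a b => ?_, inferInstance⟩
  by_contra hab
  let S : Finset V := Finset.univ.filter fun v => G.toGraph.Reachable a v
  have h0 : G.bdry S = 0 := by
    rw [bdry, cut, Finset.card_eq_zero, Finset.filter_eq_empty_iff]
    rintro d - ⟨h1, h2⟩
    simp only [S, Finset.mem_compl, Finset.mem_filter, Finset.mem_univ, true_and] at h1 h2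
    exact h2 (h1.trans (SimpleGraph.Adj.reachable ⟨d.2, rfl⟩))
  refine h S ⟨by omega, by omega, by omega, ⟨a, by simp [S]⟩, ⟨b, by simpa [S] using hab⟩⟩

end DartGraph

namespace DartGraph

variable {V : Type} (G : DartGraph V) [Fintype V] [DecidableEq V]

/-- Conditions on a part `T` of the module `M` which allow one to remove `T` from a bad set. -/
def Light (M T : Finset V) : Prop :=
  T = ∅ ∨ (T.card + G.cut T Mᶜ ≤ G.cut T (M \ T) ∧ T.card < G.cut T (M \ T)) ∨
    (G.cut T Mᶜ + 1 ≤ G.cut T (M \ T) ∧ 6 ≤ G.cut T (M \ T) + G.cut T Mᶜ) ∨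
    (G.cut T (M \ T) = 3 ∧ T.card = 3 ∧ G.cut T Mᶜ = 2 ∧
      ∀ u ∉ M, ∀ w ∉ M, G.cut {u} T ≠ 0 → G.cut {w} T ≠ 0 → G.cut {u} {w} = 0)

/-- A module that can be made to lie on one side of every small cut. -/
structure Roundable (M : Finset V) : Prop where
  cut_le_one : ∀ v ∉ M, G.cut {v} M ≤ 1
  light : ∀ T ⊆ M, 6 ≤ G.cut T (M \ T) ∨ G.Light M T ∨ G.Light M (M \ T)

theorem cut_mono_left {A A' : Finset V} (h : A ⊆ A') (B : Finset V) :
    G.cut A B ≤ G.cut A' B := by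
  rw [G.cut_comm A, G.cut_comm A']; exact G.cut_mono_right B h

theorem cut_le_card {A B : Finset V} (h : ∀ v ∈ A, G.cut {v} B ≤ 1) : G.cut A B ≤ A.card := by
  rw [cut_eq_sum, Finset.card_eq_sum_ones]
  exact Finset.sum_le_sum h

variable {G} {M S : Finset V}

theorem bdry_sdiff : G.bdry S + 2 * G.cut (S ∩ M) (S \ M) =
    G.cut (S ∩ M) (M \ (S ∩ M)) + G.cut (S ∩ M) Mᶜ + G.bdry (S \ M) := by
  have h1 : G.bdry S = G.cut (S ∩ M) Sᶜ + G.cut (S \ M) Sᶜ := by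
    rw [← cut_union_left _ (Finset.disjoint_sdiff_inter S M).symm, Finset.union_comm,
      Finset.sdiff_union_inter]
  have h2 : Sᶜ = M \ (S ∩ M) ∪ (Mᶜ \ S) := by ext; simp; tauto
  have h3 : G.cut (S ∩ M) Sᶜ = G.cut (S ∩ M) (M \ (S ∩ M)) + G.cut (S ∩ M) (Mᶜ \ S) := by
    rw [h2, cut_union_right]
    rw [Finset.disjoint_left]; intro x; simp; tauto
  have h4 : G.cut (S ∩ M) Mᶜ = G.cut (S ∩ M) (S \ M) + G.cut (S ∩ M) (Mᶜ \ S) := by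
    rw [← cut_union_right]
    · congr 1; ext; simp; tauto
    · rw [Finset.disjoint_left]; intro x; simp; tauto
  have h5 : G.bdry (S \ M) = G.cut (S \ M) Sᶜ + G.cut (S ∩ M) (S \ M) := by
    rw [G.cut_comm (S ∩ M), ← cut_union_right, bdry]
    · congr 1; ext; simp; tauto
    · rw [Finset.disjoint_left]; intro x; simp; tauto
  omega

theorem IsBad.sdiff (hS : G.IsBad S) (hM : ∀ v ∉ M, G.cut {v} M ≤ 1)
    (hT : G.Light M (S ∩ M)) : G.IsBad (S \ M) := by
  have key := bdry_sdiff (G := G) (S := S) (M := M)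
  have hpar := G.bdry_add_card_even (S \ M)
  have hcard : S.card = (S ∩ M).card + (S \ M).card := (Finset.card_inter_add_card_sdiff S M).symm
  have he : G.cut (S ∩ M) (S \ M) ≤ (S \ M).card := by
    rw [cut_comm]
    refine G.cut_le_card fun v hv => ?_
    exact (G.cut_mono_right _ Finset.inter_subset_right).trans
      (hM v (Finset.mem_sdiff.1 hv).2)
  have heb : G.cut (S ∩ M) (S \ M) ≤ G.cut (S ∩ M) Mᶜ :=
    G.cut_mono_right _ fun x => by simp
  have hlt := hS.bdry_lt
  have hle := hS.le_card
  have hle' := hS.le_card_compl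
  have hcc : Sᶜ.card ≤ (S \ M)ᶜ.card :=
    Finset.card_le_card (Finset.compl_subset_compl.2 Finset.sdiff_subset)
  obtain h0 | hT := hT
  · have : S \ M = S := by rw [Finset.sdiff_eq_self_iff_disjoint,
      Finset.disjoint_iff_inter_eq_empty, h0]
    rwa [this]
  suffices h : G.bdry (S \ M) ≤ G.bdry S ∧ G.bdry (S \ M) ≤ (S \ M).card ∧ (S \ M).card ≠ 0 by
    refine ⟨by omega, h.2.1, by omega, Finset.card_ne_zero.1 h.2.2, ?_⟩
    exact hS.nonempty_compl.mono (Finset.compl_subset_compl.2 Finset.sdiff_subset)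
  rw [Nat.even_iff] at hpar
  obtain ⟨h1, h2⟩ | ⟨h1, h2⟩ | ⟨h1, h2, h3, h4⟩ := hT
  · omega
  · omega
  · have h5 : ¬ (G.bdry (S \ M) = 4 ∧ (S \ M).card = 2 ∧ G.cut (S ∩ M) (S \ M) = 2) := by
      rintro ⟨hb, hc, he2⟩
      obtain ⟨u, w, huw, hSM⟩ := Finset.card_eq_two.1 hc
      have hu : u ∉ M := (Finset.mem_sdiff.1 (hSM ▸ by simp : u ∈ S \ M)).2
      have hw : w ∉ M := (Finset.mem_sdiff.1 (hSM ▸ by simp : w ∈ S \ M)).2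
      have hu1 := (G.cut_mono_right {u} (Finset.inter_subset_right (s₁ := S))).trans (hM u hu)
      have hw1 := (G.cut_mono_right {w} (Finset.inter_subset_right (s₁ := S))).trans (hM w hw)
      have hd : Disjoint ({u} : Finset V) {w} := by simpa using huw
      have hpair : ({u, w} : Finset V) = {u} ∪ {w} := rfl
      rw [hSM, cut_comm, hpair, cut_union_left _ hd] at he2
      have h0 := h4 u hu w hw (by omega) (by omega)
      have h6 := G.cut_add_cut_compl (S \ M)
      have h7 : G.cut (S \ M) (S \ M) = 0 := by
        rw [hSM, hpair, cut_union_left _ hd, cut_union_right _ _ hd, cut_union_right _ _ hd,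
          cut_singleton_self, cut_singleton_self, G.cut_comm {w}, h0]
      unfold bdry at hb
      omega
    omega

theorem Roundable.isBad (hM : G.Roundable M) (hS : G.IsBad S) :
    G.IsBad (S \ M) ∨ G.IsBad (S ∪ M) := by
  obtain h | h | h := hM.light (S ∩ M) Finset.inter_subset_right
  · have h1 : G.cut (S ∩ M) (M \ (S ∩ M)) ≤ G.bdry S :=
      (G.cut_mono_left Finset.inter_subset_left _).trans (G.cut_mono_right _ fun x => by
        simp)
    have := hS.bdry_lt
    omega
  · exact .inl (hS.sdiff hM.cut_le_one h)
  · have h1 : M \ (S ∩ M) = Sᶜ ∩ M := by ext; simp; tauto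
    rw [h1] at h
    have h2 := (hS.compl.sdiff hM.cut_le_one h).compl
    have h3 : (Sᶜ \ M)ᶜ = S ∪ M := by ext; simp; tauto
    exact .inr (h3 ▸ h2)

theorem IsBad.exists_forall_subset_or_disjoint {ι : Type} [DecidableEq ι] (M : ι → Finset V)
    (hM : ∀ i, G.Roundable (M i)) (hd : ∀ i j, i ≠ j → Disjoint (M i) (M j))
    (hS : G.IsBad S) (I : Finset ι) :
    ∃ S, G.IsBad S ∧ ∀ i ∈ I, M i ⊆ S ∨ Disjoint (M i) S := by
  induction I using Finset.induction_on with
  | empty => exact ⟨S, hS, by simp⟩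
  | insert i I hi ih =>
    obtain ⟨S', hS', h⟩ := ih
    have hne : ∀ j ∈ I, Disjoint (M j) (M i) := fun j hj => hd j i fun e => hi (e ▸ hj)
    obtain h1 | h1 := (hM i).isBad hS'
    · refine ⟨_, h1, fun j hj => ?_⟩
      obtain rfl | hj := Finset.mem_insert.1 hj
      · exact .inr Finset.disjoint_sdiff
      · refine (h j hj).imp (fun h => Finset.subset_sdiff.2 ⟨h, hne j hj⟩) fun h =>
          h.mono_right Finset.sdiff_subset
    · refine ⟨_, h1, fun j hj => ?_⟩
      obtain rfl | hj := Finset.mem_insert.1 hj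
      · exact .inl Finset.subset_union_right
      · refine (h j hj).imp (fun h => h.trans Finset.subset_union_left) fun h =>
          Finset.disjoint_union_right.2 ⟨h, hne j hj⟩

end DartGraph

/-- A superedge: a graph fragment with three dangling edges on the left (`false`) and three on
the right (`true`). -/
structure Piece where
  W : Type
  fin : Fintype W
  dec : DecidableEq W
  nb : W × Fin 3 → (W × Fin 3) ⊕ (Bool × Fin 3)
  port : Bool × Fin 3 → W × Fin 3
  nb_symm : ∀ d d', nb d = .inl d' → nb d' = .inl d
  nb_eq_inr : ∀ d p, nb d = .inr p ↔ port p = d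
  nb_ne : ∀ d d', nb d = .inl d' → d'.1 ≠ d.1
  nb_inj : ∀ w i j d d', nb (w, i) = .inl d → nb (w, j) = .inl d' → d.1 = d'.1 → i = j
  port_inj : ∀ b s t, (port (b, s)).1 = (port (b, t)).1 → s = t

attribute [instance] Piece.fin Piece.dec

namespace Piece

variable (P : Piece)

theorem nb_port (p : Bool × Fin 3) : P.nb (P.port p) = .inr p := (P.nb_eq_inr _ _).2 rfl

/-- A proper edge colouring of a piece off the vertex set `X`. -/
structure IsCol (X : Set P.W) (h : P.W × Fin 3 → Fin 3) : Prop where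
  inj : ∀ v ∉ X, Injective fun i => h (v, i)
  flip : ∀ d d', P.nb d = .inl d' → d.1 ∉ X → d'.1 ∉ X → h d' = h d

/-- Off `X`, the piece has a colouring with given colours on the dangling edges. -/
def Real (X : Set P.W) (L R : Fin 3 → Fin 3) : Prop :=
  ∃ h, P.IsCol X h ∧ (∀ s, (P.port (false, s)).1 ∉ X → h (P.port (false, s)) = L s) ∧
    ∀ s, (P.port (true, s)).1 ∉ X → h (P.port (true, s)) = R s

variable {P} in
theorem Real.mono {X Y : Set P.W} (hXY : X ⊆ Y) {L R : Fin 3 → Fin 3} (h : P.Real X L R) :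
    P.Real Y L R := by
  obtain ⟨c, hc, hL, hR⟩ := h
  exact ⟨c, ⟨fun v hv => hc.inj v fun h => hv (hXY h),
    fun d d' h h1 h2 => hc.flip d d' h (fun h => h1 (hXY h)) fun h => h2 (hXY h)⟩,
    fun s hs => hL s fun h => hs (hXY h), fun s hs => hR s fun h => hs (hXY h)⟩

variable {P} in
theorem Real.perm {X : Set P.W} {L R : Fin 3 → Fin 3} (h : P.Real X L R)
    {π : Fin 3 → Fin 3} (hπ : Injective π) : P.Real X (π ∘ L) (π ∘ R) := by
  obtain ⟨c, hc, hL, hR⟩ := h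
  exact ⟨π ∘ c, ⟨fun v hv => hπ.comp (hc.inj v hv),
    fun d d' h h1 h2 => congrArg π (hc.flip d d' h h1 h2)⟩,
    fun s hs => congrArg π (hL s hs), fun s hs => congrArg π (hR s hs)⟩

end Piece

/-- The colours as elements of the Klein four-group. -/
def klein : Fin 3 → ZMod 2 × ZMod 2 := ![(1, 0), (0, 1), (1, 1)]

/-- The boundary colouring `L` is not constant and has Klein sum `c`. -/
def Bal (c : Fin 3) (L : Fin 3 → Fin 3) : Prop :=
  klein (L 0) + klein (L 1) + klein (L 2) = klein c ∧ ¬ (L 0 = L 1 ∧ L 1 = L 2)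

instance (c : Fin 3) (L : Fin 3 → Fin 3) : Decidable (Bal c L) :=
  inferInstanceAs (Decidable (_ ∧ _))

/-- A colour different from both arguments. -/
def oth (a b : Fin 3) : Fin 3 := if a = b then a + 1 else -(a + b)

theorem Piece.Real.klein_sum {P : Piece} {L R : Fin 3 → Fin 3} (h : P.Real ∅ L R) :
    ∑ s, klein (L s) = ∑ s, klein (R s) := by
  obtain ⟨c, hc, hL, hR⟩ := h
  simp only [Set.mem_empty_iff_false, not_false_eq_true, forall_const] at hL hR
  have h1 : ∑ d : P.W × Fin 3, klein (c d) = 0 := by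
    rw [Fintype.sum_prod_type]
    refine Finset.sum_eq_zero fun w _ => ?_
    have hinj := hc.inj w (by simp)
    have : ∀ f : Fin 3 → Fin 3, Injective f → ∑ i, klein (f i) = 0 := by decide
    exact this _ hinj
  have h2 : ∑ d ∈ Finset.univ.filter (fun d => ∃ d', P.nb d = .inl d'), klein (c d) = 0 := by
    have hex : ∀ d, ∃ d', ∀ e, P.nb d = .inl e → d' = e := fun d => by
      cases h : P.nb d with
      | inl e => exact ⟨e, fun _ h => by simpa using h⟩
      | inr p => exact ⟨d, fun _ h => by simp at h⟩
    choose g hg using hex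
    have hg' : ∀ d ∈ Finset.univ.filter (fun d => ∃ d', P.nb d = .inl d'),
        P.nb d = .inl (g d) := by
      intro d hd
      obtain ⟨e, he⟩ := (Finset.mem_filter.1 hd).2
      rw [hg d e he, he]
    refine Finset.sum_involution (fun d _ => g d) ?_ ?_ ?_ ?_
    · intro d hd
      rw [hc.flip _ _ (hg' d hd) (by simp) (by simp)]
      generalize c d = a
      revert a; decide
    · intro d hd _ h
      exact P.nb_ne _ _ (hg' d hd) (by rw [h])
    · intro d hd
      simp only [Finset.mem_filter, Finset.mem_univ, true_and]
      exact ⟨_, P.nb_symm _ _ (hg' d hd)⟩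
    · intro d hd
      exact hg _ _ (P.nb_symm _ _ (hg' d hd))
  have h3 : ∑ d ∈ Finset.univ.filter (fun d => ¬ ∃ d', P.nb d = .inl d'), klein (c d) =
      ∑ p, klein (c (P.port p)) := by
    symm
    refine Finset.sum_nbij P.port ?_ ?_ ?_ fun _ _ => rfl
    · intro p _
      simp [P.nb_port]
    · intro p _ q _ h
      have := P.nb_port p
      rw [h, P.nb_port] at this
      simpa using this.symm
    · intro d hd
      simp only [Finset.coe_filter, Finset.mem_univ, true_and, Set.mem_ofPred_eq] at hd
      cases h : P.nb d with
      | inl e => exact absurd ⟨e, h⟩ hd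
      | inr p => exact ⟨p, by simp, (P.nb_eq_inr _ _).1 h⟩
  rw [← Finset.sum_filter_add_sum_filter_not _ (fun d => ∃ d', P.nb d = .inl d'), h2, h3,
    Fintype.sum_prod_type] at h1
  simp only [Fintype.sum_bool, hL, hR, zero_add] at h1
  generalize ∑ s, klein (L s) = a at h1 ⊢
  generalize ∑ s, klein (R s) = b at h1 ⊢
  revert a b; decide

/-- The attachment darts of the base graph. -/
def att (i : Fin 15) : Fin 21 × Fin 3 :=
  [(7, 0), (9, 1), (8, 2), (10, 0), (16, 0), (15, 0), (13, 1), (12, 1), (14, 0), (6, 0),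
    (18, 0), (20, 1), (19, 2), (17, 0), (11, 0)].getD i.val (0, 0)

/-- The partner of a dart of the base graph. -/
def nbU (d : Fin 21 × Fin 3) : (Fin 21 × Fin 3) ⊕ Fin 15 :=
  [.inl (1, 0), .inl (5, 1), .inl (7, 2),
    .inl (0, 0), .inl (2, 0), .inl (12, 2),
    .inl (1, 1), .inl (3, 0), .inl (17, 2),
    .inl (2, 1), .inl (4, 0), .inl (10, 2),
    .inl (3, 1), .inl (5, 0), .inl (15, 2),
    .inl (4, 1), .inl (0, 1), .inl (20, 2),
    .inr 9, .inl (8, 0), .inl (9, 0),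
    .inr 0, .inl (8, 1), .inl (0, 2),
    .inl (6, 1), .inl (7, 1), .inr 2,
    .inl (6, 2), .inr 1, .inl (10, 1),
    .inr 3, .inl (9, 2), .inl (3, 2),
    .inr 14, .inl (12, 0), .inl (13, 0),
    .inl (11, 1), .inr 7, .inl (1, 2),
    .inl (11, 2), .inr 6, .inl (14, 1),
    .inr 8, .inl (13, 2), .inl (15, 1),
    .inr 5, .inl (14, 2), .inl (4, 2),
    .inr 4, .inl (19, 0), .inl (20, 0),
    .inr 13, .inl (18, 1), .inl (2, 2),
    .inr 10, .inl (17, 1), .inl (19, 1),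
    .inl (16, 1), .inl (18, 2), .inr 12,
    .inl (16, 2), .inr 11, .inl (5, 2)].getD (3 * d.1.val + d.2.val) (.inr 0)

theorem nbU_symm : ∀ d d', nbU d = .inl d' → nbU d' = .inl d := by decide +kernel

theorem nbU_eq_inr : ∀ d i, nbU d = .inr i ↔ att i = d := by decide +kernel

theorem nbU_ne : ∀ d d', nbU d = .inl d' → d'.1 ≠ d.1 := by decide +kernel

/-- The vertices of the graph obtained from the base graph by replacing fifteen edges with
pieces. -/
abbrev Vtx (P : Fin 15 → Piece) : Type := Fin 15 ⊕ Fin 21 ⊕ Σ i, (P i).W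

namespace Vtx

variable (P : Fin 15 → Piece)

/-- A dart of the `i`-th piece. -/
abbrev dart (i : Fin 15) (d : (P i).W × Fin 3) : Vtx P × Fin 3 := (.inr (.inr ⟨i, d.1⟩), d.2)

/-- The dart joined to the dangling edge `p` of the `i`-th piece. -/
def ext (i : Fin 15) (p : Bool × Fin 3) : Vtx P × Fin 3 :=
  if p.2 = 0 then (if p.1 then (.inl (i + 1), 1) else (.inl i, 0))
  else if p.1 then dart P (i + 1) ((P (i + 1)).port (false, p.2))
  else dart P (i - 1) ((P (i - 1)).port (true, p.2))

/-- Reversal of darts. -/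
def flip : Vtx P × Fin 3 → Vtx P × Fin 3
  | (.inl i, j) =>
    if j = 0 then dart P i ((P i).port (false, 0))
    else if j = 1 then dart P (i - 1) ((P (i - 1)).port (true, 0))
    else (.inr (.inl (att i).1), (att i).2)
  | (.inr (.inl u), j) => match nbU (u, j) with
    | .inl d => (.inr (.inl d.1), d.2)
    | .inr i => (.inl i, 2)
  | (.inr (.inr ⟨i, w⟩), j) => match (P i).nb (w, j) with
    | .inl d => dart P i d
    | .inr p => ext P i p

theorem flip_dart_inl {i : Fin 15} {d d' : (P i).W × Fin 3} (h : (P i).nb d = .inl d') :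
    flip P (dart P i d) = dart P i d' := by
  simp [dart, flip, h]

theorem flip_dart_port (i : Fin 15) (p : Bool × Fin 3) :
    flip P (dart P i ((P i).port p)) = ext P i p := by
  simp [flip, (P i).nb_port p]

theorem flip_U_inl {d d' : Fin 21 × Fin 3} (h : nbU d = .inl d') :
    flip P (.inr (.inl d.1), d.2) = (.inr (.inl d'.1), d'.2) := by
  simp [flip, h]

theorem flip_U_att (i : Fin 15) : flip P (.inr (.inl (att i).1), (att i).2) = (.inl i, 2) := by
  simp [flip, (nbU_eq_inr _ i).2 rfl]

theorem flip_D_zero (i : Fin 15) : flip P (.inl i, 0) = dart P i ((P i).port (false, 0)) := rfl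

theorem flip_D_one (i : Fin 15) :
    flip P (.inl i, 1) = dart P (i - 1) ((P (i - 1)).port (true, 0)) := rfl

theorem flip_D_two (i : Fin 15) : flip P (.inl i, 2) = (.inr (.inl (att i).1), (att i).2) := rfl

theorem ext_left_zero (i : Fin 15) : ext P i (false, 0) = (.inl i, 0) := rfl

theorem ext_right_zero (i : Fin 15) : ext P i (true, 0) = (.inl (i + 1), 1) := rfl

theorem ext_left {s : Fin 3} (hs : s ≠ 0) (i : Fin 15) :
    ext P i (false, s) = dart P (i - 1) ((P (i - 1)).port (true, s)) := by
  simp [ext, hs]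

theorem ext_right {s : Fin 3} (hs : s ≠ 0) (i : Fin 15) :
    ext P i (true, s) = dart P (i + 1) ((P (i + 1)).port (false, s)) := by
  simp [ext, hs]

/-- Case distinction on the darts of the graph. -/
theorem dart_cases {C : Vtx P × Fin 3 → Prop}
    (D0 : ∀ i, C (.inl i, 0)) (D1 : ∀ i, C (.inl i, 1)) (D2 : ∀ i, C (.inl i, 2))
    (U : ∀ d d', nbU d = .inl d' → C (.inr (.inl d.1), d.2))
    (UD : ∀ i, C (.inr (.inl (att i).1), (att i).2))
    (M : ∀ i d d', (P i).nb d = .inl d' → C (dart P i d))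
    (MD : ∀ i p, C (dart P i ((P i).port p))) (d) : C d := by
  obtain ⟨i | u | ⟨i, w⟩, j⟩ := d
  · fin_cases j
    exacts [D0 i, D1 i, D2 i]
  · cases h : nbU (u, j) with
    | inl d' => exact U (u, j) d' h
    | inr i =>
      have := UD i
      rwa [(nbU_eq_inr _ i).1 h] at this
  · cases h : (P i).nb (w, j) with
    | inl d' => exact M i (w, j) d' h
    | inr p =>
      have := MD i p
      rwa [((P i).nb_eq_inr _ p).1 h] at this

theorem flip_ext (i : Fin 15) (p : Bool × Fin 3) :
    flip P (ext P i p) = dart P i ((P i).port p) := by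
  obtain ⟨b, s⟩ := p
  by_cases hs : s = 0
  · subst hs
    cases b
    · rw [ext_left_zero, flip_D_zero]
    · rw [ext_right_zero, flip_D_one, add_sub_cancel_right]
  · cases b
    · rw [ext_left P hs, flip_dart_port, ext_right P hs, sub_add_cancel]
    · rw [ext_right P hs, flip_dart_port, ext_left P hs, add_sub_cancel_right]

theorem flip_flip (d) : flip P (flip P d) = d := by
  induction d using dart_cases P with
  | D0 i => rw [flip_D_zero, flip_dart_port, ext_left_zero]
  | D1 i => rw [flip_D_one, flip_dart_port, ext_right_zero, sub_add_cancel]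
  | D2 i => rw [flip_D_two, flip_U_att]
  | U d d' h => rw [flip_U_inl P h, flip_U_inl P (nbU_symm _ _ h)]
  | UD i => rw [flip_U_att, flip_D_two]
  | M i d d' h => rw [flip_dart_inl P h, flip_dart_inl P ((P i).nb_symm _ _ h)]
  | MD i p => rw [flip_dart_port, flip_ext]

theorem flip_ne (d) : (flip P d).1 ≠ d.1 := by
  induction d using dart_cases P with
  | D0 i => rw [flip_D_zero]; simp
  | D1 i => rw [flip_D_one]; simp
  | D2 i => rw [flip_D_two]; simp
  | U d d' h => rw [flip_U_inl P h]; simpa using nbU_ne _ _ h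
  | UD i => rw [flip_U_att]; simp
  | M i d d' h => rw [flip_dart_inl P h]; simpa using (P i).nb_ne _ _ h
  | MD i p =>
    rw [flip_dart_port]
    obtain ⟨b, s⟩ := p
    by_cases hs : s = 0
    · subst hs
      cases b <;> simp [ext]
    · cases b <;> simp [ext, hs, Sigma.mk.injEq]

theorem ext_fst_ne (i : Fin 15) (p : Bool × Fin 3) (w : (P i).W) :
    (ext P i p).1 ≠ .inr (.inr ⟨i, w⟩) := by
  obtain ⟨b, s⟩ := p
  by_cases hs : s = 0
  · subst hs
    cases b <;> simp [ext]
  · cases b <;> simp [ext, hs, Sigma.mk.injEq]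

theorem ext_fst_inj (i : Fin 15) (p q : Bool × Fin 3) (h : (ext P i p).1 = (ext P i q).1) :
    p = q := by
  have h1 : ∀ i : Fin 15, i + 1 ≠ i - 1 := by decide
  have h2 : ∀ i : Fin 15, i + 1 ≠ i := by decide
  have h3 := h1 i
  have h4 := h2 i
  obtain ⟨b, s⟩ := p
  obtain ⟨b', s'⟩ := q
  by_cases hs : s = 0 <;> by_cases hs' : s' = 0 <;> cases b <;> cases b' <;>
    simp [ext, hs, hs', Sigma.mk.injEq, h3, h3.symm, h4, h4.symm] at h ⊢
  all_goals exact (P _).port_inj _ _ _ h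

theorem flip_port_eq (v : Vtx P) (i j : Fin 3) (h : (flip P (v, i)).1 = (flip P (v, j)).1) :
    i = j := by
  obtain k | u | ⟨k, w⟩ := v
  · have h1 : ∀ k : Fin 15, k - 1 ≠ k := by decide
    have h2 := h1 k
    fin_cases i <;> fin_cases j <;> simp [flip, Sigma.mk.injEq, h2, h2.symm] at h ⊢
  · have : ∀ u i j, (nbU (u, i)).map Prod.fst id = (nbU (u, j)).map Prod.fst id → i = j := by
      decide +kernel
    refine this u i j ?_
    cases h1 : nbU (u, i) <;> cases h2 : nbU (u, j) <;> simp [flip, h1, h2] at h ⊢ <;> exact h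
  · cases h1 : (P k).nb (w, i) <;> cases h2 : (P k).nb (w, j) <;> simp only [flip, h1, h2] at h
    · exact (P k).nb_inj w i j _ _ h1 h2 (by simpa using h)
    · exact absurd h.symm (ext_fst_ne P _ _ _)
    · exact absurd h (ext_fst_ne P _ _ _)
    · rw [ext_fst_inj P k _ _ h, ← h2] at h1
      rename_i p q
      have e1 := ((P k).nb_eq_inr _ q).1 h2
      have e2 := ((P k).nb_eq_inr _ q).1 (h1.trans h2)
      simpa using e2.symm.trans e1

end Vtx

/-- The graph obtained from the base graph by replacing fifteen edges with pieces. -/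
def assemble (P : Fin 15 → Piece) : DartGraph (Vtx P) where
  flip := Vtx.flip P
  flip_flip := Vtx.flip_flip P
  port_eq := Vtx.flip_port_eq P
  loopless := Vtx.flip_ne P

theorem assemble_flip (P : Fin 15 → Piece) (d) : (assemble P).flip d = Vtx.flip P d := rfl

namespace Piece

/-- The colouring properties required of a piece. -/
structure Good (P : Piece) : Prop where
  not_real : ∀ L R, Injective L → Injective R → ¬ P.Real ∅ L R
  real : ∀ c L R, Bal c L → Bal c R → P.Real ∅ L R
  real_edge : ∀ d d', P.nb d = .inl d' → ∀ f g, ∃ L R, Injective L ∧ Injective R ∧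
    L 0 ≠ f ∧ R 0 ≠ g ∧ P.Real {d.1, d'.1} L R
  real_left : ∀ f g, ∃ L R, Bal f L ∧ Injective R ∧ R 0 ≠ g ∧
    P.Real {(P.port (false, 0)).1} L R
  real_right : ∀ f g, ∃ L R, Bal g R ∧ Injective L ∧ L 0 ≠ f ∧
    P.Real {(P.port (true, 0)).1} L R
  real_straight_right : ∀ s ≠ 0, ∀ f g, ∃ L R, Injective L ∧ L 0 ≠ f ∧ R 0 ≠ g ∧
    P.Real {(P.port (true, s)).1} L R
  real_straight_left : ∀ s ≠ 0, ∀ L f g, f ≠ g → P.Real {(P.port (false, s)).1} L ![f, g, g]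

end Piece

theorem isCol_of_real {P : Fin 15 → Piece} {X : Set (Vtx P)} {L R : Fin 15 → Fin 3 → Fin 3}
    {f : Fin 15 → Fin 3} {hU : Fin 21 × Fin 3 → Fin 3}
    (hM : ∀ i, (P i).Real {w | .inr (.inr ⟨i, w⟩) ∈ X} (L i) (R i))
    (hLR : ∀ i, ∀ s ≠ 0, L (i + 1) s = R i s)
    (hD : ∀ i, .inl i ∉ X → Injective ![L i 0, R (i - 1) 0, f i])
    (hinj : ∀ u, .inr (.inl u) ∉ X → Injective fun j => hU (u, j))
    (hflip : ∀ d d', nbU d = .inl d' → .inr (.inl d.1) ∉ X → .inr (.inl d'.1) ∉ X →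
      hU d' = hU d)
    (hatt : ∀ i, .inl i ∉ X → .inr (.inl (att i).1) ∉ X → hU (att i) = f i) :
    ∃ h, (assemble P).IsCol X h := by
  choose g hg hgL hgR using hM
  have hLR' : ∀ i, ∀ s ≠ 0, L i s = R (i - 1) s := fun i s hs => by
    simpa using hLR (i - 1) s hs
  refine ⟨fun d => match d with
    | (.inl i, j) => ![L i 0, R (i - 1) 0, f i] j
    | (.inr (.inl u), j) => hU (u, j)
    | (.inr (.inr ⟨i, w⟩), j) => g i (w, j), ?_, ?_⟩
  · rintro (i | u | ⟨i, w⟩) hX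
    · exact hD i hX
    · exact hinj u hX
    · exact (hg i).inj w hX
  · intro d h1 h2
    change (Vtx.flip P d).1 ∉ X at h2
    change (match Vtx.flip P d with
      | (.inl i, j) => ![L i 0, R (i - 1) 0, f i] j
      | (.inr (.inl u), j) => hU (u, j)
      | (.inr (.inr ⟨i, w⟩), j) => g i (w, j)) = _
    induction d using Vtx.dart_cases P with
    | D0 i => rw [Vtx.flip_D_zero] at h2 ⊢; exact hgL i 0 h2
    | D1 i => rw [Vtx.flip_D_one] at h2 ⊢; exact hgR (i - 1) 0 h2
    | D2 i => rw [Vtx.flip_D_two] at h2 ⊢; exact hatt i h1 h2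
    | U d d' h => rw [Vtx.flip_U_inl P h] at h2 ⊢; exact hflip d d' h h1 h2
    | UD i => rw [Vtx.flip_U_att] at h2 ⊢; exact (hatt i h2 h1).symm
    | M i d d' h => rw [Vtx.flip_dart_inl P h] at h2 ⊢; exact (hg i).flip d d' h h1 h2
    | MD i p =>
      rw [Vtx.flip_dart_port] at h2 ⊢
      obtain ⟨b, s⟩ := p
      by_cases hs : s = 0
      · subst hs
        cases b
        · rw [Vtx.ext_left_zero]; exact (hgL i 0 h1).symm
        · rw [Vtx.ext_right_zero]; refine Eq.trans ?_ (hgR i 0 h1).symm; simp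
      · cases b
        · rw [Vtx.ext_left P hs] at h2 ⊢
          exact (hgR (i - 1) s h2).trans ((hLR' i s hs).symm.trans (hgL i s h1).symm)
        · rw [Vtx.ext_right P hs] at h2 ⊢
          exact (hgL (i + 1) s h2).trans ((hLR i s hs).trans (hgR i s h1).symm)

/-- A colouring of the base graph off given vertices. -/
structure BaseCol (XD : Finset (Fin 15)) (XU : Finset (Fin 21)) (c : Fin 15 → Fin 3)
    (h : Fin 21 × Fin 3 → Fin 3) : Prop where
  inj : ∀ u ∉ XU, Injective fun j => h (u, j)
  flip : ∀ d d', nbU d = .inl d' → d.1 ∉ XU → d'.1 ∉ XU → h d' = h d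
  ne : ∀ i ∉ XD, c i ≠ c (i - 1)
  att : ∀ i ∉ XD, (att i).1 ∉ XU → h (att i) ≠ c i ∧ h (att i) ≠ c (i - 1)

/-- The boundary colouring on the left of a piece replacing an edge coloured `c i`. -/
def stdL (c : Fin 15 → Fin 3) (i : Fin 15) : Fin 3 → Fin 3 :=
  ![c i, oth (c i) (c (i - 1)), oth (c i) (c (i - 1))]

/-- The boundary colouring on the right of a piece replacing an edge coloured `c i`. -/
def stdR (c : Fin 15 → Fin 3) (i : Fin 15) : Fin 3 → Fin 3 :=
  ![c i, oth (c (i + 1)) (c i), oth (c (i + 1)) (c i)]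

theorem bal_left (a b : Fin 3) : Bal a ![a, oth a b, oth a b] := by
  revert a b; decide

theorem bal_right (a b : Fin 3) : Bal a ![a, oth b a, oth b a] := by
  revert a b; decide

theorem stdL_succ (c : Fin 15 → Fin 3) (i : Fin 15) {s : Fin 3} (hs : s ≠ 0) :
    stdL c (i + 1) s = stdR c i s := by
  fin_cases s <;> simp [stdL, stdR] at hs ⊢

theorem isCol_of_baseCol {P : Fin 15 → Piece} (hP : ∀ i, (P i).Good) {X : Set (Vtx P)}
    {XD : Finset (Fin 15)} {XU : Finset (Fin 21)} {c : Fin 15 → Fin 3}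
    {h : Fin 21 × Fin 3 → Fin 3} (hb : BaseCol XD XU c h)
    (hXD : ∀ i ∈ XD, .inl i ∈ X) (hXU : ∀ u ∈ XU, .inr (.inl u) ∈ X) :
    ∃ h, (assemble P).IsCol X h := by
  refine isCol_of_real (L := stdL c) (R := stdR c) (hU := h)
    (f := fun i => if (att i).1 ∈ XU then oth (c i) (c (i - 1)) else h (att i))
    (fun i => ((hP i).real _ _ _ (bal_left _ _) (bal_right _ _)).mono (Set.empty_subset _))
    (fun i s hs => stdL_succ c i hs) (fun i hi => ?_) (fun u hu => hb.inj u fun h => hu (hXU u h))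
    (fun d d' hd h1 h2 => hb.flip d d' hd (fun h => h1 (hXU _ h)) fun h => h2 (hXU _ h))
    (fun i hi hu => by rw [if_neg fun h => hu (hXU _ h)])
  have hi' : i ∉ XD := fun h => hi (hXD i h)
  have h1 := hb.ne i hi'
  have key : ∀ a b f : Fin 3, a ≠ b → f ≠ a → f ≠ b → Injective ![a, b, f] := by decide
  have key2 : ∀ a b : Fin 3, oth a b ≠ a ∧ oth a b ≠ b := by decide
  have h2 : stdR c (i - 1) 0 = c (i - 1) := rfl
  rw [h2]
  by_cases hu : (att i).1 ∈ XU
  · simp only [if_pos hu]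
    exact key _ _ _ h1 (key2 _ _).1 (key2 _ _).2
  · simp only [if_neg hu]
    exact key _ _ _ h1 (hb.att i hi' hu).1 (hb.att i hi' hu).2

theorem isCol_of_baseCol_pair {P : Fin 15 → Piece} (hP : ∀ i, (P i).Good) {X : Set (Vtx P)}
    {k : Fin 15} {c : Fin 15 → Fin 3} {h : Fin 21 × Fin 3 → Fin 3}
    (hb : BaseCol {k, k + 1} ∅ c h) {L R L' R' : Fin 3 → Fin 3}
    (hR : Bal (c (k - 1)) R) (hM : (P k).Real {w | .inr (.inr ⟨k, w⟩) ∈ X} L R')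
    (hM' : (P (k + 1)).Real {w | .inr (.inr ⟨k + 1, w⟩) ∈ X} L' (stdR c (k + 1)))
    (hLR : ∀ s ≠ 0, L s = R s) (hLR' : ∀ s ≠ 0, L' s = R' s)
    (hD : .inl k ∉ X → Injective ![L 0, R 0, h (att k)])
    (hD' : .inl (k + 1) ∉ X → Injective ![L' 0, R' 0, h (att (k + 1))]) :
    ∃ h, (assemble P).IsCol X h := by
  have e1 : ∀ k : Fin 15, k ≠ k + 1 := by decide
  have e2 : ∀ k : Fin 15, k - 1 ≠ k := by decide
  have e3 : ∀ k : Fin 15, k - 1 ≠ k + 1 := by decide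
  refine isCol_of_real (L := update (update (stdL c) k L) (k + 1) L')
    (R := update (update (stdR c) (k - 1) R) k R') (hU := h) (f := fun i => h (att i))
    (fun i => ?_) (fun i s hs => ?_) (fun i hi => ?_) (fun u hu => hb.inj u (by simp))
    (fun d d' hd h1 h2 => hb.flip d d' hd (by simp) (by simp)) (fun i hi hu => rfl)
  · by_cases h1 : i = k + 1
    · subst h1
      rw [update_self, update_of_ne (e1 k).symm, update_of_ne (e3 k).symm]
      exact hM'
    rw [update_of_ne h1]
    by_cases h2 : i = k
    · subst h2
      rw [update_self, update_self]
      exact hM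
    rw [update_of_ne h2, update_of_ne h2]
    by_cases h3 : i = k - 1
    · subst h3
      rw [update_self]
      exact ((hP _).real _ _ _ (bal_left _ _) hR).mono (Set.empty_subset _)
    · rw [update_of_ne h3]
      exact ((hP i).real _ _ _ (bal_left _ _) (bal_right _ _)).mono (Set.empty_subset _)
  · by_cases h1 : i = k
    · subst h1
      rw [update_self, update_self]
      exact hLR' s hs
    rw [update_of_ne (fun h => h1 (add_right_cancel h)), update_of_ne h1]
    by_cases h2 : i = k - 1
    · subst h2
      rw [sub_add_cancel, update_self, update_self]
      exact hLR s hs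
    · rw [update_of_ne (fun h => h2 (eq_sub_of_add_eq h)), update_of_ne h2]
      exact stdL_succ c i hs
  · by_cases h1 : i = k + 1
    · subst h1
      rw [update_self, add_sub_cancel_right, update_self]
      exact hD' hi
    rw [update_of_ne h1, update_of_ne (fun h => h1 (sub_eq_iff_eq_add.1 h))]
    by_cases h2 : i = k
    · subst h2
      rw [update_self, update_self]
      exact hD hi
    · have hi' : i ∉ ({k, k + 1} : Finset (Fin 15)) := by simp [h1, h2]
      rw [update_of_ne h2, update_of_ne (fun h => h2 (sub_left_injective h))]
      have key : ∀ a b f : Fin 3, a ≠ b → f ≠ a → f ≠ b → Injective ![a, b, f] := by decide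
      exact key _ _ _ (hb.ne i hi') (hb.att i hi' (by simp)).1 (hb.att i hi' (by simp)).2

namespace ColSearch

/-- One step of the search: colour the edges `a`, `b`, `c` with `x`, `y`, `z`. Bit `3 * e + x` of
`m` is set if the edge `e` cannot have the colour `x`. -/
def place (ih : ℕ → Bool) (m a b c x y z : ℕ) : Bool :=
  cond (m.testBit (3 * a + x) || (m.testBit (3 * b + y) || m.testBit (3 * c + z))) true
    (ih (m ||| (2 ^ (3 * a + y) ||| (2 ^ (3 * a + z) ||| (2 ^ (3 * b + x) ||| (2 ^ (3 * b + z) |||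
      (2 ^ (3 * c + x) ||| 2 ^ (3 * c + y))))))))

/-- Exhaustive search for a colouring of edges that is injective on the given triples. -/
noncomputable def fails (l : List (ℕ × ℕ × ℕ)) : ℕ → Bool :=
  List.rec (motive := fun _ => ℕ → Bool) (fun _ => false)
    (fun t _ ih m =>
      place ih m t.1 t.2.1 t.2.2 0 1 2 && (place ih m t.1 t.2.1 t.2.2 0 2 1 &&
      (place ih m t.1 t.2.1 t.2.2 1 0 2 && (place ih m t.1 t.2.1 t.2.2 1 2 0 &&
      (place ih m t.1 t.2.1 t.2.2 2 0 1 && place ih m t.1 t.2.1 t.2.2 2 1 0))))) l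

variable {f : ℕ → Fin 3}

/-- The values of `f` on the triple are distinct. -/
def Distinct (f : ℕ → Fin 3) (t : ℕ × ℕ × ℕ) : Prop :=
  f t.1 ≠ f t.2.1 ∧ f t.1 ≠ f t.2.2 ∧ f t.2.1 ≠ f t.2.2

theorem not_place {ih : ℕ → Bool}
    (hih : ∀ m, (∀ e x, m.testBit (3 * e + x.val) = true → f e ≠ x) → ih m = false) {m a b c : ℕ}
    (hm : ∀ e x, m.testBit (3 * e + x.val) = true → f e ≠ x) {x y z : Fin 3}
    (ha : f a = x) (hb : f b = y) (hc : f c = z) (hxy : x ≠ y) (hxz : x ≠ z) (hyz : y ≠ z) :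
    place ih m a b c x y z = false := by
  have h : ∀ e x, f e = x → m.testBit (3 * e + x.val) = false := fun e x h => by
    rw [Bool.eq_false_iff]; exact fun h' => hm e x h' h
  rw [place, h a x ha, h b y hb, h c z hc]
  refine hih _ fun e w hw => ?_
  simp only [Nat.testBit_or, Nat.testBit_two_pow, Bool.or_eq_true, decide_eq_true_eq] at hw
  have key : ∀ (a : ℕ) (v : Fin 3), 3 * a + v.val = 3 * e + w.val → a = e ∧ v = w := by
    intro a v h
    have := v.2
    have := w.2
    refine ⟨by omega, Fin.ext (by omega)⟩
  obtain hw | hw | hw | hw | hw | hw | hw := hw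
  · exact hm e w hw
  all_goals obtain ⟨rfl, rfl⟩ := key _ _ hw
  · rwa [ha]
  · rwa [ha]
  · rw [hb]; exact hxy.symm
  · rwa [hb]
  · rw [hc]; exact hxz.symm
  · rw [hc]; exact hyz.symm

theorem fails_eq_false {l : List (ℕ × ℕ × ℕ)} (hl : ∀ t ∈ l, Distinct f t) :
    ∀ m, (∀ e x, m.testBit (3 * e + x.val) = true → f e ≠ x) → fails l m = false := by
  induction l with
  | nil => exact fun _ _ => rfl
  | cons t l ih =>
    intro m hm
    obtain ⟨h1, h2, h3⟩ := hl t List.mem_cons_self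
    have key := fun x y z hx hy hz =>
      not_place (ih fun t ht => hl t (List.mem_cons_of_mem _ ht)) hm (a := t.1) (b := t.2.1)
        (c := t.2.2) (x := x) (y := y) (z := z) hx hy hz
    change (_ && (_ && (_ && (_ && (_ && _))))) = false
    have k1 := key 0 1 2
    have k2 := key 0 2 1
    have k3 := key 1 0 2
    have k4 := key 1 2 0
    have k5 := key 2 0 1
    have k6 := key 2 1 0
    have fin3 : ∀ a b c : Fin 3, a ≠ b → a ≠ c → b ≠ c → a = 0 ∧ b = 1 ∧ c = 2 ∨
      a = 0 ∧ b = 2 ∧ c = 1 ∨ a = 1 ∧ b = 0 ∧ c = 2 ∨ a = 1 ∧ b = 2 ∧ c = 0 ∨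
      a = 2 ∧ b = 0 ∧ c = 1 ∨ a = 2 ∧ b = 1 ∧ c = 0 := by decide
    simp only [Bool.and_eq_false_iff]
    obtain ⟨ha, hb, hc⟩ | ⟨ha, hb, hc⟩ | ⟨ha, hb, hc⟩ |
      ⟨ha, hb, hc⟩ | ⟨ha, hb, hc⟩ | ⟨ha, hb, hc⟩ :=
      fin3 _ _ _ h1 h2 h3
    · exact .inl (k1 ha hb hc (by decide) (by decide) (by decide))
    · exact .inr (.inl (k2 ha hb hc (by decide) (by decide) (by decide)))
    · exact .inr (.inr (.inl (k3 ha hb hc (by decide) (by decide) (by decide))))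
    · exact .inr (.inr (.inr (.inl (k4 ha hb hc (by decide) (by decide) (by decide)))))
    · exact .inr (.inr (.inr (.inr (.inl (k5 ha hb hc (by decide) (by decide) (by decide))))))
    · exact .inr (.inr (.inr (.inr (.inr (k6 ha hb hc (by decide) (by decide) (by decide))))))

/-- If the search fails, there is no colouring `h` of a set of half-edges which agrees on
half-edges with the same index and is injective on the given triples. -/
theorem not_exists {E : Type} (eid : E → ℕ) (t : E × E × E) (l : List (E × E × E))
    (hs : place (fails (l.map fun t => (eid t.1, eid t.2.1, eid t.2.2))) 0
      (eid t.1) (eid t.2.1) (eid t.2.2) 0 1 2 = true)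
    (h : E → Fin 3) (hE : ∀ d d', eid d = eid d' → h d = h d')
    (hl : ∀ s ∈ t :: l, h s.1 ≠ h s.2.1 ∧ h s.1 ≠ h s.2.2 ∧ h s.2.1 ≠ h s.2.2) : False := by
  classical
  obtain ⟨h1, h2, h3⟩ := hl t List.mem_cons_self
  obtain ⟨π, hπ, p0, p1, p2⟩ : ∃ π : Fin 3 → Fin 3, Injective π ∧ π (h t.1) = 0 ∧
      π (h t.2.1) = 1 ∧ π (h t.2.2) = 2 := by
    generalize h t.1 = a at h1 h2
    generalize h t.2.1 = b at h1 h3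
    generalize h t.2.2 = c at h2 h3
    revert a b c; decide
  let f : ℕ → Fin 3 := fun e => if he : ∃ d, eid d = e then π (h he.choose) else 0
  have hf : ∀ d, f (eid d) = π (h d) := fun d => by
    have he : ∃ d', eid d' = eid d := ⟨d, rfl⟩
    simp only [f, dif_pos he]
    rw [hE _ _ he.choose_spec]
  have := not_place (f := f) (fails_eq_false (f := f)
    (l := l.map fun t => (eid t.1, eid t.2.1, eid t.2.2)) ?_) (m := 0) (by simp)
    ((hf t.1).trans p0) ((hf t.2.1).trans p1) ((hf t.2.2).trans p2) (by decide) (by decide)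
    (by decide)
  · exact Bool.false_ne_true (this.symm.trans hs)
  · intro s' hs'
    obtain ⟨s, hs1, rfl⟩ := List.mem_map.1 hs'
    obtain ⟨h1, h2, h3⟩ := hl s (List.mem_cons_of_mem _ hs1)
    simp only [Distinct, hf]
    exact ⟨hπ.ne h1, hπ.ne h2, hπ.ne h3⟩

end ColSearch

/-- The permutations of the colours. -/
def permOf : ℕ → Fin 3 → Fin 3
  | 0 => ![0, 1, 2]
  | 1 => ![0, 2, 1]
  | 2 => ![1, 0, 2]
  | 3 => ![1, 2, 0]
  | 4 => ![2, 0, 1]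
  | _ => ![2, 1, 0]

theorem permOf_injective (n : ℕ) : Injective (permOf n) := by
  unfold permOf
  split <;> decide

namespace BaseCol

/-- The colours of the edges of the cycle, encoded in base three. -/
def outer (N : ℕ × ℕ) (i : Fin 15) : Fin 3 := ⟨N.1 / 3 ^ i.val % 3, Nat.mod_lt _ (by decide)⟩

/-- The colours of the other edges, encoded by a permutation at each vertex. -/
def inner (N : ℕ × ℕ) (d : Fin 21 × Fin 3) : Fin 3 := permOf (N.2 / 6 ^ d.1.val % 6) d.2

/-- A test for `BaseCol`. -/
def check (XD : Finset (Fin 15)) (XU : Finset (Fin 21)) (N : ℕ × ℕ) : Prop :=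
  (∀ d, Sum.elim
    (fun d' => decide (d.1 ∈ XU ∨ d'.1 ∈ XU ∨ inner N d' = inner N d))
    (fun i => decide (i ∈ XD ∨ d.1 ∈ XU ∨ inner N d ≠ outer N i ∧ inner N d ≠ outer N (i - 1)))
    (nbU d) = true) ∧ ∀ i ∉ XD, outer N i ≠ outer N (i - 1)

instance (XD : Finset (Fin 15)) (XU : Finset (Fin 21)) (N : ℕ × ℕ) : Decidable (check XD XU N) :=
  inferInstanceAs (Decidable (_ ∧ _))

theorem of_check {XD : Finset (Fin 15)} {XU : Finset (Fin 21)} {N : ℕ × ℕ} (h : check XD XU N) :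
    BaseCol XD XU (outer N) (inner N) where
  inj u _ := permOf_injective (N.2 / 6 ^ u.val % 6)
  flip d d' hd h1 h2 := by
    have := h.1 d
    rw [hd, Sum.elim_inl, decide_eq_true_eq] at this
    exact (this.resolve_left h1).resolve_left h2
  ne := h.2
  att i h1 h2 := by
    have := h.1 (_root_.att i)
    rw [(nbU_eq_inr _ _).2 rfl, Sum.elim_inr, decide_eq_true_eq] at this
    exact (this.resolve_left h1).resolve_left h2

/-- Colourings of the base graph without two consecutive vertices of the cycle. -/
def pairTable : List (ℕ × ℕ) :=
  [(10853625, 5737642267732417), (5380848, 5483710719126129), (5702781, 3530413986046624),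
    (5387493, 11455316639996105), (8289246, 14785352447622838), (5381508, 11454060587906355),
    (5384667, 11456144131404909), (5381751, 11455852079785745), (8192775, 5247158445487798),
    (8163615, 11134253169074015), (5690847, 5771464000230045), (5867994, 7765988704793603),
    (5159406, 1742919052375043), (5916756, 14002602199023859), (3860362, 18407628242147814)]

/-- Colourings of the base graph without the ends of an edge off the cycle. -/
def innerTable : List (ℕ × ℕ) :=
  [(8290461, 7478270728984764), (8172363, 11422182336170976), (8172381, 11422182077871852),
    (0, 0), (8172363, 11422182336206549), (8170905, 11422557105554451),
    (0, 0), (8569911, 5398174490570517), (8172363, 5399112683760135),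
    (0, 0), (8172363, 11422182336188847), (6045168, 7154220821857804),
    (0, 0), (8290461, 7478270728979941), (8173092, 11420060336224163),
    (0, 0), (0, 0), (8644755, 132100486528803),
    (0, 0), (6057564, 7153657203219639), (6057561, 7153657203219639),
    (0, 0), (6057561, 7153657171652750), (0, 0),
    (0, 0), (0, 0), (0, 0),
    (0, 0), (0, 0), (6057561, 7153657024900033),
    (0, 0), (0, 0), (0, 0),
    (0, 0), (5381751, 11456031301531409), (5384667, 11456146670984301),
    (0, 0), (0, 0), (0, 0),
    (0, 0), (0, 0), (5384910, 11454648319137075),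
    (0, 0), (0, 0), (5384667, 11453747131249971),
    (0, 0), (0, 0), (0, 0),
    (0, 0), (5690847, 18875519520391007), (6045141, 3489186085090307),
    (0, 0), (6045141, 5500637449114269), (0, 0),
    (0, 0), (0, 0), (6045141, 11032833977663327),
    (0, 0), (0, 0), (0, 0),
    (0, 0), (0, 0), (0, 0)]

/-- Colourings of the base graph without the ends of an edge leaving the cycle. -/
def attTable : List (ℕ × ℕ) :=
  [(5380840, 11456413688217823), (5380839, 5483710819903089), (5380842, 11456413689337567),
    (5380833, 5483710547805297), (5380860, 4132399143998109), (5380779, 11454119723832429),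
    (5381022, 11456379223897197), (5380293, 11456411512835181), (5382480, 11456078827934829),
    (5375919, 11456413692510175), (5395602, 4958984346882717), (5336553, 487525143564957),
    (5513700, 4146504693535389), (4982259, 5399077492445853), (6576582, 11456416591993965)]

end BaseCol

open BaseCol

theorem exists_baseCol_pair (k : Fin 15) : ∃ c h, BaseCol {k, k + 1} ∅ c h ∧
    c (k - 1) = h (att k) ∧ c (k + 1) = h (att (k + 1)) := by
  have key : ∀ k : Fin 15, check {k, k + 1} ∅ (pairTable.getD k.val 0) ∧
      outer (pairTable.getD k.val 0) (k - 1) = inner (pairTable.getD k.val 0) (att k) ∧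
      outer (pairTable.getD k.val 0) (k + 1) = inner (pairTable.getD k.val 0) (att (k + 1)) := by
    decide +kernel
  exact ⟨_, _, of_check (key k).1, (key k).2⟩

theorem exists_baseCol_inner (d d' : Fin 21 × Fin 3) (h : nbU d = .inl d') :
    ∃ c h, BaseCol ∅ {d.1, d'.1} c h := by
  have key : ∀ d, Sum.elim (fun d' => decide (check ∅ {d.1, d'.1} (innerTable.getD
      (min (3 * d.1.val + d.2.val) (3 * d'.1.val + d'.2.val)) 0))) (fun _ => true) (nbU d) =
      true := by
    decide +kernel
  have := key d
  rw [h, Sum.elim_inl, decide_eq_true_eq] at this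
  exact ⟨_, _, of_check this⟩

theorem exists_baseCol_att (i : Fin 15) : ∃ c h, BaseCol {i} {(att i).1} c h := by
  have key : ∀ i : Fin 15, check {i} {(att i).1} (attTable.getD i.val 0) := by
    decide +kernel
  exact ⟨_, _, of_check (key i)⟩

theorem not_baseCol (c h) : ¬ BaseCol {14, 9} ∅ c h := by
  intro hb
  let trD : Fin 15 → (Fin 15 ⊕ (Fin 21 × Fin 3)) × (Fin 15 ⊕ (Fin 21 × Fin 3)) ×
    (Fin 15 ⊕ (Fin 21 × Fin 3)) := fun i => (.inl i, .inl (i - 1), .inr (att i))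
  let trU : Fin 21 → (Fin 15 ⊕ (Fin 21 × Fin 3)) × (Fin 15 ⊕ (Fin 21 × Fin 3)) ×
    (Fin 15 ⊕ (Fin 21 × Fin 3)) := fun u => (.inr (u, 0), .inr (u, 1), .inr (u, 2))
  let code : Fin 21 × Fin 3 → ℕ := fun d => 3 * d.1.val + d.2.val
  let eid : Fin 15 ⊕ (Fin 21 × Fin 3) → ℕ := Sum.elim (fun i => i.val) fun d =>
    15 + Sum.elim (fun d' => min (code d) (code d')) (fun _ => code d) (nbU d)
  have hD : ∀ i, i ∉ ({14, 9} : Finset (Fin 15)) → Sum.elim c h (trD i).1 ≠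
      Sum.elim c h (trD i).2.1 ∧ Sum.elim c h (trD i).1 ≠ Sum.elim c h (trD i).2.2 ∧
      Sum.elim c h (trD i).2.1 ≠ Sum.elim c h (trD i).2.2 := fun i hi =>
    ⟨hb.ne i hi, (hb.att i hi (by simp)).1.symm, (hb.att i hi (by simp)).2.symm⟩
  have hU : ∀ u, Sum.elim c h (trU u).1 ≠ Sum.elim c h (trU u).2.1 ∧
      Sum.elim c h (trU u).1 ≠ Sum.elim c h (trU u).2.2 ∧
      Sum.elim c h (trU u).2.1 ≠ Sum.elim c h (trU u).2.2 := fun u =>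
    ⟨(hb.inj u (by simp)).ne (a₁ := 0) (a₂ := 1) (by decide),
      (hb.inj u (by simp)).ne (a₁ := 0) (a₂ := 2) (by decide),
      (hb.inj u (by simp)).ne (a₁ := 1) (a₂ := 2) (by decide)⟩
  have hE : ∀ d d', eid (.inr d) = eid (.inr d') → d = d' ∨ nbU d = .inl d' := by
    decide +kernel
  refine ColSearch.not_exists eid (trD 6)
    [trD 7, trU 13, trU 11, trU 12, trD 5, trU 15, trU 14, trU 1,
      trD 8, trU 4, trU 2, trU 3, trU 0, trU 5, trU 10, trD 4,
      trD 3, trU 9, trD 2, trD 1, trU 8, trU 6, trU 7, trD 0,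
      trU 16, trU 20, trU 19, trU 18, trU 17, trD 13, trD 12, trD 11,
      trD 10]
    (by decide +kernel) (Sum.elim c h) (fun e e' he => ?_) ?_
  · obtain i | d := e <;> obtain i' | d' := e'
    · obtain rfl : i = i' := Fin.ext he
      rfl
    · have := i.2
      simp only [eid, Sum.elim_inl, Sum.elim_inr] at he
      lia
    · have := i'.2
      simp only [eid, Sum.elim_inl, Sum.elim_inr] at he
      lia
    · obtain rfl | hd := hE d d' he
      · rfl
      · exact (hb.flip d d' hd (by simp) (by simp)).symm
  · simp only [List.forall_mem_cons]
    and_intros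
    all_goals first
      | exact (hU _).1 | exact (hU _).2.1 | exact (hU _).2.2
      | exact (hD _ (by decide)).1 | exact (hD _ (by decide)).2.1 | exact (hD _ (by decide)).2.2
      | simp

theorem bal_oth (L : Fin 3 → Fin 3) (f : Fin 3) (h : Injective L) (h0 : L 0 ≠ f) :
    Bal f ![oth (L 0) f, L 1, L 2] := by
  revert L f; decide

theorem injective_oth (a f : Fin 3) (h : a ≠ f) :
    Injective ![a, oth a f, f] ∧ Injective ![oth a f, a, f] := by
  revert a f; decide

section

variable {P : Fin 15 → Piece} (hP : ∀ i, (P i).Good)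
include hP

theorem exists_isCol_edge (k : Fin 15) {d d' : (P k).W × Fin 3} (h : (P k).nb d = .inl d') :
    ∃ h, (assemble P).IsCol {.inr (.inr ⟨k, d.1⟩), .inr (.inr ⟨k, d'.1⟩)} h := by
  obtain ⟨c, g, hb, h1, h2⟩ := exists_baseCol_pair k
  obtain ⟨L, R, hL, hR, hLf, hRg, hreal⟩ := (hP k).real_edge d d' h (g (att k)) (g (att (k + 1)))
  refine isCol_of_baseCol_pair hP hb (L := L) (R := ![oth (L 0) (g (att k)), L 1, L 2])
    (L' := ![oth (R 0) (g (att (k + 1))), R 1, R 2]) (R' := R) ?_ (hreal.mono ?_)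
    (((hP (k + 1)).real _ _ _ (bal_oth _ _ hR hRg) ?_).mono (Set.empty_subset _)) ?_ ?_ ?_ ?_
  · rw [h1]; exact bal_oth _ _ hL hLf
  · rintro w (rfl | rfl) <;> simp
  · rw [← h2]; exact bal_right _ _
  · intro s hs; fin_cases s <;> simp at hs ⊢
  · intro s hs; fin_cases s <;> simp at hs ⊢
  · exact fun _ => (injective_oth _ _ hLf).1
  · exact fun _ => (injective_oth _ _ hRg).2

theorem exists_isCol_left (k : Fin 15) : ∃ h, (assemble P).IsCol
    {.inl k, .inr (.inr ⟨k, ((P k).port (false, 0)).1⟩)} h := by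
  obtain ⟨c, g, hb, h1, h2⟩ := exists_baseCol_pair k
  obtain ⟨L, R, hL, hR, hRg, hreal⟩ := (hP k).real_left (g (att k)) (g (att (k + 1)))
  refine isCol_of_baseCol_pair hP hb (L := L) (R := L)
    (L' := ![oth (R 0) (g (att (k + 1))), R 1, R 2]) (R' := R) (by rwa [h1]) (hreal.mono ?_)
    (((hP (k + 1)).real _ _ _ (bal_oth _ _ hR hRg) ?_).mono (Set.empty_subset _))
    (fun _ _ => rfl) ?_ ?_ ?_
  · rintro w rfl; simp
  · rw [← h2]; exact bal_right _ _
  · intro s hs; fin_cases s <;> simp at hs ⊢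
  · simp
  · exact fun _ => (injective_oth _ _ hRg).2

theorem exists_isCol_right (k : Fin 15) : ∃ h, (assemble P).IsCol
    {.inl (k + 1), .inr (.inr ⟨k, ((P k).port (true, 0)).1⟩)} h := by
  obtain ⟨c, g, hb, h1, h2⟩ := exists_baseCol_pair k
  obtain ⟨L, R, hR, hL, hLf, hreal⟩ := (hP k).real_right (g (att k)) (g (att (k + 1)))
  refine isCol_of_baseCol_pair hP hb (L := L) (R := ![oth (L 0) (g (att k)), L 1, L 2])
    (L' := R) (R' := R) ?_ (hreal.mono ?_)
    (((hP (k + 1)).real _ _ _ hR ?_).mono (Set.empty_subset _)) ?_ (fun _ _ => rfl) ?_ ?_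
  · rw [h1]; exact bal_oth _ _ hL hLf
  · rintro w rfl; simp
  · rw [← h2]; exact bal_right _ _
  · intro s hs; fin_cases s <;> simp at hs ⊢
  · exact fun _ => (injective_oth _ _ hLf).1
  · simp

theorem exists_isCol_straight (k : Fin 15) {s : Fin 3} (hs : s ≠ 0) : ∃ h, (assemble P).IsCol
    {.inr (.inr ⟨k, ((P k).port (true, s)).1⟩),
      .inr (.inr ⟨k + 1, ((P (k + 1)).port (false, s)).1⟩)} h := by
  obtain ⟨c, g, hb, h1, h2⟩ := exists_baseCol_pair k
  obtain ⟨L, R, hL, hLf, hRg, hreal⟩ :=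
    (hP k).real_straight_right s hs (g (att k)) (g (att (k + 1)))
  refine isCol_of_baseCol_pair hP hb (L := L) (R := ![oth (L 0) (g (att k)), L 1, L 2])
    (L' := ![oth (R 0) (g (att (k + 1))), R 1, R 2]) (R' := R) ?_ (hreal.mono ?_)
    (((hP (k + 1)).real_straight_left s hs _ _ _ ?_).mono ?_) ?_ ?_ ?_ ?_
  · rw [h1]; exact bal_oth _ _ hL hLf
  · rintro w rfl; simp
  · have : ∀ a b : Fin 3, a ≠ oth b a := by decide
    exact this _ _
  · rintro w rfl; simp
  · intro s hs; fin_cases s <;> simp at hs ⊢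
  · intro s hs; fin_cases s <;> simp at hs ⊢
  · exact fun _ => (injective_oth _ _ hLf).1
  · exact fun _ => (injective_oth _ _ hRg).2

theorem exists_isCol_adj (d : Vtx P × Fin 3) :
    ∃ h, (assemble P).IsCol {d.1, ((assemble P).flip d).1} h := by
  change ∃ h, (assemble P).IsCol {d.1, (Vtx.flip P d).1} h
  have hUD : ∀ i, ∃ h, (assemble P).IsCol {.inl i, .inr (.inl (att i).1)} h := by
    intro i
    obtain ⟨c, g, hb⟩ := exists_baseCol_att i
    exact isCol_of_baseCol hP hb (by simp) (by simp)
  induction d using Vtx.dart_cases P with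
  | D0 i => rw [Vtx.flip_D_zero]; exact exists_isCol_left hP i
  | D1 i =>
    rw [Vtx.flip_D_one]
    simpa using exists_isCol_right hP (i - 1)
  | D2 i => rw [Vtx.flip_D_two]; exact hUD i
  | U d d' h =>
    rw [Vtx.flip_U_inl P h]
    obtain ⟨c, g, hb⟩ := exists_baseCol_inner d d' h
    exact isCol_of_baseCol hP hb (by simp) (by simp)
  | UD i => rw [Vtx.flip_U_att, Set.pair_comm]; exact hUD i
  | M i d d' h => rw [Vtx.flip_dart_inl P h]; exact exists_isCol_edge hP i h
  | MD i p =>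
    rw [Vtx.flip_dart_port]
    obtain ⟨b, s⟩ := p
    by_cases hs : s = 0
    · subst hs
      cases b
      · rw [Vtx.ext_left_zero, Set.pair_comm]; exact exists_isCol_left hP i
      · rw [Vtx.ext_right_zero, Set.pair_comm]; exact exists_isCol_right hP i
    · cases b
      · rw [Vtx.ext_left P hs, Set.pair_comm]
        have := exists_isCol_straight hP (i - 1) hs
        rwa [sub_add_cancel] at this
      · rw [Vtx.ext_right P hs]; exact exists_isCol_straight hP i hs

theorem not_isCol_pair (h) : ¬ (assemble P).IsCol {.inl 14, .inl 9} h := by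
  intro hh
  let L : Fin 15 → Fin 3 → Fin 3 := fun i s => h (Vtx.dart P i ((P i).port (false, s)))
  let R : Fin 15 → Fin 3 → Fin 3 := fun i s => h (Vtx.dart P i ((P i).port (true, s)))
  have hreal : ∀ i, (P i).Real ∅ (L i) (R i) := by
    intro i
    refine ⟨fun d => h (Vtx.dart P i d), ⟨fun w _ => ?_, fun d d' hd _ _ => ?_⟩,
      fun _ _ => rfl, fun _ _ => rfl⟩
    · exact hh.inj (.inr (.inr ⟨i, w⟩)) (by simp)
    · have := hh.flip (Vtx.dart P i d) (by simp)
      rw [assemble_flip, Vtx.flip_dart_inl P hd] at this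
      exact this (by simp)
  have hc : ∀ i, ∃ c, ∑ s, klein (L i s) = klein c ∧ ∑ s, klein (R i s) = klein c := by
    intro i
    have h1 := (hreal i).klein_sum
    have h2 := (hP i).not_real (L i) (R i)
    have key : ∀ L : Fin 3 → Fin 3, ¬ Injective L → ∃ c, ∑ s, klein (L s) = klein c := by
      decide
    have h3 : ¬ (Injective (L i) ∧ Injective (R i)) := fun h => h2 h.1 h.2 (hreal i)
    rcases not_and_or.1 h3 with h3 | h3
    · obtain ⟨c, hc⟩ := key _ h3
      exact ⟨c, hc, h1 ▸ hc⟩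
    · obtain ⟨c, hc⟩ := key _ h3
      exact ⟨c, h1 ▸ hc, hc⟩
  choose c hcL hcR using hc
  have hstr : ∀ i, ∀ s ≠ 0, L i s = R (i - 1) s := by
    intro i s hs
    have := hh.flip (Vtx.dart P i ((P i).port (false, s))) (by simp)
    rw [assemble_flip, Vtx.flip_dart_port P i (false, s),
      Vtx.ext_left P hs] at this
    exact (this (by simp)).symm
  have hkey : ∀ a b f : Fin 3, ∀ x t : Fin 3, ∀ v : ZMod 2 × ZMod 2, Injective ![x, t, f] →
      klein x + v = klein a → klein t + v = klein b → f ≠ a ∧ f ≠ b ∧ a ≠ b := by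
    decide
  have hDc : ∀ i ∉ ({14, 9} : Finset (Fin 15)),
      h (.inl i, 2) ≠ c i ∧ h (.inl i, 2) ≠ c (i - 1) ∧ c i ≠ c (i - 1) := by
    intro i hi
    have hi' : (.inl i : Vtx P) ∉ ({.inl 14, .inl 9} : Set (Vtx P)) := by simpa using hi
    have h0 := hh.flip (.inl i, 0) hi' (by simp [assemble, Vtx.flip_D_zero])
    have h1 := hh.flip (.inl i, 1) hi' (by simp [assemble, Vtx.flip_D_one])
    have hinj := hh.inj _ hi'
    have e0 : L i 0 = h (.inl i, 0) := h0
    have e1 : R (i - 1) 0 = h (.inl i, 1) := h1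
    have a1 := hcL i
    have a2 := hcR (i - 1)
    simp only [Fin.sum_univ_three, add_assoc, ← hstr i _ one_ne_zero,
      ← hstr i 2 (by decide)] at a1 a2
    refine hkey _ _ _ _ _ _ ?_ a1 a2
    rw [e0, e1]
    convert hinj using 1
    ext j; fin_cases j <;> rfl
  refine not_baseCol c (fun d => h (.inr (.inl d.1), d.2)) ⟨?_, ?_, ?_, ?_⟩
  · exact fun u _ => hh.inj (.inr (.inl u)) (by simp)
  · intro d d' hd _ _
    have := hh.flip (.inr (.inl d.1), d.2) (by simp)
    rw [assemble_flip, Vtx.flip_U_inl P hd] at this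
    exact this (by simp)
  · exact fun i hi => (hDc i hi).2.2
  · intro i hi _
    have hi' : (.inl i : Vtx P) ∉ ({.inl 14, .inl 9} : Set (Vtx P)) := by simpa using hi
    have h2 := hh.flip (.inl i, 2) hi' (by simp [assemble, Vtx.flip_D_two])
    have e2 : h (.inr (.inl (att i).1), (att i).2) = h (.inl i, 2) := h2
    simp only [e2]
    exact ⟨(hDc i hi).1, (hDc i hi).2.1⟩

end

/-- The number of edges leaving `T`, for a partial involution `adj` of darts. -/
def pcut {W : Type} [Fintype W] [DecidableEq W] (adj : W × Fin 3 → Option (W × Fin 3))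
    (T : Finset W) : ℕ :=
  (Finset.univ.filter fun d => d.1 ∈ T ∧ ∃ d', adj d = some d' ∧ d'.1 ∉ T).card

/-- The data of one vertex in an exhaustive search over vertex sets: the places of its earlier
neighbours, the cost of selecting it while none of them is selected, and its weights. -/
structure CutEntry where
  a : ℕ
  b : ℕ
  c : ℕ
  k : ℕ
  l : ℕ
  w : ℕ

namespace CutEntry

/-- One if the place `a` is occupied in `m`. -/
def bit (m a : ℕ) : ℕ := cond (Nat.beq (Nat.land m a) 0) 0 1

/-- The number of selected earlier neighbours. -/
def pop (m : ℕ) (e : CutEntry) : ℕ :=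
  Nat.add (bit m e.a) (Nat.add (bit m e.b) (bit m e.c))

/-- A test for cutting off the search. -/
def prune (c lo hi : ℕ) : Bool :=
  cond (Nat.ble 4 c) (cond (Nat.ble 6 (Nat.add c lo)) (Nat.ble hi c) false) false

/-- Exhaustive search over all vertex sets, checking that `acc` holds for each. -/
noncomputable def search (acc : ℕ → ℕ → ℕ → ℕ → Bool) (es : List CutEntry) :
    ℕ → ℕ → ℕ → ℕ → ℕ → ℕ → ℕ → Bool :=
  List.rec (motive := fun _ => ℕ → ℕ → ℕ → ℕ → ℕ → ℕ → ℕ → Bool)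
    (fun _ _ c t l lo _ => acc c t l lo)
    (fun e _ ih p m c t l lo hi => cond (prune c lo hi) true
      (cond (ih (Nat.add p p) m (Nat.add c (pop m e)) t l lo (Nat.sub hi e.w))
        (ih (Nat.add p p) (Nat.add m p) (Nat.add c (Nat.sub e.k (pop m e))) (Nat.add t 1)
          (Nat.add l e.l) (Nat.add lo e.w) hi) false)) es

end CutEntry

section

variable {W : Type} (adj : W × Fin 3 → Option (W × Fin 3)) (ρ : W → ℕ) (xw lw bw : W → ℕ)

/-- The place of the `i`-th neighbour of `w`, if it comes before `w`. -/
def backBit (w : W) (i : Fin 3) : ℕ :=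
  match adj (w, i) with
  | some d => if ρ d.1 < ρ w then 2 ^ ρ d.1 else 0
  | none => 0

/-- One if the `i`-th neighbour of `w` comes before `w`. -/
def backNum (w : W) (i : Fin 3) : ℕ :=
  match adj (w, i) with
  | some d => if ρ d.1 < ρ w then 1 else 0
  | none => 0

/-- The search data of a vertex. -/
def cutEntry (w : W) : CutEntry :=
  ⟨backBit adj ρ w 0, backBit adj ρ w 1, backBit adj ρ w 2,
    backNum adj ρ w 0 + backNum adj ρ w 1 + backNum adj ρ w 2 + xw w, lw w, bw w⟩

variable [DecidableEq W] (T : Finset W)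

/-- One if the `i`-th neighbour of `w` comes before `w` and is separated from it by `T`. -/
def backCut (w : W) (i : Fin 3) : ℕ :=
  match adj (w, i) with
  | some d => if ρ d.1 < ρ w ∧ (w ∈ T ↔ d.1 ∉ T) then 1 else 0
  | none => 0

theorem bit_backBit {m : ℕ} {w : W} (hm : ∀ v, ρ v < ρ w → m.testBit (ρ v) = decide (v ∈ T))
    (i : Fin 3) : (w ∉ T → CutEntry.bit m (backBit adj ρ w i) = backCut adj ρ T w i) ∧
      (w ∈ T → CutEntry.bit m (backBit adj ρ w i) + backCut adj ρ T w i = backNum adj ρ w i) := by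
  have h0 : CutEntry.bit m 0 = 0 := by simp [CutEntry.bit]
  unfold backBit backCut backNum
  cases adj (w, i) with
  | none => simp [h0]
  | some d =>
    by_cases hd : ρ d.1 < ρ w
    swap
    · simp [hd, h0]
    have h1 : CutEntry.bit m (2 ^ ρ d.1) = if d.1 ∈ T then 1 else 0 := by
      have h2 : Nat.land m (2 ^ ρ d.1) = (m.testBit (ρ d.1)).toNat * 2 ^ ρ d.1 :=
        Nat.and_two_pow m _
      rw [CutEntry.bit, h2, hm _ hd]
      by_cases h : d.1 ∈ T
      · have h3 : Nat.beq (2 ^ ρ d.1) 0 = false := by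
          rw [Bool.eq_false_iff, Ne, Nat.beq_eq]
          exact (Nat.two_pow_pos _).ne'
        simp [h, h3]
      · simp [h]
    simp only [hd, if_true, true_and, h1]
    by_cases h : d.1 ∈ T <;> by_cases h' : w ∈ T <;> simp [h, h']

theorem search_sound (hρ : Injective ρ) {acc : ℕ → ℕ → ℕ → ℕ → Bool} {B : ℕ}
    (hacc : ∀ c t l b, 4 ≤ c → 6 ≤ c + b → b ≤ c → b ≤ B → acc c t l b = true) (o : List W) :
    ∀ r m c t l lo hi, o.map ρ = List.range' r o.length →
      (∀ w, ρ w < r → m.testBit (ρ w) = decide (w ∈ T)) → m < 2 ^ r → hi ≤ B →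
      hi = lo + (o.map bw).sum →
      CutEntry.search acc (o.map (cutEntry adj ρ xw lw bw)) (2 ^ r) m c t l lo hi = true →
      acc (c + (o.map fun w => ∑ i, backCut adj ρ T w i + if w ∈ T then xw w else 0).sum)
        (t + (o.map fun w => if w ∈ T then 1 else 0).sum)
        (l + (o.map fun w => if w ∈ T then lw w else 0).sum)
        (lo + (o.map fun w => if w ∈ T then bw w else 0).sum) = true := by
  induction o with
  | nil => intro r m c t l lo hi _ _ _ _ _ h; exact h
  | cons w o ih =>
    intro r m c t l lo hi hr hm hlt h6 hhi h
    have hle : ((w :: o).map fun w => if w ∈ T then bw w else 0).sum ≤ ((w :: o).map bw).sum :=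
      List.sum_le_sum fun v _ => by split <;> omega
    simp only [List.map_cons, List.length_cons, List.range'_succ, List.cons.injEq] at hr
    obtain ⟨hw, hr⟩ := hr
    change cond (CutEntry.prune c lo hi) true _ = true at h
    by_cases hp : CutEntry.prune c lo hi = true
    · have hp' : 4 ≤ c ∧ 6 ≤ c + lo ∧ hi ≤ c := by
        simp only [CutEntry.prune, Bool.cond_false_right, Bool.and_eq_true, Nat.ble_eq] at hp
        exact hp
      exact hacc _ _ _ _ (by omega) (by omega) (by omega) (by omega)
    rw [Bool.not_eq_true] at hp
    rw [hp, cond_false, Bool.cond_false_right, Bool.and_eq_true] at h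
    obtain ⟨h1, h2⟩ := h
    have e2 : (2 ^ r + 2 ^ r : ℕ) = 2 ^ (r + 1) := by ring
    have hbit := bit_backBit adj ρ T (m := m) (w := w) (by rwa [hw])
    have hlast : ∀ v, ρ v = r → v = w := fun v hv => hρ (hv.trans hw.symm)
    have hpop : CutEntry.pop m (cutEntry adj ρ xw lw bw w) =
        CutEntry.bit m (backBit adj ρ w 0) + (CutEntry.bit m (backBit adj ρ w 1) +
          CutEntry.bit m (backBit adj ρ w 2)) := rfl
    have hk : (cutEntry adj ρ xw lw bw w).k =
        backNum adj ρ w 0 + backNum adj ρ w 1 + backNum adj ρ w 2 + xw w := rfl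
    simp only [List.map_cons, List.sum_cons] at hhi ⊢
    by_cases hwT : w ∈ T
    · have hb0 := (hbit 0).2 hwT
      have hb1 := (hbit 1).2 hwT
      have hb2 := (hbit 2).2 hwT
      have := ih (r + 1) (m + 2 ^ r) (c + ((cutEntry adj ρ xw lw bw w).k -
        CutEntry.pop m (cutEntry adj ρ xw lw bw w))) (t + 1) (l + lw w) (lo + bw w) hi hr ?_ ?_ h6
        (by omega) (by rw [← e2]; exact h2)
      · have hc : (cutEntry adj ρ xw lw bw w).k - CutEntry.pop m (cutEntry adj ρ xw lw bw w) =
            backCut adj ρ T w 0 + backCut adj ρ T w 1 + backCut adj ρ T w 2 + xw w := by omega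
        simpa only [hc, hwT, if_true, Fin.sum_univ_three, ← add_assoc] using this
      · intro v hv
        rcases (Nat.lt_succ_iff_lt_or_eq.1 hv) with hv | hv
        · rw [add_comm, Nat.testBit_two_pow_add_gt hv, hm v hv]
        · rw [add_comm, hv, Nat.testBit_two_pow_add_eq, Nat.testBit_lt_two_pow hlt, hlast v hv]
          simpa using hwT
      · rw [← e2]; omega
    · have hb0 := (hbit 0).1 hwT
      have hb1 := (hbit 1).1 hwT
      have hb2 := (hbit 2).1 hwT
      have := ih (r + 1) m (c + CutEntry.pop m (cutEntry adj ρ xw lw bw w)) t l lo (hi - bw w)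
        hr ?_ ?_ (by omega) (by omega) (by rw [← e2]; exact h1)
      · have hc : CutEntry.pop m (cutEntry adj ρ xw lw bw w) =
            backCut adj ρ T w 0 + backCut adj ρ T w 1 + backCut adj ρ T w 2 := by omega
        simpa only [hc, hwT, if_false, Fin.sum_univ_three, ← add_assoc, add_zero, zero_add]
          using this
      · intro v hv
        rcases (Nat.lt_succ_iff_lt_or_eq.1 hv) with hv | hv
        · exact hm v hv
        · rw [hv, Nat.testBit_lt_two_pow hlt, hlast v hv]
          simpa using hwT
      · rw [← e2]; omega

end

section

variable {W : Type} [Fintype W] [DecidableEq W] {adj : W × Fin 3 → Option (W × Fin 3)}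
  {ρ : W → ℕ}

theorem pcut_eq_sum (hadj : ∀ d d', adj d = some d' → adj d' = some d)
    (hρ : Injective ρ) (T : Finset W) :
    pcut adj T = ∑ w, ∑ i, backCut adj ρ T w i := by
  have hex : ∀ d, ∃ d', ∀ e, adj d = some e → d' = e := fun d => by
    cases h : adj d with
    | some e => exact ⟨e, fun _ h => by simpa using h⟩
    | none => exact ⟨d, fun _ h => by simp at h⟩
  choose g hg using hex
  have hback : ∀ d, backCut adj ρ T d.1 d.2 =
      if ∃ d', adj d = some d' ∧ ρ d'.1 < ρ d.1 ∧ (d.1 ∈ T ↔ d'.1 ∉ T) then 1 else 0 := by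
    intro d
    unfold backCut
    cases h : adj (d.1, d.2) with
    | none => simp
    | some e => simp
  rw [← Fintype.sum_prod_type', Finset.sum_congr rfl fun d _ => hback d, Finset.sum_boole,
    Nat.cast_id, pcut]
  refine Finset.card_nbij' (fun d => if ρ (g d).1 < ρ d.1 then d else g d)
    (fun d => if d.1 ∈ T then d else g d) ?_ ?_ ?_ ?_
  · intro d hd
    simp only [Finset.coe_filter, Finset.mem_univ, true_and, Set.mem_ofPred_eq] at hd ⊢
    obtain ⟨h1, d', h2, h3⟩ := hd
    obtain rfl := hg _ _ h2
    split_ifs with h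
    · exact ⟨_, h2, h, by tauto⟩
    · refine ⟨d, hadj _ _ h2, lt_of_le_of_ne (not_lt.1 h) fun e => h3 (hρ e ▸ h1), by tauto⟩
  · intro d hd
    simp only [Finset.coe_filter, Finset.mem_univ, true_and, Set.mem_ofPred_eq] at hd ⊢
    obtain ⟨d', h2, h3, h4⟩ := hd
    obtain rfl := hg _ _ h2
    split_ifs with h
    · exact ⟨h, _, h2, h4.1 h⟩
    · exact ⟨by tauto, d, hadj _ _ h2, h⟩
  · intro d hd
    simp only [Finset.coe_filter, Finset.mem_univ, true_and, Set.mem_ofPred_eq] at hd ⊢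
    obtain ⟨h1, d', h2, h3⟩ := hd
    obtain rfl := hg _ _ h2
    split_ifs with h
    · rfl
    · exact hg _ _ (hadj _ _ h2)
  · intro d hd
    simp only [Finset.coe_filter, Finset.mem_univ, true_and, Set.mem_ofPred_eq] at hd ⊢
    obtain ⟨d', h2, h3, h4⟩ := hd
    obtain rfl := hg _ _ h2
    have h5 := hg _ _ (hadj _ _ h2)
    split_ifs with h h1
    · rfl
    · rw [h5] at h1
      omega
    · exact h5

/-- The place of `w` in the list `o`. -/
def place (o : List W) (w : W) : ℕ := @List.idxOf W instBEqOfDecidableEq w o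

theorem search_complete (xw lw bw : W → ℕ) {acc : ℕ → ℕ → ℕ → ℕ → Bool}
    (hadj : ∀ d d', adj d = some d' → adj d' = some d) {B : ℕ}
    (hacc : ∀ c t l b, 4 ≤ c → 6 ≤ c + b → b ≤ c → b ≤ B → acc c t l b = true)
    {o : List W} (ho : ∀ w, place o w < o.length) (hr : o.map (place o) = List.range o.length)
    (hB : B = ∑ w, bw w)
    (h : CutEntry.search acc (o.map (cutEntry adj (place o) xw lw bw)) 1 0 0 0 0 0 B = true)
    (T : Finset W) :
    acc (pcut adj T + ∑ w ∈ T, xw w) T.card (∑ w ∈ T, lw w) (∑ w ∈ T, bw w) = true := by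
  have ho' : ∀ w, w ∈ o := fun w => List.idxOf_lt_length_iff.1 (ho w)
  have hρ : Injective (place o) := fun v w h => (List.idxOf_inj (ho' v)).1 h
  have hnd : o.Nodup := by
    have : (o.map (place o)).Nodup := hr ▸ List.nodup_range
    exact List.Nodup.of_map _ this
  have hsum : ∀ f : W → ℕ, (o.map f).sum = ∑ w, f w := fun f => by
    rw [← List.sum_toFinset _ hnd]
    exact Finset.sum_congr (by ext; simp [ho']) fun _ _ => rfl
  have hite : ∀ f : W → ℕ, (∑ w, if w ∈ T then f w else 0) = ∑ w ∈ T, f w := fun f => by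
    rw [← Finset.sum_filter]
    exact Finset.sum_congr (by ext; simp) fun _ _ => rfl
  have := search_sound adj (place o) xw lw bw T hρ hacc o 0 0 0 0 0 0 B
    (by rw [hr, List.range_eq_range']) (by simp) (by simp) le_rfl (by rw [hsum, zero_add, hB]) h
  simp only [hsum, hite, zero_add, Finset.sum_add_distrib] at this
  rw [pcut_eq_sum hadj hρ]
  simpa using this

end

namespace Piece

variable (P : Piece)

/-- The number of edges inside the piece leaving `T`. -/
def cut (T : Finset P.W) : ℕ := pcut (fun d => (P.nb d).getLeft?) T

/-- The number of dangling edges of `T` on the side `b`. -/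
def side (b : Bool) (T : Finset P.W) : ℕ :=
  (Finset.univ.filter fun s => (P.port (b, s)).1 ∈ T).card

/-- Conditions on a part of a piece which allow one to remove it from a bad set. -/
def Light (T : Finset P.W) : Prop :=
  T = ∅ ∨ (T.card + (P.side false T + P.side true T) ≤ P.cut T ∧ T.card < P.cut T) ∨
    (P.side false T + P.side true T + 1 ≤ P.cut T ∧
      6 ≤ P.cut T + (P.side false T + P.side true T)) ∨
    (P.cut T = 3 ∧ T.card = 3 ∧ P.side false T = 1 ∧ P.side true T = 1)

/-- Every division of the piece cuts many edges or is uneven. -/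
def Solid : Prop := ∀ T, 6 ≤ P.cut T ∨ P.Light T ∨ P.Light Tᶜ

end Piece

namespace Vtx

variable (P : Fin 15 → Piece)

/-- The inclusion of a piece. -/
def emb (k : Fin 15) : (P k).W ↪ Vtx P :=
  ⟨fun w => .inr (.inr ⟨k, w⟩), fun _ _ h => by simpa using h⟩

theorem emb_apply (k : Fin 15) (w) : emb P k w = .inr (.inr ⟨k, w⟩) := rfl

/-- The vertices of a piece. -/
abbrev module (k : Fin 15) : Finset (Vtx P) := Finset.univ.map (emb P k)

variable {P}

theorem mem_module {k : Fin 15} {w : (P k).W} : (.inr (.inr ⟨k, w⟩) : Vtx P) ∈ module P k := by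
  simpa using ⟨w, rfl⟩

theorem mem_map_emb {k : Fin 15} {T : Finset (P k).W} {w : (P k).W} :
    (.inr (.inr ⟨k, w⟩) : Vtx P) ∈ T.map (emb P k) ↔ w ∈ T := by
  rw [← emb_apply, Finset.mem_map' (emb P k)]

theorem module_sdiff (k : Fin 15) (T : Finset (P k).W) :
    module P k \ T.map (emb P k) = Tᶜ.map (emb P k) := by
  ext v
  simp only [Finset.mem_sdiff, Finset.mem_map, Finset.mem_univ, true_and, Finset.mem_compl]
  constructor
  · rintro ⟨⟨w, rfl⟩, h⟩
    exact ⟨w, fun hw => h ⟨w, hw, rfl⟩, rfl⟩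
  · rintro ⟨w, hw, rfl⟩
    refine ⟨⟨w, rfl⟩, ?_⟩
    rintro ⟨w', hw', e⟩
    rw [(emb P k).injective e] at hw'
    exact hw hw'

theorem exists_map_emb {k : Fin 15} {T : Finset (Vtx P)} (hT : T ⊆ module P k) :
    ∃ T' : Finset (P k).W, T = T'.map (emb P k) := by
  obtain ⟨T', -, h⟩ := Finset.subset_map_iff.1 hT
  exact ⟨T', h⟩

theorem flip_emb_inl {k : Fin 15} {w : (P k).W} {i : Fin 3} {d : (P k).W × Fin 3}
    (h : (P k).nb (w, i) = .inl d) : flip P (.inr (.inr ⟨k, w⟩), i) = dart P k d :=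
  flip_dart_inl P h

theorem flip_emb_inr {k : Fin 15} {w : (P k).W} {i : Fin 3} {p : Bool × Fin 3}
    (h : (P k).nb (w, i) = .inr p) : flip P (.inr (.inr ⟨k, w⟩), i) = ext P k p := by
  rw [← flip_dart_port, ((P k).nb_eq_inr _ p).1 h]

theorem cut_map_emb (k : Fin 15) (T : Finset (P k).W) :
    (assemble P).cut (T.map (emb P k)) (module P k \ T.map (emb P k)) = (P k).cut T := by
  rw [module_sdiff]
  symm
  refine Finset.card_nbij (dart P k) ?_ ?_ ?_
  · intro d hd
    simp only [Finset.coe_filter, Finset.mem_univ, true_and, Set.mem_ofPred_eq,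
      Sum.getLeft?_eq_some_iff] at hd ⊢
    obtain ⟨h1, d', h2, h3⟩ := hd
    rw [assemble_flip, flip_dart_inl P h2, mem_map_emb, mem_map_emb, Finset.mem_compl]
    exact ⟨h1, h3⟩
  · intro d _ d' _ h
    simpa [dart, Prod.ext_iff] using h
  · rintro ⟨v, i⟩ h
    simp only [Finset.coe_filter, Finset.mem_univ, true_and, Set.mem_ofPred_eq, Finset.mem_map]
      at h
    obtain ⟨⟨w, hw, rfl⟩, w', hw', h⟩ := h
    refine ⟨(w, i), ?_, rfl⟩
    simp only [Finset.coe_filter, Finset.mem_univ, true_and, Set.mem_ofPred_eq,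
      Sum.getLeft?_eq_some_iff]
    refine ⟨hw, ?_⟩
    rw [Finset.mem_compl] at hw'
    cases h2 : (P k).nb (w, i) with
    | inl d =>
      refine ⟨d, rfl, ?_⟩
      rw [emb_apply, emb_apply, assemble_flip, flip_emb_inl h2] at h
      rwa [← (by simpa using h : w' = d.1)]
    | inr p =>
      rw [emb_apply, emb_apply, assemble_flip, flip_emb_inr h2] at h
      exact absurd h.symm (ext_fst_ne P k p w')

theorem cut_map_emb_compl (k : Fin 15) (T : Finset (P k).W) :
    (assemble P).cut (T.map (emb P k)) (module P k)ᶜ = (P k).side false T + (P k).side true T := by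
  have h1 : (P k).side false T + (P k).side true T =
      (Finset.univ.filter fun p => ((P k).port p).1 ∈ T).card := by
    simp only [Piece.side, Finset.card_filter]
    rw [Fintype.sum_prod_type, Fintype.sum_bool, add_comm]
  rw [h1]
  symm
  refine Finset.card_nbij (fun p => dart P k ((P k).port p)) ?_ ?_ ?_
  · intro p hp
    simp only [Finset.coe_filter, Finset.mem_univ, true_and, Set.mem_ofPred_eq,
      Finset.mem_compl] at hp ⊢
    rw [mem_map_emb, assemble_flip, flip_dart_port]
    refine ⟨hp, fun h => ?_⟩
    obtain ⟨w, -, h⟩ := Finset.mem_map.1 h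
    exact ext_fst_ne P k p w h.symm
  · intro p _ q _ h
    have : (P k).port p = (P k).port q := by simpa [dart, Prod.ext_iff] using h
    have h2 := (P k).nb_port p
    rw [this, (P k).nb_port] at h2
    simpa using h2.symm
  · rintro ⟨v, i⟩ h
    simp only [Finset.coe_filter, Finset.mem_univ, true_and, Set.mem_ofPred_eq,
      Finset.mem_compl] at h
    obtain ⟨h, h'⟩ := h
    obtain ⟨w, hw, rfl⟩ := Finset.mem_map.1 h
    cases h2 : (P k).nb (w, i) with
    | inl d =>
      rw [emb_apply, assemble_flip, flip_dart_inl P h2] at h'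
      exact absurd mem_module h'
    | inr p =>
      have h3 := ((P k).nb_eq_inr _ p).1 h2
      refine ⟨p, ?_, ?_⟩
      · simpa [h3] using hw
      · simp only [h3]; rfl

theorem cut_singleton_map_emb {k : Fin 15} {v : Vtx P} (hv : v ∉ module P k)
    {T : Finset (P k).W} (h : (assemble P).cut {v} (T.map (emb P k)) ≠ 0) :
    ∃ p, ((P k).port p).1 ∈ T ∧ (ext P k p).1 = v := by
  rw [DartGraph.cut_singleton, Finset.card_ne_zero] at h
  obtain ⟨i, hi⟩ := h
  simp only [Finset.mem_filter, Finset.mem_univ, true_and, Finset.mem_map] at hi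
  obtain ⟨w, hw, hi⟩ := hi
  have h1 := (assemble P).flip_flip (v, i)
  rw [← Prod.mk.eta (p := (assemble P).flip (v, i)), ← hi, emb_apply, assemble_flip,
    assemble_flip] at h1
  cases h2 : (P k).nb (w, (Vtx.flip P (v, i)).2) with
  | inl d =>
    rw [flip_dart_inl P h2] at h1
    have h3 : (dart P k d).1 = v := congrArg Prod.fst h1
    exact absurd (h3 ▸ mem_module) hv
  | inr p =>
    have h3 := ((P k).nb_eq_inr _ p).1 h2
    refine ⟨p, by rwa [h3], ?_⟩
    have h4 := flip_dart_port P k p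
    rw [h3] at h4
    rw [← h4]
    exact congrArg Prod.fst h1

theorem cut_ext_left_right (k : Fin 15) (s t : Fin 3) :
    (assemble P).cut {(ext P k (false, s)).1} {(ext P k (true, t)).1} = 0 := by
  rw [DartGraph.cut_singleton, Finset.card_eq_zero, Finset.filter_eq_empty_iff]
  intro i _ h
  rw [Finset.mem_singleton, assemble_flip] at h
  have e1 : ∀ k : Fin 15, k + 1 ≠ k - 1 ∧ k + 1 ≠ k ∧ k + 1 ≠ k - 1 - 1 ∧ k ≠ k - 1 - 1 ∧
    k ≠ k - 1 := by decide
  obtain ⟨e1, e2, e3, e4, e5⟩ := e1 k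
  have key : ∀ (w : (P (k - 1)).W), ∀ v, v = (ext P k (true, t)).1 →
      (flip P (.inr (.inr ⟨k - 1, w⟩), i)).1 = v → False := by
    intro w v hv h
    have hv' : v = .inl (k + 1) ∨ ∃ w, v = .inr (.inr ⟨k + 1, w⟩) := by
      rw [hv]
      by_cases ht : t = 0
      · subst ht; left; rfl
      · right; rw [ext_right P ht]; exact ⟨_, rfl⟩
    cases h2 : (P (k - 1)).nb (w, i) with
    | inl d =>
      rw [flip_emb_inl h2] at h
      subst h
      obtain h | ⟨w', h⟩ := hv'
      · simp at h
      · simp [Sigma.mk.injEq, e1.symm] at h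
    | inr p =>
      rw [flip_emb_inr h2] at h
      subst h
      obtain ⟨b, s⟩ := p
      by_cases hs : s = 0 <;> cases b <;> obtain h | ⟨w', h⟩ := hv' <;>
        simp [ext, hs, Sigma.mk.injEq, e1.symm, e2.symm, e3.symm] at h
  by_cases hs : s = 0
  · subst hs
    rw [ext_left_zero] at h
    by_cases ht : t = 0
    · subst ht
      rw [ext_right_zero] at h
      fin_cases i <;> simp [flip] at h
    · rw [ext_right P ht] at h
      fin_cases i <;> simp [flip, Sigma.mk.injEq, e1.symm, e2.symm] at h
  · rw [ext_left P hs] at h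
    exact key _ _ rfl h

theorem roundable {k : Fin 15} (hk : (P k).Solid) : (assemble P).Roundable (module P k) := by
  constructor
  · intro v hv
    rw [DartGraph.cut_singleton, Finset.card_le_one]
    intro i hi j hj
    simp only [Finset.mem_filter, Finset.mem_univ, true_and] at hi hj
    have key : ∀ i, ((assemble P).flip (v, i)).1 ∈ module P k →
        ∃ p, (v, i) = ext P k p := by
      intro i hi
      obtain ⟨w, -, hw⟩ := Finset.mem_map.1 hi
      have h1 := (assemble P).flip_flip (v, i)
      rw [← Prod.mk.eta (p := (assemble P).flip (v, i)), ← hw, emb_apply, assemble_flip,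
        assemble_flip] at h1
      cases h2 : (P k).nb (w, (Vtx.flip P (v, i)).2) with
      | inl d =>
        rw [flip_dart_inl P h2] at h1
        have h3 : (dart P k d).1 = v := congrArg Prod.fst h1
        exact absurd (h3 ▸ mem_module) hv
      | inr p =>
        refine ⟨p, ?_⟩
        rw [← flip_dart_port, ((P k).nb_eq_inr _ p).1 h2]
        exact h1.symm
    obtain ⟨p, hp⟩ := key i hi
    obtain ⟨q, hq⟩ := key j hj
    have : p = q := ext_fst_inj P k p q (by rw [← hp, ← hq])
    subst this
    exact congrArg Prod.snd (hp.trans hq.symm)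
  · intro T hT
    obtain ⟨T, rfl⟩ := exists_map_emb hT
    have key : ∀ T, (P k).Light T → (assemble P).Light (module P k) (T.map (emb P k)) := by
      intro T hT
      unfold DartGraph.Light
      rw [cut_map_emb, cut_map_emb_compl, Finset.card_map]
      obtain h | h | h | ⟨h1, h2, h3, h4⟩ := hT
      · left; simp [h]
      · right; left; exact h
      · right; right; left; exact h
      · refine .inr (.inr (.inr ⟨h1, h2, by omega, ?_⟩))
        have huniq : ∀ b s t, ((P k).port (b, s)).1 ∈ T → ((P k).port (b, t)).1 ∈ T → s = t := by
          intro b s t hs ht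
          have : (P k).side b T ≤ 1 := by cases b <;> omega
          exact Finset.card_le_one.1 this s (by simpa using hs) t (by simpa using ht)
        intro u hu w hw hu' hw'
        obtain ⟨⟨b, s⟩, hs, rfl⟩ := cut_singleton_map_emb hu hu'
        obtain ⟨⟨b', s'⟩, hs', rfl⟩ := cut_singleton_map_emb hw hw'
        cases b <;> cases b'
        · rw [huniq _ _ _ hs hs', DartGraph.cut_singleton_self]
        · exact cut_ext_left_right k _ _
        · rw [DartGraph.cut_comm]; exact cut_ext_left_right k _ _
        · rw [huniq _ _ _ hs hs', DartGraph.cut_singleton_self]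
    obtain h | h | h := hk T
    · left; rwa [cut_map_emb]
    · exact .inr (.inl (key _ h))
    · right; right; rw [module_sdiff]; exact key _ h

end Vtx

/-- The function `m` on a cycle changes its value at least twice unless it is constant. -/
theorem two_le_card_filter_ne {m : Fin 15 → Bool} (h : ∃ i j, m i ≠ m j) :
    2 ≤ (Finset.univ.filter fun i => m i ≠ m (i + 1)).card := by
  set K := Finset.univ.filter fun i => m i ≠ m (i + 1) with hK
  have h0 : K.card ≠ 0 := by
    intro h0
    rw [Finset.card_eq_zero, hK, Finset.filter_eq_empty_iff] at h0
    have h1 : ∀ k : ℕ, ∀ hk : k < 15, m ⟨k, hk⟩ = m 0 := by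
      intro k
      induction k with
      | zero => intro _; rfl
      | succ k ih =>
        intro hk
        rw [← ih (by omega)]
        have := h0 (Finset.mem_univ ⟨k, by omega⟩)
        rw [not_not] at this
        rw [this]
        congr 1
        simp [Fin.ext_iff, Fin.val_add]
        omega
    obtain ⟨i, j, h⟩ := h
    exact h ((h1 i i.2).trans (h1 j j.2).symm)
  have h2 : (K.card : ZMod 2) = 0 := by
    have h3 : ∀ i, ((if m i ≠ m (i + 1) then 1 else 0 : ℕ) : ZMod 2) =
        (if m i then 1 else 0) + (if m (i + 1) then 1 else 0) := by
      intro i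
      generalize m i = a
      generalize m (i + 1) = b
      revert a b; decide
    have h4 : ∑ i, (if m (i + 1) then 1 else 0 : ZMod 2) = ∑ i, if m i then 1 else 0 :=
      Equiv.sum_comp (Equiv.addRight (1 : Fin 15)) fun i => if m i then 1 else 0
    rw [hK, Finset.card_filter, Nat.cast_sum, Finset.sum_congr rfl fun i _ => h3 i,
      Finset.sum_add_distrib, h4]
    exact CharTwo.add_self_eq_zero _
  rw [ZMod.natCast_eq_zero_iff] at h2
  omega

/-- The adjacency of darts in the graph obtained from the base graph by deleting the pieces. -/
def baseAdj : (Fin 15 ⊕ Fin 21) × Fin 3 → Option ((Fin 15 ⊕ Fin 21) × Fin 3)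
  | (.inl i, j) => if j = 2 then some (.inr (att i).1, (att i).2) else none
  | (.inr u, j) => match nbU (u, j) with
    | .inl d => some (.inr d.1, d.2)
    | .inr i => some (.inl i, 2)

theorem baseAdj_symm : ∀ d d', baseAdj d = some d' → baseAdj d' = some d := by
  have : ∀ d, (baseAdj d).all fun d' => decide (baseAdj d' = some d) := by decide +kernel
  intro d d' h
  simpa [h] using this d

/-- The acceptance condition for the base graph. -/
def baseAcc (c t _ _ : ℕ) : Bool := Nat.ble 6 c || Nat.ble (t + 1) c || Nat.beq t 0

/-- The order in which the vertices of the base graph are processed. -/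
def baseOrder : List (Fin 15 ⊕ Fin 21) :=
  [.inr 19, .inl 12, .inr 16, .inl 4, .inr 20, .inl 11, .inr 18, .inl 10, .inr 17, .inl 13, .inr 5,
    .inr 2, .inr 3, .inr 4, .inr 15, .inl 5, .inr 1, .inr 0, .inr 12, .inl 7, .inr 14, .inl 8,
    .inr 13, .inl 6, .inr 11, .inl 14, .inr 10, .inl 3, .inr 7, .inl 0, .inr 8, .inl 2, .inr 9,
    .inl 1, .inr 6, .inl 9]

theorem baseAcc_pcut (T : Finset (Fin 15 ⊕ Fin 21)) :
    baseAcc (pcut baseAdj T + ∑ w ∈ T, if w.isLeft then 2 else 0) T.card 0 0 = true := by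
  have := search_complete (fun w : Fin 15 ⊕ Fin 21 => if w.isLeft then 2 else 0) (fun _ => 0)
    (fun _ => 0) (acc := baseAcc) baseAdj_symm (B := 0)
    (fun c t l b h1 h2 h3 h4 => by simp [baseAcc]; omega) (o := baseOrder) (by decide +kernel)
    (by decide +kernel) (by simp)
    (by decide +kernel) T
  simpa using this

namespace Vtx

variable {P : Fin 15 → Piece}

/-- An index for the edges between consecutive pieces. -/
def linkKey (d : Vtx P × Fin 3) : Fin 15 × Fin 3 :=
  match d with
  | (.inl i, _) => (i, 0)
  | (.inr (.inl _), _) => (0, 0)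
  | (.inr (.inr ⟨i, w⟩), j) => match (P i).nb (w, j) with
    | .inl _ => (0, 0)
    | .inr (b, s) => (if b then i + 1 else i, s)

theorem linkKey_port (i : Fin 15) (b : Bool) (s : Fin 3) :
    linkKey (dart P i ((P i).port (b, s))) = (if b then i + 1 else i, s) := by
  simp [linkKey, (P i).nb_port]

theorem exists_linkKey {S : Finset (Vtx P)} (hS : ∀ i, module P i ⊆ S ∨ Disjoint (module P i) S)
    {i : Fin 15} (hi : ¬ (module P i ⊆ S ↔ module P (i + 1) ⊆ S)) (s : Fin 3) :
    ∃ d : Vtx P × Fin 3, (d.1 ∈ S ∧ ((assemble P).flip d).1 ∈ Sᶜ) ∧ linkKey d = (i + 1, s) := by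
  have hmem : ∀ i w, (.inr (.inr ⟨i, w⟩) : Vtx P) ∈ S ↔ module P i ⊆ S := by
    intro i w
    refine ⟨fun h => (hS i).resolve_right fun h' => ?_, fun h => h mem_module⟩
    exact Finset.disjoint_left.1 h' mem_module h
  by_cases hs : s = 0
  · subst hs
    have h1 : (assemble P).flip (dart P i ((P i).port (true, 0))) = (.inl (i + 1), 1) := by
      rw [assemble_flip, flip_dart_port, ext_right_zero]
    have h2 : (assemble P).flip (.inl (i + 1), 1) = dart P i ((P i).port (true, 0)) := by
      rw [← h1, DartGraph.flip_flip]
    have h3 : (assemble P).flip (.inl (i + 1), 0) = dart P (i + 1) ((P (i + 1)).port (false, 0)) :=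
      rfl
    have h4 : (assemble P).flip (dart P (i + 1) ((P (i + 1)).port (false, 0))) =
        (.inl (i + 1), 0) := by
      rw [← h3, DartGraph.flip_flip]
    by_cases hD : (.inl (i + 1) : Vtx P) ∈ S <;> by_cases hi' : module P i ⊆ S
    · exact ⟨_, ⟨hD, by rw [h3, Finset.mem_compl, hmem]; tauto⟩, rfl⟩
    · exact ⟨_, ⟨hD, by rw [h2, Finset.mem_compl, hmem]; tauto⟩, rfl⟩
    · exact ⟨_, ⟨(hmem _ _).2 hi', by rw [h1, Finset.mem_compl]; exact hD⟩, by
        rw [linkKey_port]; rfl⟩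
    · exact ⟨_, ⟨(hmem (i + 1) _).2 (by tauto), by rw [h4, Finset.mem_compl]; exact hD⟩, by
        rw [linkKey_port]; rfl⟩
  · have h1 : (assemble P).flip (dart P i ((P i).port (true, s))) =
        dart P (i + 1) ((P (i + 1)).port (false, s)) := by
      rw [assemble_flip, flip_dart_port, ext_right P hs]
    have h2 : (assemble P).flip (dart P (i + 1) ((P (i + 1)).port (false, s))) =
        dart P i ((P i).port (true, s)) := by
      rw [← h1, DartGraph.flip_flip]
    by_cases hi' : module P i ⊆ S
    · exact ⟨_, ⟨(hmem _ _).2 hi', by rw [h1, Finset.mem_compl, hmem]; tauto⟩, by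
        rw [linkKey_port]; rfl⟩
    · exact ⟨_, ⟨(hmem (i + 1) _).2 (by tauto), by rw [h2, Finset.mem_compl, hmem]; tauto⟩, by
        rw [linkKey_port]; rfl⟩

theorem six_le_bdry {S : Finset (Vtx P)} (hS : ∀ i, module P i ⊆ S ∨ Disjoint (module P i) S)
    {i j : Fin 15} (hij : module P i ⊆ S ∧ ¬ module P j ⊆ S) : 6 ≤ (assemble P).bdry S := by
  classical
  have h2 := two_le_card_filter_ne (m := fun i => decide (module P i ⊆ S))
    ⟨i, j, by simp [hij.1, hij.2]⟩
  set K := Finset.univ.filter fun i : Fin 15 =>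
    decide (module P i ⊆ S) ≠ decide (module P (i + 1) ⊆ S)
  have h3 : ((K.map (Equiv.addRight (1 : Fin 15)).toEmbedding) ×ˢ
      (Finset.univ : Finset (Fin 3))).card ≤ (assemble P).bdry S := by
    refine Finset.card_le_card_of_surjOn linkKey ?_
    rintro ⟨i, s⟩ hi
    simp only [Finset.coe_product, Set.mem_prod, Finset.mem_coe, Finset.mem_map] at hi
    obtain ⟨⟨i, hi, rfl⟩, -⟩ := hi
    simp only [K, Finset.mem_filter, Finset.mem_univ, true_and, ne_eq, decide_eq_decide] at hi
    obtain ⟨d, hd, hk⟩ := exists_linkKey hS hi s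
    exact ⟨d, by simpa using hd, hk⟩
  rw [Finset.card_product, Finset.card_map, Finset.card_univ, Fintype.card_fin] at h3
  omega

/-- The vertices of the base graph. -/
def baseEmb (P : Fin 15 → Piece) : Fin 15 ⊕ Fin 21 ↪ Vtx P where
  toFun := Sum.map id Sum.inl
  inj' := Sum.map_injective.2 ⟨injective_id, Sum.inl_injective⟩

theorem pcut_add_le_bdry (T : Finset (Fin 15 ⊕ Fin 21)) :
    pcut baseAdj T + (∑ w ∈ T, if w.isLeft then 2 else 0) ≤
      (assemble P).bdry (T.map (baseEmb P)) := by
  have h1 : (∑ w ∈ T, if w.isLeft then 2 else 0) =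
      (Finset.univ.filter fun d : (Fin 15 ⊕ Fin 21) × Fin 3 =>
        d.1 ∈ T ∧ d.1.isLeft ∧ d.2 ≠ 2).card := by
    rw [Finset.card_filter, Fintype.sum_prod_type, ← Finset.sum_filter_add_sum_filter_not
      (s := Finset.univ) (p := (· ∈ T)), Finset.filter_univ_mem]
    rw [Finset.sum_eq_zero (s := Finset.univ.filter (· ∉ T)) (fun w hw => ?_), add_zero]
    · refine Finset.sum_congr rfl fun w hw => ?_
      cases w <;> simp [hw, Fin.sum_univ_three]
    · simp only [Finset.mem_filter, Finset.mem_univ, true_and] at hw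
      simp [hw]
  rw [h1, pcut, ← Finset.card_union_of_disjoint]
  · refine Finset.card_le_card_of_injOn (fun d => (baseEmb P d.1, d.2)) ?_ ?_
    · rintro ⟨w, j⟩ hd
      simp only [Finset.coe_union, Finset.coe_filter, Finset.mem_univ, true_and, Set.mem_union,
        Set.mem_ofPred_eq] at hd
      simp only [Finset.coe_filter, Finset.mem_univ, true_and, Set.mem_ofPred_eq,
        Finset.mem_map', Finset.mem_compl]
      obtain ⟨h1, ⟨v, j'⟩, h2, h3⟩ | ⟨h1, h2, h3⟩ := hd
      · refine ⟨h1, ?_⟩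
        have : (assemble P).flip (baseEmb P w, j) = (baseEmb P v, j') := by
          obtain i | u := w
          · by_cases hj : j = 2
            · subst hj
              simp only [baseAdj, if_true, Option.some.injEq, Prod.mk.injEq] at h2
              rw [← h2.1, ← h2.2]
              rfl
            · simp [baseAdj, hj] at h2
          · cases h : nbU (u, j) with
            | inl d =>
              simp only [baseAdj, h, Option.some.injEq, Prod.mk.injEq] at h2
              rw [← h2.1, ← h2.2]
              exact flip_U_inl P h
            | inr i =>
              simp only [baseAdj, h, Option.some.injEq, Prod.mk.injEq] at h2
              rw [← h2.1, ← h2.2]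
              have := (nbU_eq_inr _ i).1 h
              have h4 := flip_U_att P i
              rw [this] at h4
              exact h4
        rw [this, Finset.mem_map']
        exact h3
      · refine ⟨h1, ?_⟩
        obtain i | u := w
        · have hT : ∀ k w, (.inr (.inr ⟨k, w⟩) : Vtx P) ∉ T.map (baseEmb P) := by
            intro k w h
            obtain ⟨v, -, h⟩ := Finset.mem_map.1 h
            cases v <;> simp [baseEmb] at h
          fin_cases j
          · exact hT _ _
          · exact hT _ _
          · simp at h3
        · simp at h2
    · rintro ⟨v, i⟩ _ ⟨w, j⟩ _ h
      simpa using h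
  · rw [Finset.disjoint_left]
    rintro ⟨w, j⟩ h h'
    simp only [Finset.mem_filter, Finset.mem_univ, true_and] at h h'
    obtain ⟨-, d, h, -⟩ := h
    obtain i | u := w
    · simp [baseAdj, h'.2.2] at h
    · simp at h'

theorem not_isBad (hP : ∀ i, (P i).Solid) (S : Finset (Vtx P)) : ¬ (assemble P).IsBad S := by
  intro hS
  have hd : ∀ i j, i ≠ j → Disjoint (module P i) (module P j) := by
    intro i j hij
    rw [Finset.disjoint_left]
    intro v hv hw
    obtain ⟨w, -, rfl⟩ := Finset.mem_map.1 hv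
    obtain ⟨w', -, h⟩ := Finset.mem_map.1 hw
    simp only [emb_apply, Sum.inr.injEq, Sigma.mk.injEq] at h
    exact hij h.1.symm
  obtain ⟨S, hS, h⟩ := hS.exists_forall_subset_or_disjoint (module P) (fun i => roundable (hP i))
    hd Finset.univ
  have key : ∀ S, (assemble P).IsBad S → (∀ i, Disjoint (module P i) S) → False := by
    intro S hS h
    obtain ⟨T, rfl⟩ : ∃ T : Finset (Fin 15 ⊕ Fin 21), S = T.map (baseEmb P) := by
      have : S ⊆ Finset.univ.map (baseEmb P) := by
        intro v hv
        obtain i | u | ⟨i, w⟩ := v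
        · exact Finset.mem_map.2 ⟨.inl i, by simp, rfl⟩
        · exact Finset.mem_map.2 ⟨.inr u, by simp, rfl⟩
        · exact absurd hv (Finset.disjoint_left.1 (h i) mem_module)
      obtain ⟨T, -, h⟩ := Finset.subset_map_iff.1 this
      exact ⟨T, h⟩
    have h1 := pcut_add_le_bdry (P := P) T
    have h2 := baseAcc_pcut T
    have h3 := hS.bdry_lt
    have h4 := hS.le_card
    have h5 := hS.nonempty.card_pos
    rw [Finset.card_map] at h4 h5
    simp only [baseAcc, Bool.or_eq_true, Nat.ble_eq, Nat.beq_eq] at h2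
    omega
  have hor : ∀ i, module P i ⊆ S ∨ Disjoint (module P i) S := fun i => h i (Finset.mem_univ i)
  by_cases h1 : ∃ i, module P i ⊆ S
  · obtain ⟨i, hi⟩ := h1
    by_cases h2 : ∃ j, ¬ module P j ⊆ S
    · obtain ⟨j, hj⟩ := h2
      exact (six_le_bdry hor ⟨hi, hj⟩).not_gt hS.bdry_lt
    · push Not at h2
      refine key Sᶜ hS.compl fun i => ?_
      rw [Finset.disjoint_left]
      intro v hv hv'
      exact Finset.mem_compl.1 hv' (h2 i hv)
  · push Not at h1
    exact key S hS fun i => (hor i).resolve_left (h1 i)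

end Vtx

namespace Piece

variable {P : Piece}

theorem Real.congr {X : Set P.W} {L R L' R' : Fin 3 → Fin 3} (h : P.Real X L R)
    (hL : ∀ s, (P.port (false, s)).1 ∉ X → L s = L' s)
    (hR : ∀ s, (P.port (true, s)).1 ∉ X → R s = R' s) : P.Real X L' R' := by
  obtain ⟨c, hc, h1, h2⟩ := h
  exact ⟨c, hc, fun s hs => (h1 s hs).trans (hL s hs), fun s hs => (h2 s hs).trans (hR s hs)⟩

/-- The colouring of a piece encoded by the base six digits of `N`. -/
def colour (idx : P.W → ℕ) (N : ℕ) (d : P.W × Fin 3) : Fin 3 := permOf (N / 6 ^ idx d.1 % 6) d.2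

/-- A test for the colouring encoded by `N` off `X`. -/
def Check (P : Piece) (idx : P.W → ℕ) (N : ℕ) (X : Finset P.W) : Prop :=
  ∀ d, Sum.elim (fun d' => decide (d.1 ∈ X ∨ d'.1 ∈ X ∨ colour idx N d' = colour idx N d))
    (fun _ => true) (P.nb d) = true

/-- The colours on the dangling edges of the colouring encoded by `N`. -/
def ends (P : Piece) (idx : P.W → ℕ) (N : ℕ) (b : Bool) (s : Fin 3) : Fin 3 :=
  colour idx N (P.port (b, s))

instance (idx : P.W → ℕ) (N : ℕ) (X : Finset P.W) : Decidable (P.Check idx N X) :=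
  inferInstanceAs (Decidable (∀ _, _))

variable {idx : P.W → ℕ} {N : ℕ} {X : Finset P.W}

theorem Check.real (h : P.Check idx N X) :
    P.Real X (P.ends idx N false) (P.ends idx N true) := by
  refine ⟨colour idx N, ⟨fun v _ => permOf_injective (N / 6 ^ idx v % 6), fun d d' hd h1 h2 => ?_⟩,
    fun s _ => rfl, fun s _ => rfl⟩
  have := h d
  rw [hd, Sum.elim_inl, decide_eq_true_eq] at this
  exact (this.resolve_left h1).resolve_left h2

/-- Representatives of the pairs of balanced boundary colourings. -/
def balReps : List ((Fin 3 → Fin 3) × (Fin 3 → Fin 3)) :=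
  [(![0, 0, 1], ![0, 0, 1]), (![0, 0, 1], ![0, 1, 0]), (![0, 0, 1], ![1, 0, 0]),
    (![0, 0, 1], ![1, 2, 2]), (![0, 0, 1], ![2, 1, 2]), (![0, 0, 1], ![2, 2, 1]),
    (![0, 1, 0], ![0, 0, 1]), (![0, 1, 0], ![0, 1, 0]), (![0, 1, 0], ![1, 0, 0]),
    (![0, 1, 0], ![1, 2, 2]), (![0, 1, 0], ![2, 1, 2]), (![0, 1, 0], ![2, 2, 1]),
    (![0, 1, 1], ![0, 1, 1]), (![0, 1, 1], ![0, 2, 2]), (![0, 1, 1], ![1, 0, 1]),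
    (![0, 1, 1], ![1, 1, 0]), (![0, 1, 1], ![2, 0, 2]), (![0, 1, 1], ![2, 2, 0])]

theorem exists_perm_balReps : ∀ c a₀ a₁ a₂ b₀ b₁ b₂ : Fin 3,
    Bal c ![a₀, a₁, a₂] → Bal c ![b₀, b₁, b₂] → ∃ i : Fin 18, ∃ k : Fin 6,
    (permOf k ((balReps.getD i 0).1 0) = a₀ ∧ permOf k ((balReps.getD i 0).1 1) = a₁ ∧
      permOf k ((balReps.getD i 0).1 2) = a₂) ∧ permOf k ((balReps.getD i 0).2 0) = b₀ ∧
      permOf k ((balReps.getD i 0).2 1) = b₁ ∧ permOf k ((balReps.getD i 0).2 2) = b₂ := by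
  decide +kernel

theorem real_of_balReps {X : Set P.W}
    (h : ∀ i : Fin 18, P.Real X (balReps.getD i 0).1 (balReps.getD i 0).2)
    {c : Fin 3} {L R : Fin 3 → Fin 3} (hL : Bal c L) (hR : Bal c R) : P.Real X L R := by
  obtain ⟨i, k, ⟨h0, h1, h2⟩, h3, h4, h5⟩ :=
    exists_perm_balReps c (L 0) (L 1) (L 2) (R 0) (R 1) (R 2) hL hR
  refine ((h i).perm (permOf_injective k)).congr (fun s _ => ?_) fun s _ => ?_
  · fin_cases s <;> assumption
  · fin_cases s <;> assumption

/-- Representatives of the quadruples of colours of which the last two differ. -/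
def quadReps : List (Fin 3 × Fin 3 × Fin 3 × Fin 3) :=
  [(0, 0, 0, 1), (0, 0, 1, 0), (0, 0, 1, 2), (0, 1, 0, 1), (0, 1, 0, 2),
    (0, 1, 1, 0), (0, 1, 1, 2), (0, 1, 2, 0), (0, 1, 2, 1)]

theorem exists_perm_quadReps : ∀ a y f g : Fin 3, f ≠ g → ∃ i : Fin 9, ∃ k : Fin 6,
    permOf k (quadReps.getD i 0).1 = a ∧ permOf k (quadReps.getD i 0).2.1 = y ∧
      permOf k (quadReps.getD i 0).2.2.1 = f ∧ permOf k (quadReps.getD i 0).2.2.2 = g := by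
  decide +kernel

theorem exists_perm_ne : ∀ a b f g : Fin 3, ∃ k : Fin 6, permOf k a ≠ f ∧ permOf k b ≠ g := by
  decide

theorem exists_perm_eq_ne : ∀ a b f g : Fin 3, b ≠ a →
    ∃ k : Fin 6, permOf k a = f ∧ permOf k b ≠ g := by
  decide

theorem bal_perm {c : Fin 3} {L : Fin 3 → Fin 3} (h : Bal c L) (k : Fin 6) :
    Bal (permOf k c) (permOf k ∘ L) := by
  have key : ∀ (k : Fin 6) (c a₀ a₁ a₂ : Fin 3), Bal c ![a₀, a₁, a₂] →
      Bal (permOf k c) ![permOf k a₀, permOf k a₁, permOf k a₂] := by decide +kernel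
  exact key k c (L 0) (L 1) (L 2) h

theorem real_ne_of_real {X : Set P.W} (h : ∃ L R, Injective L ∧ Injective R ∧ P.Real X L R)
    (f g : Fin 3) : ∃ L R, Injective L ∧ Injective R ∧ L 0 ≠ f ∧ R 0 ≠ g ∧ P.Real X L R := by
  obtain ⟨L, R, hL, hR, h⟩ := h
  obtain ⟨k, h1, h2⟩ := exists_perm_ne (L 0) (R 0) f g
  exact ⟨_, _, (permOf_injective k).comp hL, (permOf_injective k).comp hR, h1, h2,
    h.perm (permOf_injective k)⟩

/-- A test for the properties in `Piece.Good` other than `not_real` and `real_edge`. -/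
structure GoodCheck (P : Piece) (idx : P.W → ℕ) (t q₁ q₂ : List ℕ) (nl nr n₁ n₂ : ℕ) : Prop where
  real : ∀ i : Fin 18, P.Check idx (t.getD i 0) ∅ ∧
    (∀ s, P.ends idx (t.getD i 0) false s = (balReps.getD i 0).1 s) ∧
    ∀ s, P.ends idx (t.getD i 0) true s = (balReps.getD i 0).2 s
  left : P.Check idx nl {(P.port (false, 0)).1} ∧ Injective (P.ends idx nl true) ∧
    ∃ f, Bal f (P.ends idx nl false) ∧ P.ends idx nl true 0 ≠ f
  right : P.Check idx nr {(P.port (true, 0)).1} ∧ Injective (P.ends idx nr false) ∧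
    ∃ f, Bal f (P.ends idx nr true) ∧ P.ends idx nr false 0 ≠ f
  right_one : P.Check idx n₁ {(P.port (true, 1)).1} ∧ Injective (P.ends idx n₁ false)
  right_two : P.Check idx n₂ {(P.port (true, 2)).1} ∧ Injective (P.ends idx n₂ false)
  left_one : ∀ i : Fin 9, P.Check idx (q₁.getD i 0) {(P.port (false, 1)).1} ∧
    P.ends idx (q₁.getD i 0) false 0 = (quadReps.getD i 0).1 ∧
    P.ends idx (q₁.getD i 0) false 2 = (quadReps.getD i 0).2.1 ∧
    P.ends idx (q₁.getD i 0) true 0 = (quadReps.getD i 0).2.2.1 ∧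
    P.ends idx (q₁.getD i 0) true 1 = (quadReps.getD i 0).2.2.2 ∧
    P.ends idx (q₁.getD i 0) true 2 = (quadReps.getD i 0).2.2.2
  left_two : ∀ i : Fin 9, P.Check idx (q₂.getD i 0) {(P.port (false, 2)).1} ∧
    P.ends idx (q₂.getD i 0) false 0 = (quadReps.getD i 0).1 ∧
    P.ends idx (q₂.getD i 0) false 1 = (quadReps.getD i 0).2.1 ∧
    P.ends idx (q₂.getD i 0) true 0 = (quadReps.getD i 0).2.2.1 ∧
    P.ends idx (q₂.getD i 0) true 1 = (quadReps.getD i 0).2.2.2 ∧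
    P.ends idx (q₂.getD i 0) true 2 = (quadReps.getD i 0).2.2.2

theorem GoodCheck.good {t q₁ q₂ : List ℕ} {nl nr n₁ n₂ : ℕ}
    (h : P.GoodCheck idx t q₁ q₂ nl nr n₁ n₂)
    (hn : ∀ L R, Injective L → Injective R → ¬ P.Real ∅ L R)
    (he : ∀ d d', P.nb d = .inl d' → ∃ L R, Injective L ∧ Injective R ∧ P.Real {d.1, d'.1} L R) :
    P.Good where
  not_real := hn
  real c L R hL hR := by
    refine real_of_balReps (fun i => ?_) hL hR
    have := (h.real i).1.real
    rw [Finset.coe_empty] at this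
    exact this.congr (fun s _ => (h.real i).2.1 s) fun s _ => (h.real i).2.2 s
  real_edge d d' hd f g := real_ne_of_real (he d d' hd) f g
  real_left f g := by
    obtain ⟨h1, h2, f', h3, h4⟩ := h.left
    obtain ⟨k, rfl, h6⟩ := exists_perm_eq_ne _ _ f g h4
    exact ⟨_, _, bal_perm h3 k, (permOf_injective k).comp h2, h6,
      by simpa using h1.real.perm (permOf_injective k)⟩
  real_right f g := by
    obtain ⟨h1, h2, f', h3, h4⟩ := h.right
    obtain ⟨k, rfl, h6⟩ := exists_perm_eq_ne _ _ g f h4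
    exact ⟨_, _, bal_perm h3 k, (permOf_injective k).comp h2, h6,
      by simpa using h1.real.perm (permOf_injective k)⟩
  real_straight_right s hs f g := by
    have hs' : s = 1 ∨ s = 2 := by revert s; decide
    obtain ⟨L, R, hL, hLR⟩ : ∃ L R, Injective L ∧ P.Real {(P.port (true, s)).1} L R := by
      obtain rfl | rfl := hs'
      · exact ⟨_, _, h.right_one.2, by simpa using h.right_one.1.real⟩
      · exact ⟨_, _, h.right_two.2, by simpa using h.right_two.1.real⟩
    obtain ⟨k, h1, h2⟩ := exists_perm_ne (L 0) (R 0) f g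
    exact ⟨_, _, (permOf_injective k).comp hL, h1, h2, hLR.perm (permOf_injective k)⟩
  real_straight_left s hs L f g hfg := by
    have hs' : s = 1 ∨ s = 2 := by revert s; decide
    obtain rfl | rfl := hs'
    · obtain ⟨i, k, e0, e1, e2, e3⟩ := exists_perm_quadReps (L 0) (L 2) f g hfg
      obtain ⟨h0, h1, h2, h3, h4, h5⟩ := h.left_one i
      have := h0.real.perm (permOf_injective k)
      rw [Finset.coe_singleton] at this
      refine this.congr (fun s hs => ?_) fun s hs => ?_
      · fin_cases s
        · exact (congrArg _ h1).trans e0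
        · exact absurd rfl hs
        · exact (congrArg _ h2).trans e1
      · fin_cases s
        · exact (congrArg _ h3).trans e2
        · exact (congrArg _ h4).trans e3
        · exact (congrArg _ h5).trans e3
    · obtain ⟨i, k, e0, e1, e2, e3⟩ := exists_perm_quadReps (L 0) (L 1) f g hfg
      obtain ⟨h0, h1, h2, h3, h4, h5⟩ := h.left_two i
      have := h0.real.perm (permOf_injective k)
      rw [Finset.coe_singleton] at this
      refine this.congr (fun s hs => ?_) fun s hs => ?_
      · fin_cases s
        · exact (congrArg _ h1).trans e0
        · exact (congrArg _ h2).trans e1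
        · exact absurd rfl hs
      · fin_cases s
        · exact (congrArg _ h3).trans e2
        · exact (congrArg _ h4).trans e3
        · exact (congrArg _ h5).trans e3

/-- A test for the existence of colourings off adjacent vertices. -/
def EdgeCheck (P : Piece) (idx : P.W → ℕ) (t : List ℕ) : Prop :=
  ∀ d, Sum.elim (fun d' => decide (P.Check idx (t.getD (min (3 * idx d.1 + d.2)
      (3 * idx d'.1 + d'.2)) 0) {d.1, d'.1} ∧
    Injective (P.ends idx (t.getD (min (3 * idx d.1 + d.2) (3 * idx d'.1 + d'.2)) 0) false) ∧
    Injective (P.ends idx (t.getD (min (3 * idx d.1 + d.2) (3 * idx d'.1 + d'.2)) 0) true)))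
    (fun _ => true) (P.nb d) = true

instance (t : List ℕ) : Decidable (P.EdgeCheck idx t) := inferInstanceAs (Decidable (∀ _, _))

theorem EdgeCheck.real {t : List ℕ} (h : P.EdgeCheck idx t) (d d') (hd : P.nb d = .inl d') :
    ∃ L R, Injective L ∧ Injective R ∧ P.Real {d.1, d'.1} L R := by
  have := h d
  rw [hd, Sum.elim_inl, decide_eq_true_eq] at this
  exact ⟨_, _, this.2.1, this.2.2, by simpa using this.1.real⟩

end Piece

namespace Piece

/-- A test for a part of a piece with `c` cut edges, `t` vertices, `l` dangling edges on the left
and `b` dangling edges in total. -/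
def lightTest (c t l b : ℕ) : Bool :=
  cond (Nat.beq t 0) true (cond (Nat.ble (Nat.add t b) c && Nat.blt t c) true
    (cond (Nat.blt b c && Nat.ble 6 (Nat.add c b)) true
      (Nat.beq c 3 && Nat.beq t 3 && Nat.beq l 1 && Nat.beq b 2)))

/-- A test for a division of a piece with `N` vertices. -/
def solidTest (N c t l b : ℕ) : Bool :=
  cond (Nat.ble 6 c) true
    (cond (lightTest c t l b) true (lightTest c (Nat.sub N t) (Nat.sub 3 l) (Nat.sub 6 b)))

theorem lightTest_iff (c t l b : ℕ) : lightTest c t l b = true ↔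
    t = 0 ∨ (t + b ≤ c ∧ t < c) ∨ (b + 1 ≤ c ∧ 6 ≤ c + b) ∨ (c = 3 ∧ t = 3 ∧ l = 1 ∧ b = 2) := by
  simp [lightTest, Bool.cond_eq_ite, Nat.blt, and_assoc, Nat.succ_le_iff]

theorem solidTest_iff (N c t l b : ℕ) : solidTest N c t l b = true ↔
    6 ≤ c ∨ lightTest c t l b = true ∨ lightTest c (N - t) (3 - l) (6 - b) = true := by
  simp [solidTest, Bool.cond_eq_ite]

variable {P : Piece}

/-- The number of dangling edges at a vertex on a given side. -/
def sideAt (P : Piece) (b : Bool) (w : P.W) : ℕ :=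
  (Finset.univ.filter fun s => (P.port (b, s)).1 = w).card

theorem sum_sideAt (b : Bool) (T : Finset P.W) : ∑ w ∈ T, P.sideAt b w = P.side b T := by
  rw [side, Finset.card_eq_sum_card_fiberwise (f := fun s => (P.port (b, s)).1) (t := T)
    (by intro s hs; simpa using hs)]
  refine Finset.sum_congr rfl fun w hw => ?_
  rw [sideAt, Finset.filter_filter]
  congr 1
  ext s
  simp only [Finset.mem_filter, Finset.mem_univ, true_and]
  exact ⟨fun h => ⟨h ▸ hw, h⟩, fun h => h.2⟩

theorem side_univ (b : Bool) : P.side b Finset.univ = 3 := by simp [side]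

theorem side_compl (b : Bool) (T : Finset P.W) : P.side b Tᶜ = 3 - P.side b T := by
  have h : P.side b T + P.side b Tᶜ = P.side b Finset.univ := by
    rw [← sum_sideAt, ← sum_sideAt, ← sum_sideAt]
    exact Finset.sum_add_sum_compl _ _
  rw [side_univ] at h
  lia

theorem side_le (b : Bool) (T : Finset P.W) : P.side b T ≤ 3 :=
  (Finset.card_filter_le _ _).trans_eq (by simp)

theorem cut_compl (T : Finset P.W) : P.cut Tᶜ = P.cut T := by
  have key : ∀ T, P.cut T ≤ P.cut Tᶜ := by
    intro T
    have hex : ∀ d, ∃ d', ∀ e, P.nb d = .inl e → d' = e := fun d => by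
      cases h : P.nb d with
      | inl e => exact ⟨e, fun _ h => by simpa using h⟩
      | inr p => exact ⟨d, fun _ h => by simp at h⟩
    choose g hg using hex
    refine Finset.card_le_card_of_injOn g ?_ ?_
    · intro d hd
      simp only [Finset.coe_filter, Finset.mem_univ, true_and, Set.mem_ofPred_eq,
        Sum.getLeft?_eq_some_iff] at hd ⊢
      obtain ⟨h1, d', h2, h3⟩ := hd
      rw [hg d d' h2]
      exact ⟨by simpa using h3, d, P.nb_symm _ _ h2, by simpa using h1⟩
    · intro d hd e he h
      simp only [Finset.coe_filter, Finset.mem_univ, true_and, Set.mem_ofPred_eq,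
        Sum.getLeft?_eq_some_iff] at hd he
      obtain ⟨-, d', h2, -⟩ := hd
      obtain ⟨-, e', h3, -⟩ := he
      rw [hg d d' h2, hg e e' h3] at h
      subst h
      have := P.nb_symm _ _ h2
      rw [P.nb_symm _ _ h3] at this
      simpa using this.symm
  refine le_antisymm ?_ (key T)
  simpa using key Tᶜ

/-- The parameters of a part of a piece pass the test. -/
def Passes (P : Piece) (T : Finset P.W) : Prop :=
  lightTest (P.cut T) T.card (P.side false T) (P.side false T + P.side true T) = true

theorem light_of_passes {T : Finset P.W} (h : P.Passes T) : P.Light T := by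
  obtain h | h | h | ⟨h1, h2, h3, h4⟩ := (lightTest_iff _ _ _ _).1 h
  · exact .inl (Finset.card_eq_zero.1 h)
  · exact .inr (.inl h)
  · exact .inr (.inr (.inl h))
  · exact .inr (.inr (.inr ⟨h1, h2, h3, by lia⟩))

theorem solidTest_iff_passes (T : Finset P.W) : solidTest (Fintype.card P.W) (P.cut T) T.card
    (P.side false T) (P.side false T + P.side true T) = true ↔
      6 ≤ P.cut T ∨ P.Passes T ∨ P.Passes Tᶜ := by
  rw [solidTest_iff, Passes, Passes, cut_compl, side_compl, side_compl, Finset.card_compl]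
  have h1 := side_le false T
  have h2 := side_le true T
  have : 6 - (P.side false T + P.side true T) = 3 - P.side false T + (3 - P.side true T) := by lia
  rw [this]

theorem passes_of_search {o : List P.W} (ho : ∀ w, place o w < o.length)
    (hr : o.map (place o) = List.range o.length)
    (h : CutEntry.search (solidTest (Fintype.card P.W))
      (o.map (cutEntry (fun d => (P.nb d).getLeft?) (place o) (fun _ => 0) (P.sideAt false)
        fun w => P.sideAt false w + P.sideAt true w)) 1 0 0 0 0 0 6 = true) (T : Finset P.W) :
    6 ≤ P.cut T ∨ P.Passes T ∨ P.Passes Tᶜ := by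
  have h1 := search_complete (fun _ => 0) (P.sideAt false)
    (fun w => P.sideAt false w + P.sideAt true w)
    (fun d d' => by simpa only [Sum.getLeft?_eq_some_iff] using P.nb_symm d d') ?_ ho hr ?_ h T
  · rw [Finset.sum_add_distrib, sum_sideAt, sum_sideAt, Finset.sum_const_zero, add_zero] at h1
    exact (solidTest_iff_passes T).1 h1
  · intro c t l b h1 h2 h3 h4
    simp only [solidTest_iff, lightTest_iff]
    lia
  · rw [Finset.sum_add_distrib, sum_sideAt, sum_sideAt, side_univ, side_univ]

theorem solid_of_passes (h : ∀ T, 6 ≤ P.cut T ∨ P.Passes T ∨ P.Passes Tᶜ) : P.Solid :=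
  fun T => (h T).imp_right fun h => h.imp light_of_passes light_of_passes

/-- The index of an edge, given indices of the half-edges. -/
def eid (P : Piece) (idx : P.W → ℕ) (d : P.W × Fin 3) : ℕ :=
  Sum.elim (fun d' => min (3 * idx d.1 + d.2) (3 * idx d'.1 + d'.2))
    (fun _ => 3 * idx d.1 + d.2) (P.nb d)

/-- The half-edges at a vertex or the dangling edges on one side. -/
def triple (P : Piece) : P.W ⊕ Bool → (P.W × Fin 3) × (P.W × Fin 3) × (P.W × Fin 3) :=
  Sum.elim (fun u => ((u, 0), (u, 1), (u, 2)))
    fun b => (P.port (b, 0), P.port (b, 1), P.port (b, 2))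

theorem not_real_of_search (idx : P.W → ℕ)
    (hE : ∀ d d', P.eid idx d = P.eid idx d' → d = d' ∨ P.nb d = .inl d') (t : P.W ⊕ Bool)
    (l : List (P.W ⊕ Bool))
    (hs : ColSearch.place (ColSearch.fails ((l.map P.triple).map fun t =>
      (P.eid idx t.1, P.eid idx t.2.1, P.eid idx t.2.2))) 0 (P.eid idx (P.triple t).1)
      (P.eid idx (P.triple t).2.1) (P.eid idx (P.triple t).2.2) 0 1 2 = true)
    (L R : Fin 3 → Fin 3) (hL : Injective L) (hR : Injective R) : ¬ P.Real ∅ L R := by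
  rintro ⟨h, hh, h1, h2⟩
  simp only [Set.mem_empty_iff_false, not_false_eq_true, forall_const] at h1 h2
  have key : ∀ x, h (P.triple x).1 ≠ h (P.triple x).2.1 ∧ h (P.triple x).1 ≠ h (P.triple x).2.2 ∧
      h (P.triple x).2.1 ≠ h (P.triple x).2.2 := by
    rintro (u | b)
    · have hinj := hh.inj u (Set.notMem_empty u)
      exact ⟨hinj.ne (a₁ := 0) (a₂ := 1) (by decide), hinj.ne (a₁ := 0) (a₂ := 2) (by decide),
        hinj.ne (a₁ := 1) (a₂ := 2) (by decide)⟩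
    · have hinj : Injective fun s => h (P.port (b, s)) := by
        cases b
        · rwa [show (fun s => h (P.port (false, s))) = L from funext h1]
        · rwa [show (fun s => h (P.port (true, s))) = R from funext h2]
      exact ⟨hinj.ne (a₁ := 0) (a₂ := 1) (by decide), hinj.ne (a₁ := 0) (a₂ := 2) (by decide),
        hinj.ne (a₁ := 1) (a₂ := 2) (by decide)⟩
  refine ColSearch.not_exists (P.eid idx) (P.triple t) (l.map P.triple) hs h (fun d d' he => ?_) ?_
  · obtain rfl | hd := hE d d' he
    · rfl
    · exact (hh.flip d d' hd (Set.notMem_empty _) (Set.notMem_empty _)).symm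
  · rw [← List.map_cons]
    intro s hs
    obtain ⟨x, -, rfl⟩ := List.mem_map.1 hs
    exact key x

end Piece

namespace DoubleStar

/-- The half-edges of a piece obtained from the double star snark. -/
def nb (d : Fin 28 × Fin 3) : (Fin 28 × Fin 3) ⊕ (Bool × Fin 3) :=
  [.inr (false, 0), .inl (1, 0), .inl (10, 0),
    .inl (0, 1), .inl (2, 0), .inl (6, 0),
    .inl (1, 1), .inl (3, 0), .inl (17, 0),
    .inl (2, 1), .inl (4, 0), .inl (13, 1),
    .inl (3, 1), .inl (9, 0), .inl (5, 0),
    .inl (4, 2), .inl (19, 0), .inl (6, 1),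
    .inl (1, 2), .inl (5, 2), .inl (7, 0),
    .inl (6, 2), .inl (8, 0), .inl (12, 0),
    .inl (7, 1), .inl (22, 0), .inl (9, 1),
    .inl (4, 1), .inl (8, 2), .inl (10, 1),
    .inl (0, 2), .inl (9, 2), .inl (11, 0),
    .inl (10, 2), .inl (25, 0), .inl (12, 1),
    .inl (7, 2), .inl (11, 2), .inl (13, 2),
    .inr (false, 1), .inl (3, 2), .inl (12, 2),
    .inr (false, 2), .inl (15, 0), .inl (27, 0),
    .inl (14, 1), .inl (18, 0), .inl (21, 0),
    .inl (23, 0), .inl (17, 1), .inl (26, 0),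
    .inl (2, 2), .inl (16, 1), .inr (true, 0),
    .inl (15, 1), .inl (26, 1), .inl (19, 1),
    .inl (5, 1), .inl (18, 2), .inl (20, 0),
    .inl (19, 2), .inl (24, 1), .inl (27, 1),
    .inl (15, 2), .inr (true, 2), .inl (22, 1),
    .inl (8, 1), .inl (21, 2), .inl (23, 1),
    .inl (16, 0), .inl (22, 2), .inl (27, 2),
    .inr (true, 1), .inl (20, 1), .inl (25, 1),
    .inl (11, 1), .inl (24, 2), .inl (26, 2),
    .inl (16, 2), .inl (18, 1), .inl (25, 2),
    .inl (14, 2), .inl (20, 2), .inl (23, 2)].getD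
    (3 * d.1.val + d.2.val) (.inr (false, 0))

/-- The positions of the dangling edges. -/
def port (p : Bool × Fin 3) : Fin 28 × Fin 3 :=
  (cond p.1 [(17, 2), (24, 0), (21, 1)] [(0, 0), (13, 0), (14, 0)]).getD p.2.val (0, 0)

/-- A piece obtained from the double star snark by removing two vertices. -/
def piece : Piece where
  W := Fin 28
  fin := inferInstance
  dec := inferInstance
  nb := nb
  port := port
  nb_symm := by decide +kernel
  nb_eq_inr := by decide +kernel
  nb_ne := by decide +kernel
  nb_inj := by
    have : ∀ u i j, (nb (u, i)).map Prod.fst id = (nb (u, j)).map Prod.fst id → i = j := by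
      decide +kernel
    intro u i j d d' h h' e
    exact this u i j (by rw [h, h']; simp [e])
  port_inj := by decide +kernel

/-- The index of a vertex. -/
def idx : piece.W → ℕ := fun w : Fin 28 => w.val

/-- Colourings with given boundary. -/
def realTable : List ℕ :=
  [4753772905073203467840, 4905114028956619626108, 1001822221570255144860, 6134180121868862359452,
    5930420448489242908224, 1699904407283081057856, 2705761132541875921080, 5418433672905968083128,
    2053748924183039620086, 3092130826586885370870, 5930113331995067211960, 3747411632127808250040,
    4507375145886613791810, 1697162296947511500984, 4441037773297477546998, 210521732091315696630,
    5467901786875754206002, 4519293808168247682114]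

/-- Colourings without the end of the second dangling edge on the left. -/
def leftTable₁ : List ℕ :=
  [2857387436739408344700, 2053748924143857538038, 3092130826547703288822, 4507375145847431709762,
    1697162296921390112952, 1001822221557194450844, 6134180121855801665436, 1001822187703875561840,
    5930462900090298837360]

/-- Colourings without the end of the third dangling edge on the left. -/
def leftTable₂ : List ℕ :=
  [2857387436674104874620, 1001822221335162652572, 6134180121712134031260, 4507375145729885463618,
    1697162296712419008696, 2248029363492958532598, 3092130826508521206774, 5780217849701900116152,
    4020897455885333161026]

/-- Colourings without adjacent vertices. -/
def edgeTable : List ℕ :=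
  [0, 673501102768863152892, 1971988647952553178264, 0, 1971988647939250620553,
    2038674641555085234408, 0, 1046008038578054229954, 812529882241272837084, 0,
    673501102788013244400, 360263689722636745122, 0, 1971988647952805117148,
    1971988647952684083721, 0, 2857847704858087623948, 1971988647952683945991, 0, 0,
    1971988647939226594897, 0, 1971988647952838399724, 1971988647933220488948, 0,
    720271017731496735228, 1971988647952678183033, 0, 0, 1971988647939079301892, 0, 0,
    1971988647932912279412, 0, 2914710819916447728876, 1971988647946265222508, 0, 0,
    1971988647934874429551, 0, 0, 0, 0, 5418367861427133636792, 300922924467765764280, 0,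
    1631129940580850672706, 2120064358175888041026, 810292307614820606136, 4022698632830995900243,
    3112929415887515472690, 0, 0, 0, 0, 3167944960677202388034, 210762970528287232818, 0, 0,
    3144245640108757509186, 0, 2398216762328018047794, 413358421587222488130, 0, 0,
    2347113930048725737656, 0, 0, 3743441050409397149880, 0, 0, 422129546703667700802, 0, 0,
    1374945763760816464056, 0, 0, 1033789111918756831416, 0, 0, 0, 0, 0, 0]

theorem goodCheck : piece.GoodCheck idx realTable leftTable₁ leftTable₂
    2347772040657412005968 3046968627602150187192
    3357241040027764809912 2705805004327324246200 where
  real := by decide +kernel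
  left := by decide +kernel
  right := by decide +kernel
  right_one := by decide +kernel
  right_two := by decide +kernel
  left_one := by decide +kernel
  left_two := by decide +kernel

theorem edgeCheck : piece.EdgeCheck idx edgeTable := by decide +kernel

theorem not_real (L R : Fin 3 → Fin 3) (hL : Injective L) (hR : Injective R) :
    ¬ piece.Real ∅ L R := by
  let v : Fin 28 → Fin 28 ⊕ Bool := .inl
  exact Piece.not_real_of_search idx (by decide +kernel) (v 12)
    [v 11, v 10, v 7, v 8, v 9, v 0, v 1, v 6, v 13, .inr false, v 3, v 2, v 4,
      v 4, v 5, v 19, v 20, v 14, v 27, v 24, v 25, v 26, v 18, v 15, v 21, .inr true,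
      .inr true, v 22, v 17, v 16, v 23] (by decide +kernel) L R hL hR

theorem good : piece.Good := goodCheck.good not_real edgeCheck.real

theorem solid : piece.Solid := by
  refine Piece.solid_of_passes (Piece.passes_of_search
    (o := ([10, 0, 1, 11, 6, 9, 8, 7, 12, 13, 2, 3, 4, 5,
      17, 25, 24, 20, 19, 16, 26, 18, 22, 23, 27, 14, 15, 21] : List (Fin 28)))
    ?_ ?_ ?_)
  · decide +kernel
  · decide +kernel
  · decide +kernel

end DoubleStar

namespace Flower

/-- The vertices: ten special ones and `m + 1` claws, whose centres are given by `none`. -/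
abbrev V (m : ℕ) : Type := Fin 10 ⊕ Fin (m + 1) × Option (Fin 3)

/-- The half-edges of the special part: those at its ten vertices and the free half-edges at the
leaves of the first claw (`false`) and of the last claw (`true`). -/
abbrev Outer : Type := (Fin 10 × Fin 3) ⊕ (Bool × Fin 3)

/-- The edges of the special part. -/
def outerNb : Outer → Outer ⊕ (Bool × Fin 3) :=
  Sum.elim
    (fun d => ([.inl (.inl (1, 0)), .inr (false, 0), .inl (.inl (2, 0)),
      .inl (.inl (0, 0)), .inl (.inr (true, 0)), .inl (.inl (4, 1)),
      .inl (.inl (0, 2)), .inl (.inr (true, 1)), .inl (.inl (6, 1)),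
      .inl (.inl (4, 0)), .inl (.inl (5, 0)), .inl (.inl (6, 0)),
      .inl (.inl (3, 0)), .inl (.inl (1, 2)), .inr (true, 1),
      .inl (.inl (3, 1)), .inr (false, 2), .inl (.inl (8, 1)),
      .inl (.inl (3, 2)), .inl (.inl (2, 2)), .inl (.inl (9, 1)),
      .inr (true, 0), .inl (.inl (8, 0)), .inl (.inl (9, 0)),
      .inl (.inl (7, 1)), .inl (.inl (5, 2)), .inl (.inr (false, 1)),
      .inl (.inl (7, 2)), .inl (.inl (6, 2)), .inl (.inr (false, 2))] :
        List (Outer ⊕ (Bool × Fin 3))).getD (3 * d.1.val + d.2.val) (.inr (false, 0)))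
    fun p => (cond p.1 [.inl (.inl (1, 1)), .inl (.inl (2, 1)), .inr (false, 1)]
      [.inr (true, 2), .inl (.inl (8, 2)), .inl (.inl (9, 2))] :
        List (Outer ⊕ (Bool × Fin 3))).getD p.2.val (.inr (false, 0))

/-- The positions of the dangling edges. -/
def outerPort (p : Bool × Fin 3) : Outer :=
  (cond p.1 [.inl (7, 0), .inl (4, 2), .inr (false, 0)]
    [.inl (0, 1), .inr (true, 2), .inl (5, 1)]).getD p.2.val (.inl (0, 0))

variable {m : ℕ}

/-- The half-edges of the special part as half-edges of the piece. -/
def emb (m : ℕ) : Outer → V m × Fin 3 :=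
  Sum.elim (fun d => (.inl d.1, d.2))
    fun r => cond r.1 (.inr (Fin.last m, some r.2), 2) (.inr (0, some r.2), 1)

/-- The half-edges of a piece obtained from a flower snark. -/
def nb (d : V m × Fin 3) : (V m × Fin 3) ⊕ (Bool × Fin 3) :=
  match d with
  | (.inl i, p) => (outerNb (.inl (i, p))).map (emb m) id
  | (.inr (b, none), p) => .inl (.inr (b, some p), 0)
  | (.inr (b, some j), 0) => .inl (.inr (b, none), j)
  | (.inr (b, some j), 1) => if b.1 = 0 then (outerNb (.inr (false, j))).map (emb m) id else
      .inl (.inr (⟨b.1 - 1, by lia⟩, some j), 2)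
  | (.inr (b, some j), 2) => if h : b.1 = m then (outerNb (.inr (true, j))).map (emb m) id else
      .inl (.inr (⟨b.1 + 1, by lia⟩, some j), 1)

theorem emb_injective : Injective (emb m) := by
  rintro (⟨i, p⟩ | ⟨_ | _, j⟩) (⟨i', p'⟩ | ⟨_ | _, j'⟩) h <;> simp_all [emb]

theorem nb_emb (x : Outer) : nb (emb m x) = (outerNb x).map (emb m) id := by
  obtain (⟨i, p⟩ | ⟨_ | _, j⟩) := x <;> simp [emb, nb]

theorem nb_inner {b : Fin (m + 1)} (hb : b.1 ≠ m) (j : Fin 3) :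
    nb (.inr (b, some j), 2) = .inl (.inr (⟨b.1 + 1, by lia⟩, some j), 1) := by
  simp [nb, hb]

theorem nb_inner' {b : Fin (m + 1)} (hb : b.1 ≠ 0) (j : Fin 3) :
    nb (.inr (b, some j), 1) = .inl (.inr (⟨b.1 - 1, by lia⟩, some j), 2) := by
  simp [nb, hb]

theorem emb_or (d : V m × Fin 3) :
    (∃ x, d = emb m x) ∨ ∃ d', nb d = .inl d' ∧ nb d' = .inl d ∧ d'.1 ≠ d.1 := by
  obtain ⟨i | ⟨b, _ | j⟩, p⟩ := d
  · exact .inl ⟨.inl (i, p), rfl⟩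
  · exact .inr ⟨_, rfl, rfl, by simp⟩
  · match p with
    | 0 => exact .inr ⟨_, rfl, rfl, by simp⟩
    | 1 =>
      by_cases hb : b.1 = 0
      · exact .inl ⟨.inr (false, j), by simp [emb, ← Fin.val_inj, hb]⟩
      · refine .inr ⟨_, nb_inner' hb j, (nb_inner (by simp; lia) j).trans ?_, ?_⟩
        · congr 6
          simp; lia
        · simp [← Fin.val_inj]; lia
    | 2 =>
      by_cases hb : b.1 = m
      · exact .inl ⟨.inr (true, j), by simp [emb, ← Fin.val_inj, hb]⟩
      · exact .inr ⟨_, nb_inner hb j, (nb_inner' (by simp) j).trans (by simp), by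
          simp [← Fin.val_inj]⟩

theorem nb_emb_eq_inl {x : Outer} {d : V m × Fin 3} (h : nb (emb m x) = .inl d) :
    ∃ y, d = emb m y ∧ outerNb x = .inl y := by
  rw [nb_emb] at h
  cases hx : outerNb x with
  | inl y =>
    rw [hx] at h
    exact ⟨y, by simpa using h.symm, rfl⟩
  | inr e => simp [hx] at h

theorem outerNb_rim : ∀ r r', outerNb (.inr r) ≠ .inl (.inr r') := by decide +kernel

/-- A piece obtained from a flower snark. -/
def piece (m : ℕ) : Piece where
  W := V m
  fin := inferInstance
  dec := inferInstance
  nb := nb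
  port p := emb m (outerPort p)
  nb_symm d d' h := by
    obtain ⟨x, rfl⟩ | ⟨e, he, he', -⟩ := emb_or d
    · obtain ⟨y, rfl, hy⟩ := nb_emb_eq_inl h
      have : ∀ x y, outerNb x = .inl y → outerNb y = .inl x := by decide +kernel
      rw [nb_emb, this x y hy, Sum.map_inl]
    · rw [he, Sum.inl.injEq] at h
      exact h ▸ he'
  nb_eq_inr d p := by
    obtain ⟨x, rfl⟩ | ⟨e, he, he', -⟩ := emb_or d
    · have : ∀ x p, outerNb x = .inr p ↔ outerPort p = x := by decide +kernel
      rw [nb_emb, emb_injective.eq_iff, ← this]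
      cases outerNb x <;> simp
    · rw [he]
      refine iff_of_false (by simp) fun h => ?_
      have : ∀ p, outerNb (outerPort p) = .inr p := by decide +kernel
      rw [← h, nb_emb, this] at he
      simp at he
  nb_ne d d' h := by
    obtain ⟨x, rfl⟩ | ⟨e, he, he', hne⟩ := emb_or d
    · obtain ⟨y, rfl, hy⟩ := nb_emb_eq_inl h
      obtain (⟨i, p⟩ | ⟨c, j⟩) := x <;> obtain (⟨i', p'⟩ | ⟨c', j'⟩) := y
      · have : ∀ i p i' p', outerNb (.inl (i, p)) = .inl (.inl (i', p')) → i' ≠ i := by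
          decide +kernel
        simpa [emb] using this _ _ _ _ hy
      · cases c' <;> simp [emb]
      · cases c <;> simp [emb]
      · exact absurd hy (outerNb_rim _ _)
    · rw [he, Sum.inl.injEq] at h
      exact h ▸ hne
  nb_inj w i j d d' h h' e := by
    obtain i' | ⟨b, _ | k⟩ := w
    · obtain ⟨x, rfl, hx⟩ := nb_emb_eq_inl (x := .inl (i', i)) h
      obtain ⟨y, rfl, hy⟩ := nb_emb_eq_inl (x := .inl (i', j)) h'
      have h1 : ∀ u i v, outerNb (.inl (u, i)) = .inl (.inl v) → ∀ j v',
        outerNb (.inl (u, j)) = .inl (.inl v') → v.1 = v'.1 → i = j := by decide +kernel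
      have h2 : ∀ u i v, outerNb (.inl (u, i)) = .inl (.inr v) → ∀ j v',
        outerNb (.inl (u, j)) = .inl (.inr v') → i = j := by decide +kernel
      obtain v | v := x <;> obtain v' | v' := y
      · exact h1 _ _ _ hx _ _ hy (by simpa [emb] using e)
      · obtain ⟨c, v'⟩ := v'
        cases c <;> simp [emb] at e
      · obtain ⟨c, v⟩ := v
        cases c <;> simp [emb] at e
      · exact h2 _ _ _ hx _ _ hy
    · simp only [nb, Sum.inl.injEq] at h h'
      subst h h'
      simpa using e
    · have h0 : ∀ i d, nb (.inr (b, some k), i) = .inl d →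
          (i = 0 ∧ d.1 = .inr (b, none)) ∨
          (i = 1 ∧ ∃ b', b'.1 + 1 = b.1 ∧ d.1 = .inr (b', some k)) ∨
          (i = 2 ∧ ∃ b', b'.1 = b.1 + 1 ∧ d.1 = .inr (b', some k)) ∨
          ∃ c u, d.1 = .inl u ∧ i = cond c 2 1 ∧
            ∃ v, outerNb (.inr (c, k)) = .inl (.inl (u, v)) := by
        intro i d hd
        match i with
        | 0 => exact .inl ⟨rfl, by simp only [nb, Sum.inl.injEq] at hd; rw [← hd]⟩
        | 1 =>
          by_cases hb : b.1 = 0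
          · obtain rfl : b = 0 := Fin.ext hb
            obtain ⟨y, rfl, hy⟩ := nb_emb_eq_inl (x := .inr (false, k)) hd
            obtain v | r := y
            · exact .inr (.inr (.inr ⟨false, v.1, rfl, rfl, v.2, hy⟩))
            · exact absurd hy (outerNb_rim _ _)
          · rw [nb_inner' hb, Sum.inl.injEq] at hd
            exact .inr (.inl ⟨rfl, ⟨b.1 - 1, by lia⟩,
              Nat.sub_add_cancel (Nat.pos_of_ne_zero hb), by rw [← hd]⟩)
        | 2 =>
          by_cases hb : b.1 = m
          · obtain rfl : b = Fin.last m := Fin.ext hb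
            obtain ⟨y, rfl, hy⟩ := nb_emb_eq_inl (x := .inr (true, k)) hd
            obtain v | r := y
            · exact .inr (.inr (.inr ⟨true, v.1, rfl, rfl, v.2, hy⟩))
            · exact absurd hy (outerNb_rim _ _)
          · rw [nb_inner hb, Sum.inl.injEq] at hd
            exact .inr (.inr (.inl ⟨rfl, _, rfl, by rw [← hd]⟩))
      have h1 : ∀ k c c' u v v', outerNb (.inr (c, k)) = .inl (.inl (u, v)) →
          outerNb (.inr (c', k)) = .inl (.inl (u, v')) → c = c' := by
        decide +kernel
      obtain ⟨rfl, h2⟩ | ⟨rfl, x, hx, h2⟩ | ⟨rfl, x, hx, h2⟩ |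
        ⟨c, u, h2, rfl, v, hv⟩ := h0 _ _ h <;>
        obtain ⟨rfl, h3⟩ | ⟨rfl, y, hy, h3⟩ | ⟨rfl, y, hy, h3⟩ | ⟨c', u', h3, rfl, v', hv'⟩ :=
          h0 _ _ h' <;> rw [h2, h3] at e <;> simp only [Sum.inr.injEq, Sum.inl.injEq,
            Prod.mk.injEq, reduceCtorEq, and_false, and_true] at e
      · lia
      · lia
      · subst e
        rw [h1 _ _ _ _ _ _ hv hv']
  port_inj b s t h := by
    have h1 : ∀ b s u, outerPort (b, s) = .inl u → ∀ t v, outerPort (b, t) = .inl v →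
        u.1 = v.1 → s = t := by decide +kernel
    have h2 : ∀ b s t u v, outerPort (b, s) = .inr u → outerPort (b, t) = .inr v → s = t := by
      decide +kernel
    have h3 : ∀ (u : Fin 10 × Fin 3) v, (emb m (.inl u)).1 ≠ (emb m (.inr v)).1 := by
      rintro u ⟨_ | _, j⟩ <;> simp [emb]
    generalize hx : outerPort (b, s) = x at h
    generalize hy : outerPort (b, t) = y at h
    obtain u | u := x <;> obtain v | v := y
    · exact h1 _ _ _ hx _ _ hy (by simpa [emb] using h)
    · exact absurd h (h3 _ _)
    · exact absurd h.symm (h3 _ _)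
    · exact h2 _ _ _ _ _ hx hy

end Flower

/-- Pulling back a colouring along a map of pieces. -/
theorem Piece.Real.of_fold {P Q : Piece} (f : P.W → Q.W) (g : P.W × Fin 3 → Q.W × Fin 3)
    (hfg : ∀ d, (g d).1 = f d.1) (hinj : ∀ v, Injective fun i => (g (v, i)).2)
    (hnb : ∀ d d', P.nb d = .inl d' → g d' = g d ∨ Q.nb (g d) = .inl (g d'))
    (hport : ∀ p, g (P.port p) = Q.port p) {Y : Set P.W} {L R : Fin 3 → Fin 3}
    (h : Q.Real (f '' Y) L R) (hY : ∀ v w, w ∈ Y → f v = f w → v = w) : P.Real Y L R := by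
  obtain ⟨c, hc, hL, hR⟩ := h
  have hmem : ∀ d : P.W × Fin 3, d.1 ∉ Y → (g d).1 ∉ f '' Y := by
    rintro d hd ⟨w, hw, e⟩
    rw [hfg] at e
    exact hd (hY d.1 w hw e.symm ▸ hw)
  refine ⟨fun d => c (g d), ⟨fun v hv i j hij => ?_, fun d d' hd h1 h2 => ?_⟩, fun s hs => ?_,
    fun s hs => ?_⟩
  · have e : ∀ i, g (v, i) = (f v, (g (v, i)).2) := fun i => Prod.ext (hfg _) rfl
    dsimp only at hij
    rw [e i, e j] at hij
    exact hinj v (hc.inj _ (hfg (v, i) ▸ hmem (v, i) hv) hij)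
  · obtain e | e := hnb d d' hd
    · exact congrArg c e
    · exact hc.flip _ _ e (hmem _ h1) (hmem _ h2)
  · exact (congrArg c (hport _)).trans (hL s (hport (false, s) ▸ hmem _ hs))
  · exact (congrArg c (hport _)).trans (hR s (hport (true, s) ▸ hmem _ hs))

namespace Flower

variable {m : ℕ} (q : Fin (m + 1))

/-- Folding three consecutive claws into one. -/
def fold (b : Fin (m + 2 + 1)) : Fin (m + 1) :=
  ⟨if b.1 ≤ q then b else if b.1 = q + 1 then q else b - 2, by split_ifs <;> lia⟩

/-- Folding on the vertices. -/
def foldV : V (m + 2) → V m := Sum.map id (Prod.map (fold q) id)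

/-- Folding on the half-edges. -/
def foldD : V (m + 2) × Fin 3 → V m × Fin 3
  | (.inl i, p) => (.inl i, p)
  | (.inr (b, none), p) => (.inr (fold q b, none), p)
  | (.inr (b, some j), p) => (.inr (fold q b, some j), if b.1 = q + 1 then -p else p)

theorem foldD_fst (d : V (m + 2) × Fin 3) : (foldD q d).1 = foldV q d.1 := by
  obtain ⟨i | ⟨b, _ | j⟩, p⟩ := d <;> rfl

theorem foldD_injective (v : V (m + 2)) : Injective fun i => (foldD q (v, i)).2 := by
  obtain i | ⟨b, _ | j⟩ := v
  · exact injective_id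
  · exact injective_id
  · by_cases hb : b.1 = q + 1 
    · simpa [foldD, hb] using neg_injective
    · exact fun _ _ h => by simpa [foldD, hb] using h

theorem foldD_emb (x : Outer) : foldD q (emb (m + 2) x) = emb m x := by
  obtain ⟨i, p⟩ | ⟨_ | _, j⟩ := x
  · rfl
  · simp [emb, foldD, fold]
  · have h1 : ¬ m + 2 = q.1 + 1 := by lia
    have h2 : ¬ m + 2 ≤ q.1 := by lia
    simp [emb, foldD, fold, h1, h2, Fin.ext_iff]

theorem nb_foldD {d d' : V (m + 2) × Fin 3} (h : nb d = .inl d') :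
    foldD q d' = foldD q d ∨ nb (foldD q d) = .inl (foldD q d') := by
  have key : ∀ (b : Fin (m + 2 + 1)) (hb : b.1 ≠ m + 2) (j : Fin 3),
      foldD q (.inr (⟨b.1 + 1, by lia⟩, some j), 1) = foldD q (.inr (b, some j), 2) ∨
        (nb (foldD q (.inr (b, some j), 2)) =
            .inl (foldD q (.inr (⟨b.1 + 1, by lia⟩, some j), 1)) ∧
          nb (foldD q (.inr (⟨b.1 + 1, by lia⟩, some j), 1)) =
            .inl (foldD q (.inr (b, some j), 2))) := by
    intro b hb j
    by_cases h1 : b.1 = q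
    · left
      simp [foldD, fold, h1]
      rfl
    by_cases h2 : b.1 = q + 1
    · left
      simp [foldD, fold, h2]
      rfl
    right
    have h4 : (foldD q (.inr (b, some j), 2)) = (.inr (fold q b, some j), 2) := by
      simp [foldD, h2]
    have h5 : (foldD q (.inr (⟨b.1 + 1, by lia⟩, some j), 1)) =
        (.inr (⟨(fold q b).1 + 1, by simp [fold]; split_ifs <;> lia⟩, some j), 1) := by
      simp [foldD, h1, fold]
      split_ifs <;> lia
    rw [h4, h5]
    constructor
    · exact nb_inner (b := fold q b) (by simp [fold]; split_ifs <;> lia) j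
    · rw [nb_inner' (by simp)]
      simp
  by_cases hx : ∃ x, d = emb (m + 2) x
  · obtain ⟨x, rfl⟩ := hx
    obtain ⟨y, rfl, hy⟩ := nb_emb_eq_inl h
    right
    rw [foldD_emb, foldD_emb, nb_emb, hy, Sum.map_inl]
  · obtain ⟨i | ⟨b, _ | j⟩, p⟩ := d
    · exact absurd ⟨.inl (i, p), rfl⟩ hx
    · simp only [nb, Sum.inl.injEq] at h
      subst h
      right
      simp [foldD, nb]
    · match p with
      | 0 =>
        simp only [nb, Sum.inl.injEq] at h
        subst h
        right
        simp [foldD, nb]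
      | 1 =>
        by_cases hb : b.1 = 0
        · obtain rfl : b = 0 := Fin.ext hb
          exact absurd ⟨.inr (false, j), rfl⟩ hx
        · rw [nb_inner' hb, Sum.inl.injEq] at h
          subst h
          have := key ⟨b.1 - 1, by lia⟩ (by simp; lia) j
          simp only [Nat.sub_add_cancel (Nat.pos_of_ne_zero hb)] at this
          exact this.imp Eq.symm And.right
      | 2 =>
        by_cases hb : b.1 = m + 2
        · obtain rfl : b = Fin.last (m + 2) := Fin.ext hb
          exact absurd ⟨.inr (true, j), rfl⟩ hx
        · rw [nb_inner hb, Sum.inl.injEq] at h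
          subst h
          exact (key b hb j).imp_right And.left

theorem real_of_real {X : Set (V m)} {Y : Set (V (m + 2))} {L R : Fin 3 → Fin 3}
    (h : (piece m).Real X L R) (hX : foldV q '' Y = X)
    (hY : ∀ v w, w ∈ Y → foldV q v = foldV q w → v = w) : (piece (m + 2)).Real Y L R := by
  subst hX
  exact h.of_fold (P := piece (m + 2)) (Q := piece m) (foldV q) (foldD q) (foldD_fst q)
    (foldD_injective q) (fun _ _ => nb_foldD q) (fun _ => foldD_emb q _) hY

theorem fold_eq {b b' : Fin (m + 2 + 1)} (h1 : b'.1 ≠ q) (h2 : b'.1 ≠ q + 1) (h3 : b'.1 ≠ q + 2)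
    (h : fold q b = fold q b') : b = b' := by
  rw [← Fin.val_inj] at h ⊢
  simp only [fold] at h
  split_ifs at h <;> lia

theorem foldV_eq_inl {v : V (m + 2)} {i : Fin 10} (h : foldV q v = foldV q (.inl i)) :
    v = .inl i := by
  obtain j | x := v
  · simpa [foldV] using h
  · simp [foldV] at h

theorem foldV_eq_inr {v : V (m + 2)} {b : Fin (m + 2 + 1)} {x : Option (Fin 3)} (h1 : b.1 ≠ q)
    (h2 : b.1 ≠ q + 1) (h3 : b.1 ≠ q + 2) (h : foldV q v = foldV q (.inr (b, x))) :
    v = .inr (b, x) := by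
  obtain j | ⟨b', y⟩ := v
  · simp [foldV] at h
  · simp only [foldV, Sum.map_inr, Prod.map_apply, id_eq, Sum.inr.injEq, Prod.mk.injEq] at h
    rw [fold_eq q h1 h2 h3 h.1, h.2]

theorem exists_fold_emb (hm : 1 ≤ m) (x : Outer) : ∃ q : Fin (m + 1), ∀ v,
    foldV q v = foldV q (emb (m + 2) x).1 → v = (emb (m + 2) x).1 := by
  obtain ⟨i, p⟩ | ⟨_ | _, j⟩ := x
  · exact ⟨0, fun v => foldV_eq_inl 0⟩
  · exact ⟨Fin.last m, fun v => foldV_eq_inr _ (by simp; lia) (by simp) (by simp)⟩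
  · exact ⟨0, fun v => foldV_eq_inr _ (by simp) (by simp) (by simp; lia)⟩

theorem real_port (hm : 1 ≤ m) (p : Bool × Fin 3) {L R : Fin 3 → Fin 3}
    (h : (piece m).Real {((piece m).port p).1} L R) :
    (piece (m + 2)).Real {((piece (m + 2)).port p).1} L R := by
  obtain ⟨q, hq⟩ := exists_fold_emb hm (outerPort p)
  refine real_of_real q h (Set.image_singleton.trans (congrArg _ ?_)) ?_
  · exact (foldD_fst q _).symm.trans (congrArg _ (foldD_emb q _))
  · rintro v w rfl hv
    exact hq v hv

theorem claw_near {b b' : Fin (m + 1)} {x y : Option (Fin 3)} {p p' : Fin 3}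
    (h : nb (.inr (b, x), p) = .inl (.inr (b', y), p')) :
    b'.1 = b ∨ b'.1 = b + 1 ∨ b.1 = b' + 1 := by
  match x, p with
  | none, p => simp_all [nb]
  | some j, 0 => simp_all [nb]
  | some j, 1 =>
    by_cases hb : b.1 = 0
    · obtain rfl : b = 0 := Fin.ext hb
      obtain ⟨⟨_, _⟩ | r, e, hy⟩ := nb_emb_eq_inl (x := .inr (false, j)) h
      · simp [emb] at e
      · exact absurd hy (outerNb_rim _ _)
    · simp only [nb_inner' hb, Sum.inl.injEq, Prod.mk.injEq, Sum.inr.injEq, ← Fin.val_inj] at h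
      lia
  | some j, 2 =>
    by_cases hb : b.1 = m
    · obtain rfl : b = Fin.last m := Fin.ext hb
      obtain ⟨⟨_, _⟩ | r, e, hy⟩ := nb_emb_eq_inl (x := .inr (true, j)) h
      · simp [emb] at e
      · exact absurd hy (outerNb_rim _ _)
    · simp only [nb_inner hb, Sum.inl.injEq, Prod.mk.injEq, Sum.inr.injEq, ← Fin.val_inj] at h
      lia

theorem exists_fold_edge (hm : 5 ≤ m) {d d' : V (m + 2) × Fin 3} (h : nb d = .inl d') :
    ∃ q : Fin (m + 1), ∀ v w, (w = d.1 ∨ w = d'.1) → foldV q v = foldV q w → v = w := by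
  have h1 : ∃ c : ℕ, ∀ w : V (m + 2), w = d.1 ∨ w = d'.1 →
      ∀ b x, w = .inr (b, x) → b.1 = c ∨ b.1 = c + 1 := by
    obtain ⟨i | ⟨b, x⟩, p⟩ := d <;> obtain ⟨i' | ⟨b', y⟩, p'⟩ := d'
    · exact ⟨0, by rintro w (rfl | rfl) b x h <;> simp at h⟩
    · exact ⟨b', by rintro w (rfl | rfl) b x h <;> simp at h; simp [h]⟩
    · exact ⟨b, by rintro w (rfl | rfl) b x h <;> simp at h; simp [h]⟩
    · refine ⟨min b.1 b'.1, ?_⟩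
      have := claw_near h
      rintro w (rfl | rfl) b x h <;> simp at h <;> obtain ⟨rfl, rfl⟩ := h <;> lia
  obtain ⟨c, hc⟩ := h1
  obtain ⟨q, hq⟩ : ∃ q : Fin (m + 1), c + 1 < q.1 ∨ q.1 + 2 < c := by
    by_cases h : 3 ≤ c
    · exact ⟨0, .inr (by simp; lia)⟩
    · exact ⟨⟨4, by lia⟩, .inl (by simp; lia)⟩
  refine ⟨q, fun v w hw hv => ?_⟩
  obtain i | ⟨b, x⟩ := w
  · exact foldV_eq_inl q hv
  · have := hc _ hw b x rfl
    exact foldV_eq_inr q (by lia) (by lia) (by lia) hv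

theorem real_edge (hm : 5 ≤ m) (h : (piece m).Good) (d d') (hd : (piece (m + 2)).nb d = .inl d') :
    ∃ L R, Injective L ∧ Injective R ∧ (piece (m + 2)).Real {d.1, d'.1} L R := by
  obtain ⟨q, hq⟩ := exists_fold_edge hm hd
  obtain e | e := nb_foldD q hd
  · have h1 : foldV q d'.1 = foldV q d.1 :=
      (foldD_fst q d').symm.trans ((congrArg Prod.fst e).trans (foldD_fst q d))
    exact absurd (hq _ _ (.inl rfl) h1) ((piece (m + 2)).nb_ne _ _ hd)
  · obtain ⟨L, R, hL, hR, -, -, h1⟩ := h.real_edge _ _ e 0 0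
    refine ⟨L, R, hL, hR, real_of_real q h1 ((Set.image_pair _ _ _).trans ?_) hq⟩
    exact congrArg₂ (fun v w : V m => ({v, w} : Set (V m)))
      (foldD_fst q d).symm (foldD_fst q d').symm

theorem good_add_two (hm : 1 ≤ m) (h : (piece m).Good)
    (hn : ∀ L R, Injective L → Injective R → ¬ (piece (m + 2)).Real ∅ L R)
    (he : ∀ d d', (piece (m + 2)).nb d = .inl d' →
      ∃ L R, Injective L ∧ Injective R ∧ (piece (m + 2)).Real {d.1, d'.1} L R) :
    (piece (m + 2)).Good where
  not_real := hn
  real c L R hL hR := real_of_real 0 (h.real c L R hL hR) (Set.image_empty _)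
    fun _ _ h => absurd h (Set.notMem_empty _)
  real_edge d d' hd f g := Piece.real_ne_of_real (he d d' hd) f g
  real_left f g := by
    obtain ⟨L, R, h1, h2, h3, h4⟩ := h.real_left f g
    exact ⟨L, R, h1, h2, h3, real_port hm _ h4⟩
  real_right f g := by
    obtain ⟨L, R, h1, h2, h3, h4⟩ := h.real_right f g
    exact ⟨L, R, h1, h2, h3, real_port hm _ h4⟩
  real_straight_right s hs f g := by
    obtain ⟨L, R, h1, h2, h3, h4⟩ := h.real_straight_right s hs f g
    exact ⟨L, R, h1, h2, h3, real_port hm _ h4⟩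
  real_straight_left s hs L f g hfg := real_port hm _ (h.real_straight_left s hs L f g hfg)

end Flower

namespace Flower

variable {m : ℕ}

/-- The possible colours on the two sides of a claw. -/
def Step (a b : Fin 3 → Fin 3) : Prop :=
  ∃ π : Fin 3 → Fin 3, Injective π ∧ ∀ j, π j ≠ a j ∧ π j ≠ b j ∧ a j ≠ b j

/-- The possible colours on the two sides of `n` consecutive claws. -/
def Path : ℕ → (Fin 3 → Fin 3) → (Fin 3 → Fin 3) → Prop
  | 0, a, e => a = e
  | n + 1, a, e => ∃ b, Step a b ∧ Path n b e

theorem path_iff {n : ℕ} {a e : Fin 3 → Fin 3} : Path n a e ↔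
    ∃ s : ℕ → Fin 3 → Fin 3, s 0 = a ∧ s n = e ∧ ∀ i < n, Step (s i) (s (i + 1)) := by
  induction n generalizing a with
  | zero => exact ⟨fun h => ⟨fun _ => a, rfl, h, by simp⟩, fun ⟨s, h, h', _⟩ => h.symm.trans h'⟩
  | succ n ih =>
    constructor
    · rintro ⟨b, hb, h⟩
      obtain ⟨s, rfl, h1, h2⟩ := ih.1 h
      refine ⟨fun i => Nat.casesOn i a s, rfl, h1, fun i hi => ?_⟩
      cases i with
      | zero => exact hb
      | succ i => exact h2 i (by lia)
    · rintro ⟨s, rfl, h1, h2⟩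
      exact ⟨s 1, h2 0 (by lia), ih.2 ⟨fun i => s (i + 1), rfl, h1, fun i hi => h2 _ (by lia)⟩⟩

theorem exists_eq_permOf {π : Fin 3 → Fin 3} (h : Injective π) : ∃ i : Fin 6, π = permOf i := by
  revert π; decide +kernel

theorem step_iff {a b : Fin 3 → Fin 3} : Step a b ↔
    ∃ i : Fin 6, (∀ j, permOf i j ≠ a j) ∧ b = fun j => -(a j + permOf i j) := by
  have h1 : ∀ x y z : Fin 3, x ≠ y ∧ x ≠ z ∧ y ≠ z ↔ x ≠ y ∧ z = -(y + x) := by decide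
  simp only [Step, h1, forall_and, funext_iff]
  constructor
  · rintro ⟨π, hπ, h⟩
    obtain ⟨i, rfl⟩ := exists_eq_permOf hπ
    exact ⟨i, h⟩
  · rintro ⟨i, h⟩
    exact ⟨_, permOf_injective i, h⟩

theorem path_two_of_four {a e : Fin 3 → Fin 3} (h : Path 4 a e) : Path 2 a e := by
  have key : ∀ x y z : Fin 3, ∀ i₁ : Fin 6, (∀ j, permOf i₁ j ≠ ![x, y, z] j) →
      ∀ i₂ : Fin 6, (∀ j, permOf i₂ j ≠ -(![x, y, z] j + permOf i₁ j)) →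
      ∀ i₃ : Fin 6, (∀ j, permOf i₃ j ≠ -(-(![x, y, z] j + permOf i₁ j) + permOf i₂ j)) →
      ∀ i₄ : Fin 6, (∀ j, permOf i₄ j ≠
        -(-(-(![x, y, z] j + permOf i₁ j) + permOf i₂ j) + permOf i₃ j)) →
      ∃ k₁ : Fin 6, (∀ j, permOf k₁ j ≠ ![x, y, z] j) ∧
        ∃ k₂ : Fin 6, (∀ j, permOf k₂ j ≠ -(![x, y, z] j + permOf k₁ j)) ∧
          ∀ j, -(-(-(-(![x, y, z] j + permOf i₁ j) + permOf i₂ j) + permOf i₃ j) + permOf i₄ j) =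
            -(-(![x, y, z] j + permOf k₁ j) + permOf k₂ j) := by decide +kernel
  obtain ⟨b₁, h₁, b₂, h₂, b₃, h₃, b₄, h₄, rfl⟩ := h
  obtain ⟨i₁, e₁, rfl⟩ := step_iff.1 h₁
  obtain ⟨i₂, e₂, rfl⟩ := step_iff.1 h₂
  obtain ⟨i₃, e₃, rfl⟩ := step_iff.1 h₃
  obtain ⟨i₄, e₄, rfl⟩ := step_iff.1 h₄
  have ea : ![a 0, a 1, a 2] = a := by ext j; fin_cases j <;> rfl
  have := key (a 0) (a 1) (a 2)
  simp only [ea] at this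
  obtain ⟨k₁, h5, k₂, h6, h7⟩ := this i₁ e₁ i₂ e₂ i₃ e₃ i₄ e₄
  exact ⟨_, step_iff.2 ⟨k₁, h5, rfl⟩, _, step_iff.2 ⟨k₂, h6, rfl⟩, (funext h7).symm⟩

theorem path_append {k n : ℕ} {a e : Fin 3 → Fin 3} :
    Path (n + k) a e ↔ ∃ b, Path k a b ∧ Path n b e := by
  induction k generalizing a with
  | zero => simp [Path]
  | succ k ih =>
    rw [← add_assoc]
    simp only [Path, ih]
    exact ⟨fun ⟨b, h1, c, h2, h3⟩ => ⟨c, ⟨b, h1, h2⟩, h3⟩,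
      fun ⟨c, ⟨b, h1, h2⟩, h3⟩ => ⟨b, h1, c, h2, h3⟩⟩

/-- A colouring of the special part with given colours on the dangling edges. -/
structure OuterCol (g : Outer → Fin 3) (L R : Fin 3 → Fin 3) : Prop where
  inj : ∀ i, Injective fun p => g (.inl (i, p))
  flip : ∀ x y, outerNb x = .inl y → g y = g x
  left : ∀ s, g (outerPort (false, s)) = L s
  right : ∀ s, g (outerPort (true, s)) = R s

theorem real_iff {L R : Fin 3 → Fin 3} : (piece m).Real ∅ L R ↔ ∃ g, OuterCol g L R ∧
    Path (m + 1) (fun j => g (.inr (false, j))) fun j => g (.inr (true, j)) := by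
  constructor
  · rintro ⟨c, hc, hL, hR⟩
    refine ⟨fun x => c (emb m x), ⟨fun i => hc.inj (.inl i) (Set.notMem_empty _), fun x y h => ?_,
      fun s => hL s (Set.notMem_empty _), fun s => hR s (Set.notMem_empty _)⟩, ?_⟩
    · exact hc.flip _ _ ((nb_emb x).trans (h ▸ rfl)) (Set.notMem_empty _) (Set.notMem_empty _)
    · refine path_iff.2 ⟨fun i j => if h : i < m + 1 then c (.inr (⟨i, h⟩, some j), 1) else
        c (.inr (Fin.last m, some j), 2), by simp [emb]; rfl, by simp [emb]; rfl, fun i hi => ?_⟩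
      have hinj := fun j => hc.inj (.inr (⟨i, hi⟩, some j)) (Set.notMem_empty _)
      have h0 : ∀ j, c (.inr (⟨i, hi⟩, none), j) = c (.inr (⟨i, hi⟩, some j), 0) := fun j =>
        hc.flip (.inr (⟨i, hi⟩, some j), 0) _ rfl (Set.notMem_empty _) (Set.notMem_empty _)
      have h1 : ∀ j, (if h : i + 1 < m + 1 then c (.inr (⟨i + 1, h⟩, some j), 1) else
          c (.inr (Fin.last m, some j), 2)) = c (.inr (⟨i, hi⟩, some j), 2) := by
        intro j
        split_ifs with h
        · exact hc.flip _ _ (nb_inner (b := ⟨i, hi⟩) (by simp; lia) j) (Set.notMem_empty _)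
            (Set.notMem_empty _)
        · obtain rfl : i = m := by lia
          rfl
      refine ⟨fun j => c (.inr (⟨i, hi⟩, none), j), hc.inj (.inr (⟨i, hi⟩, none))
        (Set.notMem_empty _), fun j => ?_⟩
      simp only [h1, hi, dif_pos, h0]
      exact ⟨(hinj j).ne (a₁ := 0) (a₂ := 1) (by decide),
        (hinj j).ne (a₁ := 0) (a₂ := 2) (by decide), (hinj j).ne (a₁ := 1) (a₂ := 2) (by decide)⟩
  · rintro ⟨g, hg, hp⟩
    obtain ⟨s, hs, hs', h⟩ := path_iff.1 hp
    choose! π hπ hd using h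
    let c : V m × Fin 3 → Fin 3
      | (.inl i, p) => g (.inl (i, p))
      | (.inr (b, none), p) => π b p
      | (.inr (b, some j), p) => ![π b j, s b j, s (b + 1) j] p
    have hemb : ∀ x, c (emb m x) = g x := by
      rintro (d | ⟨_ | _, j⟩)
      · rfl
      · exact congrFun hs j
      · exact congrFun hs' j
    refine ⟨c, ⟨fun v _ => ?_, fun d d' hdd _ _ => ?_⟩, fun t _ => (hemb _).trans (hg.left t),
      fun t _ => (hemb _).trans (hg.right t)⟩
    · obtain i | ⟨b, _ | j⟩ := v
      · exact hg.inj i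
      · exact hπ b b.2
      · obtain ⟨h1, h2, h3⟩ := hd b b.2 j
        have : ∀ x y z : Fin 3, x ≠ y → x ≠ z → y ≠ z → Injective ![x, y, z] := by decide
        exact this _ _ _ h1 h2 h3
    · by_cases hx : ∃ x, d = emb m x
      · obtain ⟨x, rfl⟩ := hx
        obtain ⟨y, rfl, hy⟩ := nb_emb_eq_inl hdd
        rw [hemb, hemb, hg.flip x y hy]
      · obtain ⟨i | ⟨b, _ | j⟩, p⟩ := d
        · exact absurd ⟨.inl (i, p), rfl⟩ hx
        · obtain rfl := Sum.inl.inj hdd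
          rfl
        · match p with
          | 0 =>
            obtain rfl := Sum.inl.inj hdd
            rfl
          | 1 =>
            by_cases hb : b.1 = 0
            · obtain rfl : b = 0 := Fin.ext hb
              exact absurd ⟨.inr (false, j), rfl⟩ hx
            · obtain rfl := Sum.inl.inj ((nb_inner' hb j).symm.trans hdd)
              change s (b.1 - 1 + 1) j = s b.1 j
              rw [Nat.sub_add_cancel (Nat.pos_of_ne_zero hb)]
          | 2 =>
            by_cases hb : b.1 = m
            · obtain rfl : b = Fin.last m := Fin.ext hb
              exact absurd ⟨.inr (true, j), rfl⟩ hx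
            · obtain rfl := Sum.inl.inj ((nb_inner hb j).symm.trans hdd)
              rfl

theorem real_of_real_add_two {L R : Fin 3 → Fin 3} (hm : 1 ≤ m)
    (h : (piece (m + 2)).Real ∅ L R) : (piece m).Real ∅ L R := by
  obtain ⟨m, rfl⟩ := Nat.exists_eq_add_of_le' hm
  obtain ⟨g, hg, h⟩ := real_iff.1 h
  obtain ⟨b, h1, h2⟩ := (path_append (n := m) (k := 4)).1 h
  exact real_iff.2 ⟨g, hg, (path_append (n := m) (k := 2)).2 ⟨b, path_two_of_four h1, h2⟩⟩

end Flower

namespace Flower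

variable {m : ℕ}

/-- The index of a vertex. -/
def idx (m : ℕ) : (piece m).W → ℕ :=
  Sum.elim (fun i => i.val) fun x => 10 + 4 * x.1.val + x.2.elim 3 fun j => j.val

/-- Colourings with given boundary. -/
def realTable : List ℕ :=
  [48673634245538, 48699132718730, 48699148172450, 27290070633368, 27290050947560, 48654296545304,
    56206010050646, 56227905459374, 56227879210838, 12706683905612, 12706681093724, 56166034348748,
    55736186281610, 12706710141620, 55736201735330, 45880179998090, 88805919764152, 12754032762548]

/-- Colourings without the end of the second dangling edge on the left. -/
def leftTable₁ : List ℕ :=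
  [34568084720786, 53406769303382, 1422244275788, 52915076374154, 1422270511796, 34593598635170,
    18826740911000, 86494711178174, 52907798038154]

/-- Colourings without the end of the third dangling edge on the left. -/
def leftTable₂ : List ℕ :=
  [48673634242514, 48699148172450, 27290070633368, 55736186242730, 12706710141620, 56227879179734,
    12706683874508, 89313654147926, 55736182043690]

/-- Colourings without adjacent vertices for two claws. -/
def edgeTableTwo : List ℕ :=
  [12236886295958, 0, 56166056919080, 0, 12754097448050, 89235354668906, 0, 11305571312468,
    88805923887038, 88805923980472, 12706710151556, 56166056735204, 0, 0, 0, 0, 0, 56166033485612,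
    0, 0, 12706673247524, 0, 12706674662972, 56166003205652, 0, 0, 89217822686506, 0, 0,
    56135410465340, 56187572848142, 0, 12753855584654, 89256887299598, 0, 87863756635634,
    89256870783374, 0, 70882058029966, 0, 0, 0, 13672957976078, 0, 0, 11688337147406, 0, 0,
    5103580612082, 0, 0, 0, 0, 0]

/-- Colourings without adjacent vertices for four claws. -/
def edgeTableFour : List ℕ :=
  [20553208467656983958, 0, 94337332364161408040, 0, 75913919265992213920, 149881094260083749738,
    0, 18988994719099609940, 149159815369520961470, 149159815369521054904, 21342329800794431876,
    94337332364161224164, 0, 0, 0, 0, 0, 94337332364137974572, 0, 0, 21342329800757527844, 0,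
    21342329800758943292, 94337332364107694612, 0, 0, 21473926455792565546, 0, 0,
    93615404477991628658, 94441269253272897038, 0, 150012614372835939854, 94441302322587348494, 0,
    94404524884217648654, 150012664067671763342, 0, 94404534745025114510, 0, 0, 0,
    150028444061808827918, 0, 94468446223388350862, 94441224754037196302, 0, 149946519662797855118,
    150012589320248034830, 0, 94417534013404349966, 0, 0, 0, 94373383251531843086, 0,
    21421456762024871438, 149917234473185232398, 0, 76241945650540912142, 149917246697994831374, 0,
    119908745802800307698, 0, 0, 0, 22965257438531864078, 0, 0, 19631856540761114126, 0, 0,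
    8571980078513767922, 0, 0, 0, 0, 0]

/-- Colourings without adjacent vertices for six claws. -/
def edgeTableSix : List ℕ :=
  [34521497793550607552791958, 0, 158450492836087833490447400, 0, 127506233421793203684230560,
    251742684016709619914470250, 0, 31894219354091463986340692, 250531212451658033290139582,
    250531212451658033290233016, 35846918610627263368388996, 158450492836087833490263524, 0, 0, 0,
    0, 0, 158450492836087833467013932, 0, 0, 35846918610627263331484964, 0,
    35846918610627263332900412, 158450492836087833436733972, 0, 0, 36067822080216472146214186, 0,
    0, 157237847879350210427891570, 158563268733170308387309070, 0, 251963670866032671605872142,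
    158563268733203377701760526, 0, 158563268696425939332060686, 158563248190455597641804174, 0,
    158563248147606647505580430, 0, 0, 0, 251963670881862360578760206, 0,
    251963623238066772731076110, 158563268733125809151608334, 0, 158563248201420793655920142,
    158563248190380850218075662, 0, 158563268709435068518761998, 0, 0, 0,
    158625066897942104858347022, 0, 251963587302282104580785678, 158625122441793326511736334, 0,
    158563350467868564745274894, 251963670770664996764763662, 0, 158563367030278523040155150, 0, 0,
    0, 251990175101257550895957518, 0, 158670713771921068628755982, 158624992156415394087618062, 0,
    251852573569928302529201678, 251963545223656177852663310, 0, 158585200809396615256131086, 0, 0,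
    0, 158511044483343362740373006, 0, 35979821520743621048845838, 251803385696851941883037198, 0,
    128057191785717379271935502, 251803406229837741276710414, 0, 201400647990240666785531378, 0, 0,
    0, 38572813837815589998872078, 0, 0, 32973980355505474047493646, 0, 0,
    14397634891477405993125362, 0, 0, 0, 0, 0]

theorem goodCheck : (piece 1).GoodCheck (idx 1) realTable leftTable₁ leftTable₂
    76524284426292 56227909373726 89313658370726 56244239552332 where
  real := by decide +kernel
  left := by decide +kernel
  right := by decide +kernel
  right_one := by decide +kernel
  right_two := by decide +kernel
  left_one := by decide +kernel
  left_two := by decide +kernel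

theorem edgeCheck_one : (piece 1).EdgeCheck (idx 1) edgeTableTwo := by decide +kernel

theorem edgeCheck_three : (piece 3).EdgeCheck (idx 3) edgeTableFour := by decide +kernel

theorem edgeCheck_five : (piece 5).EdgeCheck (idx 5) edgeTableSix := by decide +kernel

theorem not_real_one (L R : Fin 3 → Fin 3) (hL : Injective L) (hR : Injective R) :
    ¬ (piece 1).Real ∅ L R :=
  Piece.not_real_of_search (idx 1) (by decide +kernel) (.inl (.inl 2))
    [.inl (.inl 6), .inl (.inl 3), .inl (.inl 5), .inl (.inl 0),
      .inr false, .inl (.inr (1, some 2)), .inl (.inl 9), .inl (.inr (0, some 2)),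
      .inl (.inr (1, none)), .inl (.inr (1, some 1)), .inl (.inr (0, some 1)), .inl (.inl 8),
      .inl (.inl 7), .inl (.inr (0, none)), .inl (.inl 1), .inl (.inl 4),
      .inl (.inr (1, some 0)), .inr true, .inl (.inr (0, some 0))]
    (by decide +kernel) L R hL hR

theorem not_real (k : ℕ) (L R : Fin 3 → Fin 3) (hL : Injective L) (hR : Injective R) :
    ¬ (piece (2 * k + 1)).Real ∅ L R := by
  induction k with
  | zero => exact not_real_one L R hL hR
  | succ k ih => exact fun h => ih (real_of_real_add_two (m := 2 * k + 1) (by lia) h)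

theorem good (k : ℕ) : (piece (2 * k + 1)).Good := by
  induction k with
  | zero => exact goodCheck.good not_real_one edgeCheck_one.real
  | succ k ih =>
    refine good_add_two (m := 2 * k + 1) (by lia) ih (not_real (k + 1)) ?_
    match k with
    | 0 => exact edgeCheck_three.real
    | 1 => exact edgeCheck_five.real
    | k + 2 => exact real_edge (m := 2 * (k + 2) + 1) (by lia) ih

end Flower

namespace Flower

variable {m : ℕ}

/-- The vertices of a claw. -/
def claw (b : Fin (m + 1)) : List (V m) :=
  [.inr (b, none), .inr (b, some 0), .inr (b, some 1), .inr (b, some 2)]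

/-- An order of the vertices which is suitable for a search. -/
def order (m : ℕ) : List (V m) :=
  claw (Fin.last m) ++ (List.finRange 10).map .inl ++
    ((List.finRange m).map Fin.castSucc).flatMap claw

theorem passes_one (T : Finset (piece 1).W) :
    6 ≤ (piece 1).cut T ∨ (piece 1).Passes T ∨ (piece 1).Passes Tᶜ :=
  Piece.passes_of_search (o := order 1) (by decide +kernel) (by decide +kernel)
    (by decide +kernel) T

theorem passes_three (T : Finset (piece 3).W) :
    6 ≤ (piece 3).cut T ∨ (piece 3).Passes T ∨ (piece 3).Passes Tᶜ :=
  Piece.passes_of_search (o := order 3) (by decide +kernel) (by decide +kernel)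
    (by decide +kernel) T

theorem passes_seven (T : Finset (piece 7).W) :
    6 ≤ (piece 7).cut T ∨ (piece 7).Passes T ∨ (piece 7).Passes Tᶜ :=
  Piece.passes_of_search (o := order 7) (by decide +kernel) (by decide +kernel)
    (by decide +kernel) T

end Flower

namespace Piece

variable {P Q : Piece} {T : Finset P.W} {U : Finset Q.W}

theorem side_congr {b : Bool} (h : ∀ s, (P.port (b, s)).1 ∈ T ↔ (Q.port (b, s)).1 ∈ U) :
    P.side b T = Q.side b U :=
  congrArg Finset.card (Finset.filter_congr fun s _ => h s)

theorem Passes.of_cut_le (hle : P.cut T ≤ Q.cut U) (hc : Q.cut U < 6)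
    (hs : ∀ b, P.side b T = Q.side b U)
    (hcard : U.card = T.card ∨ U.card = T.card + 4 ∧ 8 ≤ T.card) (h : P.Passes T) :
    Q.Passes U := by
  rw [Passes, lightTest_iff, hs, hs] at h
  rw [Passes, lightTest_iff]
  lia

end Piece

namespace Flower

variable {m : ℕ}

/-- The edges of a piece as a partial involution of half-edges. -/
def adj (d : V m × Fin 3) : Option (V m × Fin 3) := (nb d).getLeft?

/-- An enumeration of the vertices with the special ones at the end. -/
def rank : V m → ℕ
  | .inl i => 4 * (m + 1) + i
  | .inr (b, some j) => 4 * b + j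
  | .inr (b, none) => 4 * b + 3

theorem rank_injective : Injective (rank (m := m)) := by
  rintro (i | ⟨b, _ | j⟩) (i' | ⟨b', _ | j'⟩) h <;>
    simp only [rank, Sum.inl.injEq, Sum.inr.injEq, Prod.mk.injEq, Option.some.injEq,
      reduceCtorEq, and_false, and_true, ← Fin.val_inj] at h ⊢ <;> lia

/-- The part of a set in a claw. -/
def pattern (T : Finset (V m)) (b : ℕ) (o : Option (Fin 3)) : Bool :=
  if h : b < m + 1 then decide (.inr (⟨b, h⟩, o) ∈ T) else false

/-- The number of edges of a claw cut by a pattern. -/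
def spokes (q : Option (Fin 3) → Bool) : ℕ := ∑ j, if q none = q (some j) then 0 else 1

/-- The number of edges cut between consecutive claws. -/
def links (q q' : Option (Fin 3) → Bool) : ℕ := ∑ j, if q (some j) = q' (some j) then 0 else 1

/-- The number of cut edges at the special vertices. -/
def outerCut (T : Finset (V m)) : ℕ := ∑ i : Fin 10, ∑ p, backCut adj rank T (.inl i) p

theorem backCut_some {T : Finset (V m)} {w : V m} {i : Fin 3} {d : V m × Fin 3}
    (h : adj (w, i) = some d) :
    backCut adj rank T w i = if rank d.1 < rank w ∧ (w ∈ T ↔ d.1 ∉ T) then 1 else 0 := by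
  simp [backCut, h]

theorem backCut_emb {T : Finset (V m)} {w : V m} {i : Fin 3} {x : Outer} (h : (w, i) = emb m x) :
    backCut adj rank T w i = Sum.elim (fun y => if rank (emb m y).1 < rank w ∧
      (w ∈ T ↔ (emb m y).1 ∉ T) then 1 else 0) (fun _ => 0) (outerNb x) := by
  cases hx : outerNb x with
  | inl y => exact backCut_some (by simp [adj, h, nb_emb, hx])
  | inr y => simp [backCut, adj, h, nb_emb, hx]

theorem backCut_rim (T : Finset (V m)) {b : Fin (m + 1)} {j i : Fin 3} {r : Bool × Fin 3}
    (h : (.inr (b, some j), i) = emb m (.inr r)) :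
    backCut adj rank T (.inr (b, some j)) i = 0 := by
  rw [backCut_emb h]
  cases hx : outerNb (.inr r) with
  | inr y => rfl
  | inl y =>
    obtain y | y := y
    · refine if_neg fun h => absurd h.1 ?_
      simp only [emb, Sum.elim_inl, rank]
      lia
    · exact absurd hx (outerNb_rim _ _)

theorem sum_backCut_none (T : Finset (V m)) (b : Fin (m + 1)) :
    ∑ i, backCut adj rank T (.inr (b, none)) i = spokes (pattern T b) := by
  refine Finset.sum_congr rfl fun j _ => ?_
  rw [backCut_some (d := (.inr (b, some j), 0)) rfl]
  simp [rank, pattern]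
  grind

theorem backCut_zero (T : Finset (V m)) (b : Fin (m + 1)) (j : Fin 3) :
    backCut adj rank T (.inr (b, some j)) 0 = 0 := by
  rw [backCut_some (d := (.inr (b, none), j)) rfl]
  exact if_neg fun h => absurd h.1 (by simp only [rank]; lia)

theorem backCut_two (T : Finset (V m)) (b : Fin (m + 1)) (j : Fin 3) :
    backCut adj rank T (.inr (b, some j)) 2 = 0 := by
  by_cases hb : b.1 = m
  · exact backCut_rim T (r := (true, j)) (by simp [emb, ← Fin.val_inj, hb])
  · rw [backCut_some (d := (.inr (⟨b.1 + 1, by lia⟩, some j), 1)) (by simp [adj, nb_inner hb])]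
    exact if_neg fun h => absurd h.1 (by simp only [rank]; lia)

theorem backCut_one_zero (T : Finset (V m)) (j : Fin 3) :
    backCut adj rank T (.inr (0, some j)) 1 = 0 :=
  backCut_rim T (r := (false, j)) (by simp [emb])

theorem backCut_one_succ (T : Finset (V m)) (b : Fin m) (j : Fin 3) :
    backCut adj rank T (.inr (b.succ, some j)) 1 =
      if pattern T b (some j) = pattern T (b + 1) (some j) then 0 else 1 := by
  rw [backCut_some (d := (.inr (b.castSucc, some j), 2))
    (by rw [adj, nb_inner' (by simp)]; rfl)]
  have h1 : (b : ℕ) < m + 1 := by lia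
  have h2 : (⟨b.1, h1⟩ : Fin (m + 1)) = b.castSucc := rfl
  have h3 : (⟨b.1 + 1, by lia⟩ : Fin (m + 1)) = b.succ := rfl
  simp [rank, pattern, h1, h2, h3]
  grind

theorem cut_eq (T : Finset (V m)) : (piece m).cut T = outerCut T +
    (∑ b ∈ Finset.range (m + 1), spokes (pattern T b) +
      ∑ b ∈ Finset.range m, links (pattern T b) (pattern T (b + 1))) := by
  have h := pcut_eq_sum (adj := adj) (fun d d' => by
    simp only [adj, Sum.getLeft?_eq_some_iff]
    exact (piece m).nb_symm d d') rank_injective T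
  refine Eq.trans h ?_
  rw [Fintype.sum_sum_type]
  refine congrArg (outerCut T + ·) ?_
  rw [Fintype.sum_prod_type, Finset.sum_range, Finset.sum_range]
  simp_rw [Fintype.sum_option, Finset.sum_add_distrib, sum_backCut_none]
  refine congrArg (_ + ·) ?_
  simp_rw [Fin.sum_univ_three, backCut_zero, backCut_two, zero_add, add_zero]
  rw [Fin.sum_univ_succ]
  simp [backCut_one_zero, backCut_one_succ, links, Fin.sum_univ_three]

/-- The inclusion of the vertices of a piece with one claw less. -/
def skip (r : Fin (m + 2)) : V m → V (m + 1) := Sum.map id (Prod.map r.succAbove id)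

/-- The part of a set outside one claw. -/
def remove (r : Fin (m + 2)) (T : Finset (V (m + 1))) : Finset (V m) :=
  Finset.univ.filter fun w => skip r w ∈ T

theorem mem_remove {r : Fin (m + 2)} {T : Finset (V (m + 1))} {w : V m} :
    w ∈ remove r T ↔ skip r w ∈ T := by simp [remove]

theorem remove_compl (r : Fin (m + 2)) (T : Finset (V (m + 1))) :
    remove r Tᶜ = (remove r T)ᶜ := by
  ext w
  simp [mem_remove]

theorem pattern_remove (r : Fin (m + 2)) (T : Finset (V (m + 1))) (b : ℕ) :
    pattern (remove r T) b = pattern T (if b < r then b else b + 1) := by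
  funext o
  by_cases hb : b < m + 1
  · have h : skip r (.inr (⟨b, hb⟩, o)) = .inr (⟨if b < r then b else b + 1,
        by split <;> lia⟩, o) := by
      simp only [skip, Sum.map_inr, Prod.map, id, Fin.succAbove, Fin.lt_def, Fin.val_castSucc]
      congr 2
      split <;> rfl
    have h2 : (if b < r then b else b + 1) < m + 1 + 1 := by split <;> lia
    simp [pattern, hb, h2, mem_remove, h]
  · have h2 : ¬ (if b < r then b else b + 1) < m + 1 + 1 := by
      have := r.2
      split <;> lia
    simp only [pattern, hb, h2, dite_false]

theorem skip_emb {r : Fin (m + 2)} (h0 : r ≠ 0) (h1 : r ≠ Fin.last (m + 1)) (x : Outer) :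
    skip r (emb m x).1 = (emb (m + 1) x).1 := by
  obtain v | ⟨_ | _, j⟩ := x
  · rfl
  · simp [skip, emb, Fin.succAbove_ne_zero_zero h0]
  · simp [skip, emb, Fin.succAbove_ne_last_last h1]

theorem outerCut_remove {r : Fin (m + 2)} (h0 : r ≠ 0) (h1 : r ≠ Fin.last (m + 1))
    (T : Finset (V (m + 1))) : outerCut (remove r T) = outerCut T := by
  refine Finset.sum_congr rfl fun i _ => Finset.sum_congr rfl fun p _ => ?_
  rw [backCut_emb (x := .inl (i, p)) rfl, backCut_emb (x := .inl (i, p)) rfl]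
  cases outerNb (.inl (i, p)) with
  | inr y => rfl
  | inl y =>
    simp only [Sum.elim_inl, mem_remove, skip_emb h0 h1]
    have h2 : rank (emb m y).1 < rank (.inl i : V m) ↔
        rank (emb (m + 1) y).1 < rank (.inl i : V (m + 1)) := by
      obtain v | ⟨_ | _, j⟩ := y <;> simp [emb, rank] <;> lia
    simp only [h2]
    rfl

theorem side_remove {r : Fin (m + 2)} (h0 : r ≠ 0) (h1 : r ≠ Fin.last (m + 1))
    (T : Finset (V (m + 1))) (b : Bool) :
    (piece m).side b (remove r T) = (piece (m + 1)).side b T := by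
  refine Piece.side_congr fun s => ?_
  exact mem_remove.trans (iff_of_eq (congrArg (· ∈ T) (skip_emb h0 h1 (outerPort (b, s)))))

theorem card_remove (r : Fin (m + 2)) (T : Finset (V (m + 1))) :
    T.card = (remove r T).card + ∑ o, if pattern T r o then 1 else 0 := by
  have h : ∀ {k : ℕ} (T : Finset (V k)), T.card = ∑ w, if w ∈ T then 1 else 0 := by simp
  rw [h, h (remove r T), Fintype.sum_sum_type, Fintype.sum_sum_type, Fintype.sum_prod_type,
    Fintype.sum_prod_type, Fin.sum_univ_succAbove _ r]
  simp_rw [mem_remove]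
  have h2 : (r : ℕ) < m + 1 + 1 := r.2
  simp only [pattern, h2, dite_true, decide_eq_true_eq]
  exact (congrArg _ (add_comm _ _)).trans (add_assoc _ _ _).symm

theorem links_triangle (p q r : Option (Fin 3) → Bool) : links p r ≤ links p q + links q r := by
  rw [links, links, links, ← Finset.sum_add_distrib]
  refine Finset.sum_le_sum fun j _ => ?_
  split_ifs <;> simp_all

theorem cut_remove_le {r : Fin (m + 2)} (h0 : r ≠ 0) (h1 : r ≠ Fin.last (m + 1))
    (T : Finset (V (m + 1))) : (piece m).cut (remove r T) ≤ (piece (m + 1)).cut T := by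
  rw [cut_eq, cut_eq, outerCut_remove h0 h1]
  simp only [pattern_remove]
  generalize pattern T = Q
  have h2 : 0 < r.1 := Fin.pos_iff_ne_zero.2 h0
  have h3 : r.1 < m + 1 := Fin.val_lt_last h1
  obtain ⟨s, hs⟩ := Nat.exists_eq_add_of_lt h2
  obtain ⟨t, ht⟩ := Nat.exists_eq_add_of_lt h3
  generalize r.1 = r' at *
  obtain rfl : r' = s + 1 := by lia
  obtain rfl : m = s + 1 + t := by lia
  clear h0 h1 h2 h3 hs ht
  have e1 : ∀ x < s + 1, (if x < s + 1 then x else x + 1) = x := fun x hx => if_pos hx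
  have e2 : ∀ x, (if s + 1 + x < s + 1 then s + 1 + x else s + 1 + x + 1) = s + 1 + x + 1 :=
    fun x => if_neg (by lia)
  have e3 : ∀ x, (if s + 1 + x + 1 < s + 1 then s + 1 + x + 1 else s + 1 + x + 1 + 1) =
    s + 1 + x + 1 + 1 := fun x => if_neg (by lia)
  refine Nat.add_le_add_left (Nat.add_le_add ?_ ?_) _
  · rw [show s + 1 + t + 1 = (s + 1) + (t + 1) by lia,
      show s + 1 + (t + 1) + 1 = (s + 1) + ((t + 1) + 1) by lia, Finset.sum_range_add,
      Finset.sum_range_add _ (s + 1) (t + 1 + 1), Finset.sum_range_succ' _ (t + 1)]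
    refine Nat.add_le_add (Finset.sum_le_sum fun x hx => ?_) ?_
    · rw [e1 x (Finset.mem_range.1 hx)]
    · refine le_add_right (Finset.sum_le_sum fun x _ => ?_)
      rw [e2, add_assoc (s + 1)]
  · rw [show s + 1 + t + 1 = s + 1 + (t + 1) by lia, Finset.sum_range_add,
      Finset.sum_range_add _ (s + 1), Finset.sum_range_succ _ s, Finset.sum_range_succ _ s,
      Finset.sum_range_succ' _ t]
    have h1 : ∑ x ∈ Finset.range s, links (Q (if x < s + 1 then x else x + 1))
        (Q (if x + 1 < s + 1 then x + 1 else x + 1 + 1)) =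
          ∑ x ∈ Finset.range s, links (Q x) (Q (x + 1)) := by
      refine Finset.sum_congr rfl fun x hx => ?_
      have := Finset.mem_range.1 hx
      rw [e1 x (by lia), e1 (x + 1) (by lia)]
    have h2 := links_triangle (Q s) (Q (s + 1)) (Q (s + 1 + 1))
    have h3 : ∑ x ∈ Finset.range t, links (Q (s + 1 + x + 1)) (Q (s + 1 + x + 1 + 1)) =
        ∑ x ∈ Finset.range t, links (Q (s + 1 + (x + 1))) (Q (s + 1 + (x + 1) + 1)) := rfl
    simp only [e2, e3]
    rw [h1, h3, if_pos (Nat.lt_succ_self s), if_neg (Nat.lt_irrefl (s + 1)), add_zero]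
    lia

/-- All vertices of three consecutive claws are on the same side. -/
def Constant (T : Finset (V m)) (b : ℕ) : Prop :=
  ∀ i < 3, ∀ o, pattern T (b + i) o = pattern T b none

theorem two_le_or_eq (p q r : Option (Fin 3) → Bool) :
    2 ≤ spokes p + spokes q + spokes r + links p q + links q r ∨
      ∀ o, p o = p none ∧ q o = p none ∧ r o = p none := by
  have h : ∀ a b c d a' b' c' d' a'' b'' c'' d'' : Bool,
      2 ≤ (([b, c, d].map fun x => if a = x then 0 else 1).sum +
        ([b', c', d'].map fun x => if a' = x then 0 else 1).sum +
        ([b'', c'', d''].map fun x => if a'' = x then 0 else 1).sum +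
        ([(b, b'), (c, c'), (d, d'), (b', b''), (c', c''), (d', d'')].map
          fun x => if x.1 = x.2 then 0 else 1).sum) ∨
      ∀ x ∈ [b, c, d, a', b', c', d', a'', b'', c'', d''], x = a := by
    decide +kernel
  obtain h | h := h (p none) (p (some 0)) (p (some 1)) (p (some 2)) (q none) (q (some 0))
    (q (some 1)) (q (some 2)) (r none) (r (some 0)) (r (some 1)) (r (some 2))
  · refine .inl (h.trans (le_of_eq ?_))
    simp only [List.map_cons, List.map_nil, List.sum_cons, List.sum_nil, spokes, links,
      Fin.sum_univ_three]
    lia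
  · refine .inr fun o => ?_
    simp only [List.forall_mem_cons] at h
    obtain _ | j := o
    · tauto
    · fin_cases j <;> simp <;> tauto

theorem six_le_cut_or_constant (h : 8 ≤ m) (T : Finset (V m)) : 6 ≤ (piece m).cut T ∨
    ∃ b, b + 2 ≤ m ∧ Constant T b := by
  by_contra! hc
  have key : ∀ b, b + 2 ≤ m → 2 ≤ spokes (pattern T b) + spokes (pattern T (b + 1)) +
      spokes (pattern T (b + 2)) + links (pattern T b) (pattern T (b + 1)) +
        links (pattern T (b + 1)) (pattern T (b + 2)) := by
    intro b hb
    refine (two_le_or_eq _ _ _).resolve_right fun h => hc.2 b hb fun i hi o => ?_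
    obtain ⟨h1, h2, h3⟩ := h o
    interval_cases i
    · exact h1
    · exact h2
    · exact h3
  have h0 := key 0 (by lia)
  have h3 := key 3 (by lia)
  have h6 := key 6 (by lia)
  obtain ⟨k, rfl⟩ := Nat.exists_eq_add_of_le h
  have h := hc.1
  rw [cut_eq, show 8 + k + 1 = 9 + k by lia, Finset.sum_range_add, Finset.sum_range_add] at h
  simp only [Finset.sum_range_succ, Finset.sum_range_zero] at h
  lia

theorem Constant.compl {T : Finset (V m)} {b : ℕ} (hb : b + 2 ≤ m) (h : Constant T b) :
    Constant (Tᶜ : Finset (V m)) b := by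
  intro i hi o
  have h1 : b < m + 1 := by lia
  have h2 : b + i < m + 1 := by lia
  have := h i hi o
  simp only [pattern, h1, h2, dite_true, decide_eq_decide] at this
  simp [pattern, h1, h2, this]

theorem passes_of_remove {r : ℕ} (hr : r + 2 ≤ m + 1) (T : Finset (V (m + 1)))
    (hT : Constant T r) (hc : (piece (m + 1)).cut T < 6)
    (h : (piece m).Passes (remove ⟨r + 1, by lia⟩ T)) : (piece (m + 1)).Passes T := by
  have h0 : (⟨r + 1, by lia⟩ : Fin (m + 2)) ≠ 0 := by simp [← Fin.val_inj]
  have h1 : (⟨r + 1, by lia⟩ : Fin (m + 2)) ≠ Fin.last (m + 1) := by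
    simp only [ne_eq, ← Fin.val_inj, Fin.val_last]
    lia
  have h2 := cut_remove_le h0 h1 T
  have h3 := card_remove ⟨r + 1, by lia⟩ T
  have h4 : T.card = (remove ⟨r + 1, by lia⟩ T).card ∨
      T.card = (remove ⟨r + 1, by lia⟩ T).card + 4 ∧ 8 ≤ (remove ⟨r + 1, by lia⟩ T).card := by
    simp only [hT 1 (by lia)] at h3
    cases hp : pattern T r none with
    | false => exact .inl (by simpa [hp] using h3)
    | true =>
      refine .inr ⟨by simpa [hp] using h3, ?_⟩
      have hsub : (Finset.univ : Finset (Bool × Option (Fin 3))).map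
          ⟨fun p => (.inr (⟨cond p.1 r (r + 1), by cases p.1 <;> simp <;> lia⟩, p.2) : V m), by
            rintro ⟨_ | _, o⟩ ⟨_ | _, o'⟩ <;> simp [← Fin.val_inj]⟩ ⊆ remove ⟨r + 1, by lia⟩ T := by
        intro w hw
        obtain ⟨⟨b, o⟩, -, rfl⟩ := Finset.mem_map.1 hw
        have key : pattern (remove ⟨r + 1, by lia⟩ T) (cond b r (r + 1)) o = true := by
          rw [pattern_remove]
          cases b
          · simpa [hp] using hT 2 (by lia) o
          · simpa [hp] using hT 0 (by lia) o
        have hlt : cond b r (r + 1) < m + 1 := by cases b <;> simp <;> lia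
        simp only [pattern, hlt, dite_true, decide_eq_true_eq] at key
        exact key
      simpa using Finset.card_le_card hsub
  exact Piece.Passes.of_cut_le h2 hc (side_remove h0 h1 T) h4 h

theorem passes (h : 7 ≤ m) (T : Finset (V m)) :
    6 ≤ (piece m).cut T ∨ (piece m).Passes T ∨ (piece m).Passes (Tᶜ : Finset (V m)) := by
  induction m, h using Nat.le_induction with
  | base => exact passes_seven T
  | succ m h ih =>
    obtain h1 | ⟨r, hr, hT⟩ := six_le_cut_or_constant (m := m + 1) (by lia) T
    · exact .inl h1
    by_cases hc : 6 ≤ (piece (m + 1)).cut T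
    · exact .inl hc
    have h0 : (⟨r + 1, by lia⟩ : Fin (m + 2)) ≠ 0 := by simp [← Fin.val_inj]
    have h1 : (⟨r + 1, by lia⟩ : Fin (m + 2)) ≠ Fin.last (m + 1) := by
      simp only [ne_eq, ← Fin.val_inj, Fin.val_last]
      lia
    obtain h | h | h := ih (remove ⟨r + 1, by lia⟩ T)
    · exact absurd (h.trans (cut_remove_le h0 h1 T)) hc
    · exact .inr (.inl (passes_of_remove hr T hT (not_le.1 hc) h))
    · refine .inr (.inr (passes_of_remove hr _ (hT.compl hr) ?_ ?_))
      · exact (Piece.cut_compl (P := piece (m + 1)) T).trans_lt (not_le.1 hc)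
      · rwa [remove_compl]

theorem solid {k : ℕ} (h : k = 0 ∨ k = 1 ∨ 3 ≤ k) : (piece (2 * k + 1)).Solid := by
  refine Piece.solid_of_passes ?_
  obtain rfl | rfl | h := h
  · exact passes_one
  · exact passes_three
  · exact fun T => passes (m := 2 * k + 1) (by lia) T

end Flower

section Transport

variable {V W : Type*} {G : SimpleGraph V} {H : SimpleGraph W}

theorem ThreeEdgeColorable.of_hom (h : ThreeEdgeColorable H) (f : G →g H) (hf : Injective f) :
    ThreeEdgeColorable G := by
  obtain ⟨c, hc⟩ := h
  refine ⟨fun e => c (e.map f), fun e₁ h₁ e₂ h₂ hne ⟨v, hv₁, hv₂⟩ => ?_⟩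
  exact hc _ (f.map_mem_edgeSet h₁) _ (f.map_mem_edgeSet h₂)
    (fun h => hne (Sym2.map.injective hf h)) ⟨f v, Sym2.mem_map.2 ⟨v, hv₁, rfl⟩,
      Sym2.mem_map.2 ⟨v, hv₂, rfl⟩⟩

theorem ThreeEdgeColorable.induce_pair_of_iso (e : G ≃g H) {u v : W}
    (h : ThreeEdgeColorable (G.induce ({e.symm u, e.symm v}ᶜ : Set V))) :
    ThreeEdgeColorable (H.induce ({u, v}ᶜ : Set W)) := by
  refine h.of_hom (SimpleGraph.induceHom e.symm.toHom fun w hw => ?_)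
    (SimpleGraph.induceHom_injective _ _ e.symm.injective.injOn)
  simpa using hw

theorem IsCubic.of_iso (e : G ≃g H) (h : IsCubic G) : IsCubic H := by
  intro v
  rw [← h (e.symm v), ← Nat.card_coe_set_eq, ← Nat.card_coe_set_eq]
  exact Nat.card_congr (e.symm.mapNeighborSet v)

theorem IsSnark.of_iso (e : G ≃g H) (h : IsSnark G) : IsSnark H :=
  ⟨e.connected_iff.1 h.1, h.2.1.of_iso e, fun hH => h.2.2 (hH.of_hom e.toHom e.injective)⟩

theorem StrictlyCritical.of_iso (e : G ≃g H) (h : StrictlyCritical G) : StrictlyCritical H := by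
  refine ⟨fun u v huv => (h.1 _ _ (e.symm.map_adj_iff.2 huv)).induce_pair_of_iso e,
    fun hH => h.2 fun u v huv => ?_⟩
  exact (hH (e u) (e v) (e.injective.ne huv)).induce_pair_of_iso e.symm

theorem CyclicallyConnected.of_iso {k : ℕ} (e : G ≃g H) (h : CyclicallyConnected G k) :
    CyclicallyConnected H k := by
  rintro ⟨F, hF, hk, a, b, ⟨w, hw⟩, ⟨w', hw'⟩, hab⟩
  let f : H.deleteEdges F ≃g G.deleteEdges (Sym2.map e ⁻¹' F) :=
    { toEquiv := e.symm.toEquiv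
      map_rel_iff' := by
        intro u v
        simp only [SimpleGraph.deleteEdges_adj, Set.mem_preimage, Sym2.map_mk]
        refine and_congr e.symm.map_adj_iff ?_
        simp }
  refine h ⟨_, ?_, ?_, f a, f b, ⟨w.map f.toHom, ?_⟩, ⟨w'.map f.toHom, ?_⟩, ?_⟩
  · intro x hx
    exact e.map_mem_edgeSet_iff.1 (hF hx)
  · rwa [Set.ncard_preimage_of_injective_subset_range (Sym2.map.injective e.injective)]
    intro x _
    exact ⟨x.map e.symm, by simp [Sym2.map_map]⟩
  · exact hw.map f.injective
  · exact hw'.map f.injective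
  · exact fun h => hab (f.reachable_iff.1 h)

end Transport

/-- The number of pairs of additional claws used in the `i`-th piece. -/
def extraClaws (k i : ℕ) : ℕ :=
  if k < 4 then (if 15 ≤ i + k then 1 else 0) else if i = 14 then k else 0

/-- A choice of pieces with `270 + 10 * a + 8 * k` vertices in total. -/
def pieces (a k : ℕ) (i : Fin 15) : Piece :=
  if i < a then DoubleStar.piece else Flower.piece (2 * extraClaws k i + 1)

theorem pieces_good (a k : ℕ) (i : Fin 15) : (pieces a k i).Good := by
  unfold pieces
  split
  · exact DoubleStar.good
  · exact Flower.good _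

theorem pieces_solid (a k : ℕ) (i : Fin 15) : (pieces a k i).Solid := by
  unfold pieces
  split
  · exact DoubleStar.solid
  · refine Flower.solid ?_
    unfold extraClaws
    split_ifs <;> lia

theorem card_pieces (a k : ℕ) (i : Fin 15) :
    Fintype.card (pieces a k i).W = if i < a then 28 else 18 + 8 * extraClaws k i := by
  have h1 : Fintype.card DoubleStar.piece.W = 28 := Fintype.card_fin 28
  have h2 : ∀ m, Fintype.card (Flower.piece m).W = 10 + (m + 1) * 4 := fun m => by
    change Fintype.card (Flower.V m) = _
    simp
  unfold pieces
  split_ifs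
  · exact h1
  · rw [h2]
    lia

theorem card_vtx_pieces {a : ℕ} (ha : a < 4) (k : ℕ) :
    Fintype.card (Vtx (pieces a k)) = 306 + 10 * a + 8 * k := by
  have h : ∑ i : Fin 15, (if (i : ℕ) < a then 28 else 18 + 8 * extraClaws k i) =
      270 + 10 * a + 8 * k := by
    by_cases hk : k < 4
    · interval_cases a <;> interval_cases k <;> decide
    · have h1 : ∀ i : Fin 14, (if (i.castSucc : ℕ) < a then 28 else
          18 + 8 * extraClaws k i.castSucc) = if (i : ℕ) < a then 28 else 18 := fun i => by
        have : (i : ℕ) ≠ 14 := by lia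
        simp [extraClaws, hk, this]
      have h2 : ∑ i : Fin 14, (if (i : ℕ) < a then 28 else 18) = 252 + 10 * a := by
        interval_cases a <;> decide
      have h3 : ¬ 14 < a := by lia
      rw [Fin.sum_univ_castSucc, Finset.sum_congr rfl fun i _ => h1 i, h2]
      simp only [extraClaws, hk, Fin.val_last, h3, if_false, if_true]
      lia
  rw [Fintype.card_sum, Fintype.card_sum, Fintype.card_sigma,
    Finset.sum_congr rfl fun i _ => card_pieces a k i, h, Fintype.card_fin, Fintype.card_fin]
  lia

section Snark

variable {P : Fin 15 → Piece}

theorem not_threeEdgeColorable_induce_pair (hP : ∀ i, (P i).Good) : ¬ ThreeEdgeColorable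
    ((assemble P).toGraph.induce ({.inl 14, .inl 9}ᶜ : Set (Vtx P))) := by
  rw [DartGraph.threeEdgeColorable_induce_compl]
  rintro ⟨h, hh⟩
  exact not_isCol_pair hP h hh

theorem isSnark_assemble (hP : ∀ i, (P i).Good) (hS : ∀ i, (P i).Solid) :
    IsSnark (assemble P).toGraph := by
  have : Nonempty (Vtx P) := ⟨.inl 0⟩
  refine ⟨(assemble P).connected (Vtx.not_isBad hS), (assemble P).isCubic, fun h => ?_⟩
  exact not_threeEdgeColorable_induce_pair hP
    (h.of_hom (SimpleGraph.Embedding.induce _).toHom Subtype.val_injective)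

theorem strictlyCritical_assemble (hP : ∀ i, (P i).Good) :
    StrictlyCritical (assemble P).toGraph := by
  refine ⟨?_, fun h => not_threeEdgeColorable_induce_pair hP (h _ _ (by simp))⟩
  rintro u v ⟨i, rfl⟩
  rw [DartGraph.threeEdgeColorable_induce_compl]
  exact exists_isCol_adj hP (u, i)

end Snark

/-- For every even integer `n ≥ 342` there exists a cyclically
6-connected strictly critical snark of order `n`. -/
theorem exists_cyclically6Connected_strictlyCritical_snark_of_even
    (n : ℕ) (hn : Even n) (hn342 : 342 ≤ n) :
    ∃ G : SimpleGraph (Fin n),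
      IsSnark G ∧ CyclicallyConnected G 6 ∧ StrictlyCritical G := by
  obtain ⟨a, k, ha, hak⟩ : ∃ a k, a < 4 ∧ 306 + 10 * a + 8 * k = n := by
    obtain ⟨r, rfl⟩ := hn
    exact ⟨(r - 153) % 4, (r - 153 - 5 * ((r - 153) % 4)) / 4, by lia, by lia⟩
  let e := SimpleGraph.Iso.map
    (Fintype.equivFinOfCardEq ((card_vtx_pieces ha k).trans hak)) (assemble (pieces a k)).toGraph
  have hG := pieces_good a k
  have hS := pieces_solid a k
  exact ⟨_, (isSnark_assemble hG hS).of_iso e,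
    ((assemble (pieces a k)).cyclicallyConnected_six (Vtx.not_isBad hS)).of_iso e,
    (strictlyCritical_assemble hG).of_iso e⟩
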